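/- Fix a positive integer k. There is a constant C = C(k) such that for all sufficiently large x, Σ_d |(1/#Ω_x)·#{n ∈ Ω_x : d | s(n)} − 1/d| ≤ C·(log log x)^C / log x, where the sum is over squarefree integers d with at most k prime factors, all of whose prime factors p satisfy (log x)² < p ≤ x^{1/log₃ x}, and Ω_x = {n ≤ x : n composite, P⁺(n) > x^{1/log₄ x}, P⁺(n)² ∤ n}. -/

import Mathlib

open Filter

/-- `maxPrimeFac n` is the largest prime factor `P⁺(n)` of `n`, with `P⁺(1) = 1`. -/
def maxPrimeFac (n : ℕ) : ℕ := if n = 1 then 1 else n.primeFactors.sup id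

/-- The set `Ω_x` of composite `n ≤ x` with `P⁺(n) > x^{1/log₄ x}` and `P⁺(n)² ∤ n`. -/
noncomputable def OmegaSet (x : ℝ) : Finset ℕ :=
  (Finset.Icc 2 ⌊x⌋₊).filter (fun n : ℕ =>
    ¬ n.Prime ∧
    (maxPrimeFac n : ℝ) > x ^ (1 / Real.log (Real.log (Real.log (Real.log x)))) ∧
    ¬ (maxPrimeFac n) ^ 2 ∣ n)

/-- `s(n) = σ(n) − n`, the sum of the proper divisors of `n`. -/
def sOf (n : ℕ) : ℕ := ∑ d ∈ n.properDivisors, d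

namespace LevelOfDistribution
open Finset

/-! ### Sums over primes -/

lemma card_primesLE_le {y : ℝ} (hy : 1 < y) :
    (#(Nat.primesLE ⌊y⌋₊) : ℝ) ≤ 5 * y / Real.log y := by
  have h := Chebyshev.pi_le_log4_mul_div hy
  have hl : 0 < Real.log y := Real.log_pos hy
  have hy0 : 0 ≤ y := by linarith
  have hs : 0 < √y := Real.sqrt_pos.2 (by linarith)
  rw [Nat.primesLE_card_eq_primeCounting]
  have h1 : Real.log √y ≤ √y - 1 := Real.log_le_sub_one_of_pos hs
  rw [Real.log_sqrt hy0] at h h1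
  have h4 : Real.log 4 ≤ 1.39 := by
    have : (4 : ℝ) = 2 ^ 2 := by norm_num
    rw [this, Real.log_pow]
    have := Real.log_two_lt_d9
    push_cast
    linarith
  refine h.trans ?_
  rw [le_div_iff₀ hl]
  have h2 : √y * √y = y := Real.mul_self_sqrt hy0
  have h3 : (Real.log 4 * y / (Real.log y / 2) + √y) * Real.log y
      = 2 * Real.log 4 * y + √y * Real.log y := by field_simp
  rw [h3]
  nlinarith

/-- The upper bound in Mertens' first theorem. -/
lemma sum_log_div_primesLE_le {n : ℕ} (hn : 1 ≤ n) :
    ∑ p ∈ Nat.primesLE n, Real.log p / p ≤ Real.log n + Real.log 4 := by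
  have hn0 : (0 : ℝ) < n := by exact_mod_cast hn
  have h1 : ∑ p ∈ Nat.primesLE n, Real.log p * ((n / p : ℕ) : ℝ) ≤ n * Real.log n := by
    calc ∑ p ∈ Nat.primesLE n, Real.log p * ((n / p : ℕ) : ℝ)
        = ∑ p ∈ Nat.primesLE n, ∑ m ∈ Icc 1 n, if p ∣ m then Real.log p else 0 := by
          refine sum_congr rfl fun p hp => ?_
          rw [← sum_filter, sum_const, nsmul_eq_mul, mul_comm]
          congr 2
          rw [← Nat.card_multiples' n p]
          congr 1
          ext m
          simp only [mem_filter, mem_range, mem_Icc]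
          omega
      _ = ∑ m ∈ Icc 1 n, ∑ p ∈ Nat.primesLE n, if p ∣ m then Real.log p else 0 := sum_comm
      _ ≤ ∑ m ∈ Icc 1 n, Real.log n := by
          refine sum_le_sum fun m hm => ?_
          rw [mem_Icc] at hm
          rw [← sum_filter]
          have hsub : (Nat.primesLE n).filter (· ∣ m) = m.primeFactors := by
            ext p
            simp only [mem_filter, Nat.mem_primesLE, Nat.mem_primeFactors]
            constructor
            · rintro ⟨⟨_, hp⟩, hd⟩
              exact ⟨hp, hd, by omega⟩
            · rintro ⟨hp, hd, _⟩
              exact ⟨⟨(Nat.le_of_dvd (by omega) hd).trans hm.2, hp⟩, hd⟩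
          rw [hsub, ← Real.log_prod (fun p hp => by
            exact_mod_cast (Nat.prime_of_mem_primeFactors hp).ne_zero)]
          have hle : ∏ p ∈ m.primeFactors, p ≤ n :=
            (Nat.le_of_dvd (by omega) (Nat.prod_primeFactors_dvd m)).trans hm.2
          rw [← Nat.cast_prod]
          have hpos : 0 < ∏ p ∈ m.primeFactors, p :=
            Finset.prod_pos fun p hp => (Nat.prime_of_mem_primeFactors hp).pos
          exact Real.log_le_log (by exact_mod_cast hpos) (by exact_mod_cast hle)
      _ = n * Real.log n := by simp
  have h2 : ∑ p ∈ Nat.primesLE n, Real.log p ≤ Real.log 4 * n := by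
    rw [← Chebyshev.theta_eq_sum_primesLE_log]
    exact Chebyshev.theta_le_log4_mul_x hn0.le
  have h3 : n * ∑ p ∈ Nat.primesLE n, Real.log p / p
      ≤ ∑ p ∈ Nat.primesLE n, (Real.log p * ((n / p : ℕ) : ℝ) + Real.log p) := by
    rw [mul_sum]
    refine sum_le_sum fun p hp => ?_
    have hp0 : (0 : ℝ) < p := by exact_mod_cast (Nat.prime_of_mem_primesLE hp).pos
    have hlp : 0 ≤ Real.log p := Real.log_natCast_nonneg p
    have hd : (n : ℝ) / p ≤ ((n / p : ℕ) : ℝ) + 1 := by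
      rw [div_le_iff₀ hp0]
      have h := Nat.div_add_mod n p
      have h' := Nat.mod_lt n (Nat.prime_of_mem_primesLE hp).pos
      have : n ≤ (n / p + 1) * p := by rw [add_mul, mul_comm (n / p)]; omega
      exact_mod_cast this
    calc n * (Real.log p / p) = Real.log p * (n / p) := by ring
      _ ≤ Real.log p * (((n / p : ℕ) : ℝ) + 1) := by gcongr
      _ = _ := by ring
  rw [sum_add_distrib] at h3
  have h4 : n * ∑ p ∈ Nat.primesLE n, Real.log p / p ≤ n * (Real.log n + Real.log 4) := by
    linarith
  exact le_of_mul_le_mul_left h4 hn0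

private lemma sum_inv_primesLE_exp_two_pow_le (j : ℕ) :
    ∑ p ∈ Nat.primesLE ⌊Real.exp (2 ^ j)⌋₊, (1 : ℝ) / p ≤ 4 * j + 1 := by
  induction j with
  | zero =>
    have : ⌊Real.exp (2 ^ 0)⌋₊ = 2 := by
      rw [Nat.floor_eq_iff (Real.exp_pos _).le]
      have := Real.exp_one_gt_d9
      have := Real.exp_one_lt_d9
      norm_num
      constructor <;> linarith
    rw [this]
    have h2 : Nat.primesLE 2 = {2} := by decide
    rw [h2]
    norm_num
  | succ j ih =>
    set a := ⌊Real.exp (2 ^ j)⌋₊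
    set b := ⌊Real.exp (2 ^ (j + 1))⌋₊
    have hab : a ≤ b := Nat.floor_le_floor (Real.exp_le_exp.2 (by
      exact pow_le_pow_right₀ (by norm_num) (by omega)))
    have hb1 : 1 ≤ b := Nat.le_floor (by simp)
    have hpos : (0 : ℝ) < 2 ^ j := by positivity
    have hb : Real.log b ≤ 2 ^ (j + 1) := by
      have : (b : ℝ) ≤ Real.exp (2 ^ (j + 1)) := Nat.floor_le (Real.exp_pos _).le
      calc Real.log b ≤ Real.log (Real.exp (2 ^ (j + 1))) :=
            Real.log_le_log (by exact_mod_cast hb1) this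
        _ = _ := Real.log_exp _
    have h4 : Real.log 4 ≤ 1.39 := by
      have : (4 : ℝ) = 2 ^ 2 := by norm_num
      rw [this, Real.log_pow]
      have := Real.log_two_lt_d9
      push_cast
      linarith
    have hM := sum_log_div_primesLE_le hb1
    have hsub : Nat.primesLE a ⊆ Nat.primesLE b := Nat.primesLE_mono hab
    rw [← sum_sdiff hsub]
    have hnew : ∑ p ∈ Nat.primesLE b \ Nat.primesLE a, (1 : ℝ) / p
        ≤ (∑ p ∈ Nat.primesLE b, Real.log p / p) / 2 ^ j := by
      rw [le_div_iff₀ hpos, sum_mul]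
      refine (sum_le_sum fun p hp => ?_).trans
        (sum_le_sum_of_subset_of_nonneg sdiff_subset fun p _ _ =>
          div_nonneg (Real.log_natCast_nonneg p) (Nat.cast_nonneg p))
      rw [Finset.mem_sdiff, Nat.mem_primesLE, Nat.mem_primesLE] at hp
      obtain ⟨⟨hpb, hpp⟩, hpa⟩ := hp
      have hap : a < p := by
        by_contra h
        exact hpa ⟨by omega, hpp⟩
      have h2 : (2 : ℝ) ^ j ≤ Real.log p := by
        rw [Real.le_log_iff_exp_le (by exact_mod_cast hpp.pos)]
        exact (Nat.lt_of_floor_lt hap).le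
      rw [one_div, inv_mul_eq_div]
      gcongr
    have h5 : (∑ p ∈ Nat.primesLE b, Real.log p / p) / 2 ^ j ≤ 4 := by
      rw [div_le_iff₀ hpos]
      have h1 : (1 : ℝ) ≤ 2 ^ j := one_le_pow₀ (by norm_num)
      rw [pow_succ] at hb
      linarith
    push_cast
    linarith

/-- An upper bound of the order of magnitude in Mertens' second theorem. -/
lemma sum_inv_primesLE_le {x : ℝ} (hx : 1 ≤ Real.log (Real.log x)) :
    ∑ p ∈ Nat.primesLE ⌊x⌋₊, (1 : ℝ) / p ≤ 11 * Real.log (Real.log x) := by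
  by_cases hx0 : 1 < x
  swap
  · have : Nat.primesLE ⌊x⌋₊ = ∅ := by
      have hf : ⌊x⌋₊ ≤ 1 := Nat.floor_le_of_le (by simpa using not_lt.1 hx0)
      rw [← Finset.subset_empty, ← Nat.primesLE_one]
      exact Nat.primesLE_mono hf
    rw [this, sum_empty]
    linarith
  have hl : 0 < Real.log x := Real.log_pos hx0
  set L := Real.log (Real.log x)
  have hlog2 : 0.69 < Real.log 2 := by linarith [Real.log_two_gt_d9]
  set j := ⌈L / Real.log 2⌉₊
  have hj1 : L / Real.log 2 ≤ j := Nat.le_ceil _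
  have hj2 : (j : ℝ) < L / Real.log 2 + 1 := Nat.ceil_lt_add_one (by positivity)
  have hxj : x ≤ Real.exp (2 ^ j) := by
    rw [← Real.log_le_iff_le_exp (by linarith), ← Real.exp_log hl,
      ← Real.rpow_natCast, Real.rpow_def_of_pos (by norm_num)]
    refine Real.exp_le_exp.2 ?_
    rw [div_le_iff₀ (by linarith)] at hj1
    linarith
  have hLj : L / Real.log 2 ≤ 1.45 * L := by
    rw [div_le_iff₀ (by linarith)]
    nlinarith
  calc ∑ p ∈ Nat.primesLE ⌊x⌋₊, (1 : ℝ) / p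
      ≤ ∑ p ∈ Nat.primesLE ⌊Real.exp (2 ^ j)⌋₊, (1 : ℝ) / p :=
        sum_le_sum_of_subset_of_nonneg (Nat.primesLE_mono (Nat.floor_le_floor hxj))
          fun _ _ _ => by positivity
    _ ≤ 4 * j + 1 := sum_inv_primesLE_exp_two_pow_le j
    _ ≤ 11 * L := by linarith

/-- A bound for the reciprocal sum over integers without prime factors above `z`. -/
lemma sum_inv_le_of_forall_prime_le (S : Finset ℕ) (z : ℕ)
    (hS : ∀ m ∈ S, ∀ p, p.Prime → p ∣ m → p ≤ z) :
    ∑ m ∈ S, (1 : ℝ) / m ≤ Real.exp (2 * ∑ p ∈ Nat.primesLE z, (1 : ℝ) / p) := by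
  let f : ℕ →* ℝ :=
    { toFun := fun n => (n : ℝ)⁻¹
      map_one' := by simp
      map_mul' := fun a b => by simp [mul_comm] }
  have hf : ∀ {p : ℕ}, p.Prime → ‖f p‖ < 1 := fun {p} hp => by
    have : (1 : ℝ) < p := by exact_mod_cast hp.one_lt
    simp only [f, MonoidHom.coe_mk, OneHom.coe_mk, norm_inv, Real.norm_natCast]
    exact inv_lt_one_of_one_lt₀ this
  obtain ⟨hs, hsum⟩ :=
    EulerProduct.summable_and_hasSum_smoothNumbers_prod_primesBelow_geometric hf (z + 1)
  have hmem : ∀ m ∈ S, m ∈ (z + 1).smoothNumbers := fun m hm => by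
    rw [Nat.mem_smoothNumbers']
    exact fun p hp hd => Nat.lt_succ_of_le (hS m hm p hp hd)
  have h1 : ∑ m ∈ S, (1 : ℝ) / m ≤ ∏ p ∈ (z + 1).primesBelow, (1 - f p)⁻¹ := by
    rw [← hsum.tsum_eq]
    have : ∑ m ∈ S, (1 : ℝ) / m
        = ∑ m ∈ S.subtype (· ∈ (z + 1).smoothNumbers), f (m : ℕ) := by
      rw [sum_subtype_of_mem (f := fun m => f m) hmem]
      exact sum_congr rfl fun m _ => by simp [f]
    rw [this]
    exact hsum.summable.sum_le_tsum _ fun i _ => by simp [f]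
  refine h1.trans ?_
  rw [mul_sum, Real.exp_sum]
  refine prod_le_prod (fun p hp => ?_) fun p hp => ?_
  · exact inv_nonneg.2 (sub_nonneg.2 ((le_abs_self _).trans
      (hf (Nat.prime_of_mem_primesBelow hp)).le))
  · have hp2 : (2 : ℝ) ≤ p := by exact_mod_cast (Nat.prime_of_mem_primesBelow hp).two_le
    have hp0 : (0 : ℝ) < p := by linarith
    simp only [f, MonoidHom.coe_mk, OneHom.coe_mk]
    have h2 : (p : ℝ)⁻¹ ≤ 1 / 2 := by
      rw [one_div]; exact inv_anti₀ (by norm_num) hp2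
    have h3 : 0 < (p : ℝ)⁻¹ := inv_pos.2 hp0
    calc (1 - (p : ℝ)⁻¹)⁻¹ ≤ 1 + 2 * (1 / p) := by
          rw [inv_le_iff_one_le_mul₀ (by linarith), one_div]
          nlinarith
      _ ≤ _ := by linarith [Real.add_one_le_exp (2 * (1 / (p : ℝ)))]

/-- Few integers up to `n` have only prime factors up to `y`. -/
lemma sum_log_le_of_forall_prime_le (S : Finset ℕ) {n y : ℕ} (hy : 1 ≤ y) (hSn : S ⊆ Icc 1 n)
    (hS : ∀ m ∈ S, ∀ p, p.Prime → p ∣ m → p ≤ y) :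
    ∑ m ∈ S, Real.log m ≤ 2 * n * (Real.log y + Real.log 4) := by
  have h1 : ∀ m ∈ S, Real.log m = ∑ p ∈ Nat.primesLE y, (m.factorization p : ℝ) * Real.log p := by
    intro m hm
    have hm0 : m ≠ 0 := by have := mem_Icc.1 (hSn hm); omega
    have hsub : m.primeFactors ⊆ Nat.primesLE y := fun p hp => by
      rw [Nat.mem_primesLE]
      exact ⟨hS m hm p (Nat.prime_of_mem_primeFactors hp) (Nat.dvd_of_mem_primeFactors hp),
        Nat.prime_of_mem_primeFactors hp⟩
    conv_lhs => rw [← Nat.prod_factorization_pow_eq_self hm0]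
    rw [Finsupp.prod, Nat.cast_prod, Real.log_prod (fun p hp => by
      have := (Nat.prime_of_mem_primeFactors (Nat.support_factorization m ▸ hp)).ne_zero
      positivity), Nat.support_factorization]
    rw [← sum_subset hsub]
    · exact sum_congr rfl fun p _ => by simp
    · intro p _ hp
      rw [← Nat.support_factorization, Finsupp.notMem_support_iff] at hp
      simp [hp]
  have h2 : ∀ p ∈ Nat.primesLE y, ∑ m ∈ S, (m.factorization p : ℝ) ≤ 2 * n / p := by
    intro p hp
    have hpp := Nat.prime_of_mem_primesLE hp
    have hfact : ∑ m ∈ Icc 1 n, m.factorization p = (n.factorial).factorization p := by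
      rw [← prod_Ico_id_eq_factorial, Nat.factorization_prod (fun m hm => by
        have := mem_Ico.1 hm; omega)]
      rw [show Ico 1 (n + 1) = Icc 1 n from by ext; simp]
      simp
    have hle : (p - 1) * (n.factorial).factorization p ≤ n := by
      rw [Nat.sub_one_mul_factorization_factorial hpp]
      omega
    have hp2 : (2 : ℝ) ≤ p := by exact_mod_cast hpp.two_le
    have hle' : ((p : ℝ) - 1) * (n.factorial).factorization p ≤ n := by
      have : (((p - 1 : ℕ) : ℝ)) = p - 1 := by rw [Nat.cast_sub hpp.one_le]; simp
      rw [← this]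
      exact_mod_cast hle
    calc ∑ m ∈ S, (m.factorization p : ℝ) ≤ ∑ m ∈ Icc 1 n, (m.factorization p : ℝ) :=
          sum_le_sum_of_subset_of_nonneg hSn fun _ _ _ => by positivity
      _ = (n.factorial).factorization p := by exact_mod_cast hfact
      _ ≤ 2 * n / p := by
        rw [le_div_iff₀ (by linarith)]
        have : (0 : ℝ) ≤ (n.factorial).factorization p := by positivity
        nlinarith
  calc ∑ m ∈ S, Real.log m
      = ∑ m ∈ S, ∑ p ∈ Nat.primesLE y, (m.factorization p : ℝ) * Real.log p := sum_congr rfl h1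
    _ = ∑ p ∈ Nat.primesLE y, (∑ m ∈ S, (m.factorization p : ℝ)) * Real.log p := by
        rw [sum_comm]
        exact sum_congr rfl fun p _ => by rw [sum_mul]
    _ ≤ ∑ p ∈ Nat.primesLE y, (2 * n / p) * Real.log p := by
        refine sum_le_sum fun p hp => ?_
        have := Real.log_natCast_nonneg p
        gcongr
        exact h2 p hp
    _ = 2 * n * ∑ p ∈ Nat.primesLE y, Real.log p / p := by
        rw [mul_sum]
        exact sum_congr rfl fun p _ => by ring
    _ ≤ _ := by
        have := sum_log_div_primesLE_le hy
        gcongr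

/-! ### Sums over finite sets of primes -/

lemma sum_powerset_prod_le {ι : Type*} (S : Finset ι) {a : ι → ℝ} (ha : ∀ p ∈ S, 0 ≤ a p)
    {t L : ℝ} (ht : 0 ≤ t) (hL : ∑ p ∈ S, a p ≤ L) :
    ∑ s ∈ S.powerset, t ^ #s * ∏ p ∈ s, a p ≤ Real.exp (t * L) := by
  have h : ∑ s ∈ S.powerset, t ^ #s * ∏ p ∈ s, a p = ∏ p ∈ S, (1 + t * a p) := by
    rw [prod_one_add]
    exact sum_congr rfl fun s _ => by rw [prod_mul_distrib, prod_const]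
  rw [h]
  calc ∏ p ∈ S, (1 + t * a p) ≤ ∏ p ∈ S, Real.exp (t * a p) :=
        prod_le_prod (fun p hp => by have := ha p hp; positivity) fun p _ => by
          linarith [Real.add_one_le_exp (t * a p)]
    _ = Real.exp (t * ∑ p ∈ S, a p) := by rw [← Real.exp_sum, mul_sum]
    _ ≤ _ := by gcongr

lemma sum_prod_card_le {ι : Type*} (S : Finset ι) {a : ι → ℝ} (ha : ∀ p ∈ S, 0 ≤ a p)
    {L : ℝ} (hL1 : 1 ≤ L) (hL : ∑ p ∈ S, a p ≤ L) (k : ℕ) :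
    ∑ s ∈ S.powerset with #s ≤ k, ∏ p ∈ s, a p ≤ Real.exp 1 * L ^ k := by
  have hL0 : 0 < L := by linarith
  have h := sum_powerset_prod_le S ha (t := 1 / L) (by positivity) hL
  rw [one_div_mul_cancel hL0.ne'] at h
  have hpos : ∀ s ∈ S.powerset, 0 ≤ ∏ p ∈ s, a p := fun s hs =>
    prod_nonneg fun p hp => ha p (mem_powerset.1 hs hp)
  calc ∑ s ∈ S.powerset with #s ≤ k, ∏ p ∈ s, a p
      ≤ ∑ s ∈ S.powerset with #s ≤ k, L ^ k * ((1 / L) ^ #s * ∏ p ∈ s, a p) := by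
        refine sum_le_sum fun s hs => ?_
        rw [mem_filter] at hs
        have h1 : 1 ≤ L ^ k * (1 / L) ^ #s := by
          rw [one_div, inv_pow, ← div_eq_mul_inv, one_le_div (by positivity)]
          exact pow_le_pow_right₀ hL1 hs.2
        rw [← mul_assoc]
        exact le_mul_of_one_le_left (hpos s hs.1) h1
    _ ≤ ∑ s ∈ S.powerset, L ^ k * ((1 / L) ^ #s * ∏ p ∈ s, a p) :=
        sum_le_sum_of_subset_of_nonneg (filter_subset _ _) fun s hs _ => by
          have := hpos s hs
          positivity
    _ = L ^ k * ∑ s ∈ S.powerset, (1 / L) ^ #s * ∏ p ∈ s, a p := by rw [mul_sum]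
    _ ≤ _ := by
        rw [mul_comm]
        gcongr

lemma sum_prod_powersetCard_le {ι : Type*} (S : Finset ι) {a : ι → ℝ} (ha : ∀ p ∈ S, 0 ≤ a p)
    {L : ℝ} (hL : ∑ p ∈ S, a p ≤ L) (r : ℕ) :
    ∑ s ∈ S.powersetCard r, ∏ p ∈ s, a p ≤ Real.exp (Real.exp 1 * L - r) := by
  have h := sum_powerset_prod_le S ha (t := Real.exp 1) (by positivity) hL
  have hr : Real.exp r * Real.exp (-r) = 1 := by rw [← Real.exp_add]; simp
  calc ∑ s ∈ S.powersetCard r, ∏ p ∈ s, a p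
      = Real.exp (-r) * ∑ s ∈ S.powersetCard r, Real.exp 1 ^ #s * ∏ p ∈ s, a p := by
        rw [mul_sum]
        refine sum_congr rfl fun s hs => ?_
        rw [(mem_powersetCard.1 hs).2, ← Real.exp_nat_mul, mul_one, ← mul_assoc, mul_comm
          (Real.exp (-r)), hr, one_mul]
    _ ≤ Real.exp (-r) * ∑ s ∈ S.powerset, Real.exp 1 ^ #s * ∏ p ∈ s, a p := by
        refine mul_le_mul_of_nonneg_left (sum_le_sum_of_subset_of_nonneg (fun s hs => ?_)
          fun s hs _ => ?_) (by positivity)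
        · exact mem_powerset.2 (mem_powersetCard.1 hs).1
        · have : 0 ≤ ∏ p ∈ s, a p := prod_nonneg fun p hp => ha p (mem_powerset.1 hs hp)
          positivity
    _ ≤ Real.exp (-r) * Real.exp (Real.exp 1 * L) := by gcongr
    _ = _ := by rw [← Real.exp_add]; congr 1; ring

lemma card_mul_log_le {T : Finset ℕ} {n : ℕ} {w : ℝ} (hn : n ≠ 0) (hw : 0 < w)
    (hT : ∀ p ∈ T, p.Prime ∧ p ∣ n ∧ w ≤ p) : #T * Real.log w ≤ Real.log n := by
  have hdvd : ∏ p ∈ T, p ∣ n :=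
    prod_primes_dvd n (fun p hp => (hT p hp).1.prime) fun p hp => (hT p hp).2.1
  have hpos : 0 < ∏ p ∈ T, p := Finset.prod_pos fun p hp => (hT p hp).1.pos
  calc #T * Real.log w = Real.log (w ^ #T) := by rw [Real.log_pow]
    _ ≤ Real.log n := by
      refine Real.log_le_log (by positivity) ?_
      calc w ^ #T ≤ ∏ p ∈ T, (p : ℝ) := by
            rw [← prod_const]
            exact prod_le_prod (fun _ _ => hw.le) fun p hp => (hT p hp).2.2
        _ ≤ n := by
            rw [← Nat.cast_prod]
            exact_mod_cast Nat.le_of_dvd (Nat.pos_of_ne_zero hn) hdvd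

lemma card_le_two_mul_log {T : Finset ℕ} {n : ℕ} (hn : n ≠ 0)
    (hT : ∀ p ∈ T, p.Prime ∧ p ∣ n) : (#T : ℝ) ≤ 2 * Real.log n := by
  have h := card_mul_log_le (w := 2) hn (by norm_num) fun p hp =>
    ⟨(hT p hp).1, (hT p hp).2, by exact_mod_cast (hT p hp).1.two_le⟩
  have := Real.log_two_gt_d9
  have h0 : (0 : ℝ) ≤ #T := by positivity
  nlinarith

lemma primeFactors_prod_primes {s : Finset ℕ} (hs : ∀ p ∈ s, p.Prime) :
    (∏ p ∈ s, p).primeFactors = s :=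
  Nat.primeFactors_prod hs

lemma card_le_of_prod_le {T : Finset (Finset ℕ)} (hT : ∀ s ∈ T, ∀ p ∈ s, p.Prime) {M : ℕ}
    (hM : ∀ s ∈ T, ∏ p ∈ s, p ≤ M) : #T ≤ M := by
  have h : #T ≤ #(Icc 1 M) := by
    refine card_le_card_of_injOn (fun s => ∏ p ∈ s, p) (fun s hs => ?_) fun s hs t ht h => ?_
    · simp only [coe_Icc, Set.mem_Icc]
      exact ⟨Finset.prod_pos fun p hp => (hT s hs p hp).pos, hM s hs⟩
    · rw [← primeFactors_prod_primes (hT s hs), ← primeFactors_prod_primes (hT t ht)]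
      exact congrArg _ h
  simpa using h

/-- For primes, divisibility by a product over a finite set splits. -/
lemma prod_primes_dvd_iff {s : Finset ℕ} (hs : ∀ p ∈ s, p.Prime) {n : ℕ} :
    ∏ p ∈ s, p ∣ n ↔ ∀ p ∈ s, p ∣ n :=
  ⟨fun h _ hp => (dvd_prod_of_mem _ hp).trans h,
    fun h => prod_primes_dvd n (fun p hp => (hs p hp).prime) h⟩

/-! ### Sums of periodic functions -/

lemma sum_range_mul_of_periodic {m n : ℕ} (hmn : m.Coprime n) (hm : 0 < m) (hn : 0 < n)
    {f g : ℕ → ℝ} (hf : Function.Periodic f m) (hg : Function.Periodic g n) :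
    ∑ i ∈ range (m * n), f i * g i = (∑ i ∈ range m, f i) * ∑ i ∈ range n, g i := by
  rw [sum_mul_sum, ← sum_product']
  refine sum_bij (fun i _ => (i % m, i % n)) (fun i _ => ?_) (fun i hi j hj h => ?_)
    (fun b hb => ?_) fun i _ => ?_
  · simp [Nat.mod_lt _ hm, Nat.mod_lt _ hn]
  · rw [Prod.mk.injEq] at h
    have h' : i ≡ j [MOD m * n] := (Nat.modEq_and_modEq_iff_modEq_mul hmn).1 ⟨h.1, h.2⟩
    exact h'.eq_of_lt_of_lt (mem_range.1 hi) (mem_range.1 hj)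
  · rw [mem_product, mem_range, mem_range] at hb
    refine ⟨Nat.chineseRemainder hmn b.1 b.2, ?_, ?_⟩
    · exact mem_range.2 (Nat.chineseRemainder_lt_mul hmn _ _ hm.ne' hn.ne')
    · have h := (Nat.chineseRemainder hmn b.1 b.2).2
      exact Prod.ext (Eq.trans h.1 (Nat.mod_eq_of_lt hb.1)) (Eq.trans h.2 (Nat.mod_eq_of_lt hb.2))
  · rw [hf.map_mod_nat, hg.map_mod_nat]

lemma periodic_prod {s : Finset ℕ} {f : ℕ → ℕ → ℝ} (hf : ∀ p ∈ s, Function.Periodic (f p) p)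
    {M : ℕ} (hM : ∀ p ∈ s, p ∣ M) : Function.Periodic (fun n => ∏ p ∈ s, f p n) M := by
  intro n
  refine prod_congr rfl fun p hp => ?_
  obtain ⟨c, rfl⟩ := hM p hp
  have h := (hf p hp).nat_mul c n
  rwa [mul_comm, Nat.cast_id] at h

lemma sum_range_prod_of_periodic {s : Finset ℕ} (hs : ∀ p ∈ s, p.Prime) {f : ℕ → ℕ → ℝ}
    (hf : ∀ p ∈ s, Function.Periodic (f p) p) :
    ∑ n ∈ range (∏ p ∈ s, p), ∏ p ∈ s, f p n = ∏ p ∈ s, ∑ n ∈ range p, f p n := by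
  induction s using Finset.induction_on with
  | empty => simp
  | insert q s hq ih =>
    have hs' : ∀ p ∈ s, p.Prime := fun p hp => hs p (mem_insert_of_mem hp)
    have hf' : ∀ p ∈ s, Function.Periodic (f p) p := fun p hp => hf p (mem_insert_of_mem hp)
    have hqp := hs q (mem_insert_self q s)
    rw [prod_insert hq, prod_insert hq, ← ih hs' hf', ← sum_range_mul_of_periodic
      (Nat.Coprime.prod_right fun p hp => (Nat.coprime_primes hqp (hs' p hp)).2 (by
        rintro rfl
        exact hq hp)) hqp.pos
      (Finset.prod_pos fun p hp => (hs' p hp).pos) (hf q (mem_insert_self q s))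
      (periodic_prod hf' fun p hp => dvd_prod_of_mem _ hp)]
    exact sum_congr rfl fun n _ => by rw [prod_insert hq]

lemma sum_Ico_eq_of_periodic {M : ℕ} {f : ℕ → ℝ} (hf : Function.Periodic f M) (a : ℕ) :
    ∑ n ∈ Ico a (a + M), f n = ∑ n ∈ range M, f n := by
  induction a with
  | zero => simp
  | succ a ih =>
    rw [← ih]
    have h1 := sum_Ico_succ_top (show a ≤ a + M by omega) f
    have h2 := sum_eq_sum_Ico_succ_bot (show a < a + M + 1 by omega) f
    rw [show a + 1 + M = a + M + 1 by ring]
    have h3 := hf a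
    linarith

lemma abs_sum_Ico_sub_le_of_periodic {M : ℕ} (hM : 0 < M) {f : ℕ → ℝ}
    (hf : Function.Periodic f M) {B : ℝ} (hB : ∀ n, |f n| ≤ B) (a N : ℕ) :
    |∑ n ∈ Ico a (a + N), f n - (N / M : ℕ) * ∑ n ∈ range M, f n| ≤ M * B := by
  have hB0 : 0 ≤ B := (abs_nonneg _).trans (hB 0)
  induction N using Nat.strong_induction_on generalizing a with
  | _ N ih =>
    by_cases h : N < M
    · rw [Nat.div_eq_of_lt h, Nat.cast_zero, zero_mul, sub_zero]
      calc |∑ n ∈ Ico a (a + N), f n| ≤ ∑ n ∈ Ico a (a + N), B :=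
            (abs_sum_le_sum_abs _ _).trans (sum_le_sum fun n _ => hB n)
        _ = N * B := by simp
        _ ≤ M * B := by gcongr
    · have h1 := ih (N - M) (by omega) (a + M)
      rw [← sum_Ico_consecutive f (show a ≤ a + M by omega) (show a + M ≤ a + N by omega),
        sum_Ico_eq_of_periodic hf, Nat.div_eq_sub_div hM (by omega)]
      rw [show a + M + (N - M) = a + N by omega] at h1
      convert h1 using 2
      push_cast
      ring

/-! ### The dispersion inequality -/

/-- A family of functions `ε p` of two variables, periodic modulo `p` and of mean zero in the
first one, and bounded by one. -/
structure IsOscillating (R : Finset ℕ) (ε : ℕ → ℕ → ℕ → ℝ) : Prop where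
  prime : ∀ p ∈ R, p.Prime
  periodic : ∀ p ∈ R, ∀ b, Function.Periodic (fun a => ε p a b) p
  sum_eq_zero : ∀ p ∈ R, ∀ b, ∑ a ∈ range p, ε p a b = 0
  abs_le_one : ∀ p ∈ R, ∀ a b, |ε p a b| ≤ 1

/-- The correlation over one period in the first variable. -/
noncomputable def corr (ε : ℕ → ℕ → ℕ → ℝ) (p b b' : ℕ) : ℝ := ∑ a ∈ range p, ε p a b * ε p a b'

section Oscillating
variable {R : Finset ℕ} {ε : ℕ → ℕ → ℕ → ℝ}

lemma IsOscillating.abs_prod_le_one (h : IsOscillating R ε) {e : Finset ℕ} (he : e ⊆ R)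
    (a b : ℕ) : |∏ p ∈ e, ε p a b| ≤ 1 := by
  rw [abs_prod]
  exact prod_le_one (fun _ _ => abs_nonneg _) fun p hp => h.abs_le_one p (he hp) a b

private lemma IsOscillating.sum_range_mul (h : IsOscillating R ε) {e e' : Finset ℕ} (he : e ⊆ R)
    (he' : e' ⊆ R) (b b' : ℕ) :
    ∑ n ∈ range (∏ p ∈ e ∪ e', p), (∏ p ∈ e, ε p n b) * ∏ p ∈ e', ε p n b'
      = if e = e' then ∏ p ∈ e, corr ε p b b' else 0 := by
  set f : ℕ → ℕ → ℝ := fun p n =>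
    (if p ∈ e then ε p n b else 1) * (if p ∈ e' then ε p n b' else 1) with hf
  have hu : e ∪ e' ⊆ R := union_subset he he'
  have h1 : ∀ n, (∏ p ∈ e, ε p n b) * ∏ p ∈ e', ε p n b' = ∏ p ∈ e ∪ e', f p n := by
    intro n
    rw [hf, prod_mul_distrib, prod_ite_mem, prod_ite_mem, union_inter_cancel_left,
      union_inter_cancel_right]
  simp_rw [h1]
  rw [sum_range_prod_of_periodic (fun p hp => h.prime p (hu hp)) fun p hp n => ?_]
  · split_ifs with hee
    · subst hee
      rw [union_self]
      refine prod_congr rfl fun p hp => ?_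
      simp [hf, hp, corr]
    · obtain ⟨p, hp⟩ : ∃ p, (p ∈ e ∧ p ∉ e') ∨ (p ∉ e ∧ p ∈ e') := by
        by_contra! hcon
        exact hee (Finset.ext fun p => by have := hcon p; tauto)
      rcases hp with ⟨hp, hp'⟩ | ⟨hp, hp'⟩
      · refine prod_eq_zero (mem_union_left _ hp) ?_
        simpa [hf, hp, hp'] using h.sum_eq_zero p (he hp) b
      · refine prod_eq_zero (mem_union_right _ hp') ?_
        simpa [hf, hp, hp'] using h.sum_eq_zero p (he' hp') b'
  · have h2 := h.periodic p (hu hp) b n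
    have h3 := h.periodic p (hu hp) b' n
    simp only at h2 h3
    simp only [hf, h2, h3]

lemma IsOscillating.sum_corr_eq (h : IsOscillating R ε) {e : Finset ℕ} (he : e ⊆ R)
    (S : Finset ℕ) : ∑ b ∈ S, ∑ b' ∈ S, ∏ p ∈ e, corr ε p b b'
      = ∑ n ∈ range (∏ p ∈ e, p), (∑ b ∈ S, ∏ p ∈ e, ε p n b) ^ 2 := by
  have h1 : ∀ b b', ∏ p ∈ e, corr ε p b b'
      = ∑ n ∈ range (∏ p ∈ e, p), (∏ p ∈ e, ε p n b) * ∏ p ∈ e, ε p n b' := fun b b' => by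
    have h2 := h.sum_range_mul he he b b'
    rw [union_self, if_pos rfl] at h2
    exact h2.symm
  simp_rw [h1, sq, sum_mul_sum]
  rw [sum_comm (s := range _)]
  exact sum_congr rfl fun b _ => sum_comm

lemma IsOscillating.sum_corr_nonneg (h : IsOscillating R ε) {e : Finset ℕ} (he : e ⊆ R)
    (S : Finset ℕ) : 0 ≤ ∑ b ∈ S, ∑ b' ∈ S, ∏ p ∈ e, corr ε p b b' := by
  rw [h.sum_corr_eq he]
  exact sum_nonneg fun _ _ => sq_nonneg _

/-- A large-sieve type inequality. -/
lemma IsOscillating.sum_sq_le (h : IsOscillating R ε) (T : Finset (Finset ℕ))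
    (hT : ∀ e ∈ T, e ⊆ R) (θ : Finset ℕ → ℝ) (S : Finset ℕ) (a N : ℕ) :
    ∑ n ∈ Ico a (a + N), (∑ e ∈ T, θ e * ∑ b ∈ S, ∏ p ∈ e, ε p n b) ^ 2
      ≤ ∑ e ∈ T, θ e ^ 2 * (N / ∏ p ∈ e, (p : ℝ)) * (∑ b ∈ S, ∑ b' ∈ S, ∏ p ∈ e, corr ε p b b')
        + (∑ e ∈ T, |θ e| * ∏ p ∈ e, (p : ℝ)) ^ 2 * (#S) ^ 2 := by
  set G : Finset ℕ → ℕ → ℝ := fun e n => ∑ b ∈ S, ∏ p ∈ e, ε p n b with hG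
  set V : Finset ℕ → ℝ := fun e => ∑ b ∈ S, ∑ b' ∈ S, ∏ p ∈ e, corr ε p b b' with hV
  have hGle : ∀ e ∈ T, ∀ n, |G e n| ≤ #S := fun e he n => by
    calc |G e n| ≤ ∑ b ∈ S, (1 : ℝ) := (abs_sum_le_sum_abs _ _).trans
          (sum_le_sum fun b _ => h.abs_prod_le_one (hT e he) n b)
      _ = #S := by simp
  have hfull : ∀ e ∈ T, ∀ e' ∈ T, ∑ n ∈ range (∏ p ∈ e ∪ e', p), G e n * G e' n
      = if e = e' then V e else 0 := by
    intro e he e' he'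
    simp_rw [hG, sum_mul_sum]
    rw [sum_comm]
    simp_rw [sum_comm (s := range _) (t := S)]
    simp_rw [h.sum_range_mul (hT e he) (hT e' he')]
    split_ifs with hee
    · rfl
    · simp
  have hpair : ∀ e ∈ T, ∀ e' ∈ T, θ e * θ e' * ∑ n ∈ Ico a (a + N), G e n * G e' n
      ≤ (if e = e' then θ e ^ 2 * (N / ∏ p ∈ e, (p : ℝ)) * V e else 0)
        + (|θ e| * ∏ p ∈ e, (p : ℝ)) * (|θ e'| * ∏ p ∈ e', (p : ℝ)) * (#S) ^ 2 := by
    intro e he e' he'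
    have hu : e ∪ e' ⊆ R := union_subset (hT e he) (hT e' he')
    have hpos : 0 < ∏ p ∈ e ∪ e', p := Finset.prod_pos fun p hp => (h.prime p (hu hp)).pos
    have hper : Function.Periodic (fun n => G e n * G e' n) (∏ p ∈ e ∪ e', p) := by
      have h1 : ∀ e'' ⊆ e ∪ e', ∀ n, G e'' (n + ∏ p ∈ e ∪ e', p) = G e'' n := by
        intro e'' he'' n
        refine sum_congr rfl fun b _ => ?_
        exact periodic_prod (f := fun p n => ε p n b)
          (fun p hp => h.periodic p (hu (he'' hp)) b) (fun p hp => dvd_prod_of_mem _ (he'' hp)) n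
      intro n
      simp only
      rw [h1 e subset_union_left, h1 e' subset_union_right]
    have hinc := abs_sum_Ico_sub_le_of_periodic hpos hper (B := (#S) ^ 2) (fun n => by
      rw [abs_mul, sq]
      exact mul_le_mul (hGle e he n) (hGle e' he' n) (abs_nonneg _) (Nat.cast_nonneg _)) a N
    rw [hfull e he e' he'] at hinc
    have hprod : ((∏ p ∈ e ∪ e', p : ℕ) : ℝ) ≤ (∏ p ∈ e, (p : ℝ)) * ∏ p ∈ e', (p : ℝ) := by
      have h1 : ((∏ p ∈ e ∪ e', p) * ∏ p ∈ e ∩ e', p) = (∏ p ∈ e, p) * ∏ p ∈ e', p :=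
        prod_union_inter
      have h2 : 0 < ∏ p ∈ e ∩ e', p :=
        Finset.prod_pos fun p hp => (h.prime p (hT e he (mem_inter.1 hp).1)).pos
      have h3 : (∏ p ∈ e ∪ e', p) ≤ (∏ p ∈ e, p) * ∏ p ∈ e', p := by
        rw [← h1]
        exact Nat.le_mul_of_pos_right _ h2
      rw [← Nat.cast_prod, ← Nat.cast_prod]
      exact_mod_cast h3
    set J := ∑ n ∈ Ico a (a + N), G e n * G e' n
    set M : ℕ := ∏ p ∈ e ∪ e', p
    set F : ℝ := if e = e' then V e else 0
    have h1 : θ e * θ e' * J = θ e * θ e' * (J - (N / M : ℕ) * F)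
        + θ e * θ e' * ((N / M : ℕ) * F) := by ring
    rw [h1, add_comm]
    refine add_le_add ?_ ?_
    · simp only [F]
      split_ifs with hee
      · subst hee
        have hV0 : 0 ≤ V e := h.sum_corr_nonneg (hT e he) S
        have h2 : ((N / M : ℕ) : ℝ) ≤ N / ∏ p ∈ e, (p : ℝ) := by
          have h3 : M = ∏ p ∈ e, p := by simp only [M, union_self]
          rw [h3]
          refine Nat.cast_div_le.trans_eq ?_
          rw [Nat.cast_prod]
        rw [← sq, mul_assoc]
        gcongr
      · simp
    · calc θ e * θ e' * (J - (N / M : ℕ) * F) ≤ |θ e| * |θ e'| * |J - (N / M : ℕ) * F| := by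
            rw [← abs_mul, ← abs_mul]
            exact le_abs_self _
        _ ≤ |θ e| * |θ e'| * (((∏ p ∈ e, (p : ℝ)) * ∏ p ∈ e', (p : ℝ)) * (#S) ^ 2) := by
            gcongr
            exact hinc.trans (by gcongr)
        _ = _ := by ring
  calc ∑ n ∈ Ico a (a + N), (∑ e ∈ T, θ e * G e n) ^ 2
      = ∑ e ∈ T, ∑ e' ∈ T, θ e * θ e' * ∑ n ∈ Ico a (a + N), G e n * G e' n := by
        simp_rw [sq, sum_mul_sum, mul_sum]
        rw [sum_comm]
        refine sum_congr rfl fun e _ => ?_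
        rw [sum_comm]
        exact sum_congr rfl fun e' _ => sum_congr rfl fun n _ => by ring
    _ ≤ ∑ e ∈ T, ∑ e' ∈ T, ((if e = e' then θ e ^ 2 * (N / ∏ p ∈ e, (p : ℝ)) * V e else 0)
        + (|θ e| * ∏ p ∈ e, (p : ℝ)) * (|θ e'| * ∏ p ∈ e', (p : ℝ)) * (#S) ^ 2) :=
        sum_le_sum fun e he => sum_le_sum fun e' he' => hpair e he e' he'
    _ = _ := by
        simp_rw [sum_add_distrib]
        congr 1
        · exact sum_congr rfl fun e he => by rw [sum_ite_eq, if_pos he]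
        · rw [sq (∑ e ∈ T, |θ e| * _), sum_mul_sum, sum_mul]
          exact sum_congr rfl fun e _ => by rw [sum_mul]

end Oscillating

/-! ### Kernels attached to partial bijections modulo primes -/

/-- `Rel` restricted to the residue classes modulo `p` in `U` is the graph of a bijection. -/
structure IsMatching (p : ℕ) (U : ℕ → Prop) (Rel : ℕ → ℕ → Prop) : Prop where
  periodic_mem : Function.Periodic U p
  periodic_left : ∀ b, Function.Periodic (fun a => Rel a b) p
  congr_right : ∀ a b b', b ≡ b' [MOD p] → (Rel a b ↔ Rel a b')
  exists_left : ∀ b, U b → ∃ a < p, U a ∧ Rel a b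
  unique_left : ∀ a a' b, U a → U a' → U b → Rel a b → Rel a' b → a ≡ a' [MOD p]
  unique_right : ∀ a b b', U a → U b → U b' → Rel a b → Rel a b' → b ≡ b' [MOD p]

open Classical in
/-- The number of residue classes modulo `p` in `U`. -/
noncomputable def classCount (p : ℕ) (U : ℕ → Prop) : ℕ := #{a ∈ range p | U a}

open Classical in
/-- The indicator function of `Rel` on `U × U`, minus its mean. -/
noncomputable def ker (p : ℕ) (U : ℕ → Prop) (Rel : ℕ → ℕ → Prop) (a b : ℕ) : ℝ :=
  if U a ∧ U b then (if Rel a b then 1 else 0) - 1 / (classCount p U : ℝ) else 0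

section Matching
variable {p : ℕ} {U : ℕ → Prop} {Rel : ℕ → ℕ → Prop}

lemma IsMatching.periodic_ker (h : IsMatching p U Rel) (b : ℕ) :
    Function.Periodic (fun a => ker p U Rel a b) p := by
  intro a
  have h1 : U (a + p) ↔ U a := iff_of_eq (h.periodic_mem a)
  have h2 : Rel (a + p) b ↔ Rel a b := iff_of_eq (h.periodic_left b a)
  classical
  simp only [ker]
  refine if_congr (and_congr_left fun _ => h1) ?_ rfl
  rw [if_congr h2 rfl rfl]

lemma IsMatching.modEq (h : IsMatching p U Rel) (hp : 0 < p) :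
    IsMatching p U (fun a b => a ≡ b [MOD p]) where
  periodic_mem := h.periodic_mem
  periodic_left b a := by simp [Nat.ModEq]
  congr_right a b b' hb := ⟨fun h => h.trans hb, fun h => h.trans hb.symm⟩
  exists_left b hb := ⟨b % p, Nat.mod_lt _ hp, by rwa [h.periodic_mem.map_mod_nat],
    Nat.mod_modEq b p⟩
  unique_left _ _ _ _ _ _ h1 h2 := h1.trans h2.symm
  unique_right _ _ _ _ _ _ h1 h2 := h1.symm.trans h2

lemma one_div_classCount_le_one : 1 / (classCount p U : ℝ) ≤ 1 := by
  rcases Nat.eq_zero_or_pos (classCount p U) with h | h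
  · simp [h]
  · rw [div_le_one (by exact_mod_cast h)]
    exact_mod_cast h

lemma abs_ker_le_one (a b : ℕ) : |ker p U Rel a b| ≤ 1 := by
  have h1 : 1 / (classCount p U : ℝ) ≤ 1 := one_div_classCount_le_one
  have h0 : 0 ≤ 1 / (classCount p U : ℝ) := by positivity
  rw [abs_le, ker]
  split_ifs <;> constructor <;> linarith

open Classical in
lemma abs_ker_le (a b : ℕ) :
    |ker p U Rel a b| ≤ (if Rel a b then 1 else 0) + 1 / (classCount p U : ℝ) := by
  have h0 : 0 ≤ 1 / (classCount p U : ℝ) := by positivity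
  rw [abs_le, ker]
  split_ifs <;> constructor <;> linarith

open Classical in
lemma IsMatching.card_filter_eq_one (h : IsMatching p U Rel) {b : ℕ} (hb : U b) :
    #{a ∈ {a ∈ range p | U a} | Rel a b} = 1 := by
  obtain ⟨a, hap, hUa, hab⟩ := h.exists_left b hb
  rw [card_eq_one]
  refine ⟨a, ?_⟩
  ext a'
  simp only [mem_filter, mem_range, mem_singleton]
  constructor
  · rintro ⟨⟨h1, h2⟩, h3⟩
    exact (h.unique_left a' a b h2 hUa hb h3 hab).eq_of_lt_of_lt h1 hap
  · rintro rfl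
    exact ⟨⟨hap, hUa⟩, hab⟩

lemma IsMatching.classCount_pos (h : IsMatching p U Rel) {b : ℕ} (hb : U b) :
    0 < classCount p U := by
  classical
  obtain ⟨a, hap, hUa, -⟩ := h.exists_left b hb
  exact card_pos.2 ⟨a, by simp [hap, hUa]⟩

lemma IsMatching.sum_ker_eq_zero (h : IsMatching p U Rel) (b : ℕ) :
    ∑ a ∈ range p, ker p U Rel a b = 0 := by
  classical
  by_cases hb : U b
  · have hc : (classCount p U : ℝ) ≠ 0 := by exact_mod_cast (h.classCount_pos hb).ne'
    simp only [ker, hb, and_true]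
    rw [← sum_filter, sum_sub_distrib, sum_boole, h.card_filter_eq_one hb, sum_const,
      nsmul_eq_mul]
    change ((1 : ℕ) : ℝ) - (classCount p U : ℝ) * _ = 0
    field_simp
    simp
  · simp [ker, hb]

lemma IsMatching.sum_ker_mul_ker (h : IsMatching p U Rel) (b b' : ℕ) :
    ∑ a ∈ range p, ker p U Rel a b * ker p U Rel a b'
      = ker p U (fun a b => a ≡ b [MOD p]) b b' := by
  classical
  by_cases hb : U b
  swap
  · simp [ker, hb]
  by_cases hb' : U b'
  swap
  · simp [ker, hb']
  have hc : (classCount p U : ℝ) ≠ 0 := by exact_mod_cast (h.classCount_pos hb).ne'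
  have key : #{a ∈ {a ∈ range p | U a} | Rel a b ∧ Rel a b'} = if b ≡ b' [MOD p] then 1 else 0 := by
    split_ifs with hbb
    · rw [← h.card_filter_eq_one hb]
      congr 1
      ext a
      simp only [mem_filter, mem_range]
      have := h.congr_right a b b' hbb
      tauto
    · rw [card_eq_zero, filter_eq_empty_iff]
      intro a ha hab
      exact hbb (h.unique_right a b b' (mem_filter.1 ha).2 hb hb' hab.1 hab.2)
  set c := classCount p U
  have h1 : ∀ a, ker p U Rel a b * ker p U Rel a b' = if U a then
      ((if Rel a b ∧ Rel a b' then 1 else 0) - (if Rel a b then 1 else 0) * (1 / (c : ℝ))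
        - (if Rel a b' then 1 else 0) * (1 / (c : ℝ)) + 1 / (c : ℝ) * (1 / (c : ℝ))) else 0 := by
    intro a
    by_cases ha : U a <;> by_cases h1 : Rel a b <;> by_cases h2 : Rel a b' <;>
      simp [ker, hb, hb', ha, h1, h2] <;> ring
  simp_rw [h1]
  rw [← sum_filter, sum_add_distrib, sum_sub_distrib, sum_sub_distrib, ← sum_mul, ← sum_mul,
    sum_boole, sum_boole, sum_boole, key, h.card_filter_eq_one hb, h.card_filter_eq_one hb',
    sum_const, nsmul_eq_mul]
  change _ + (c : ℝ) * _ = _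
  simp only [ker, hb, hb', and_self, if_true]
  rw [show classCount p U = c from rfl]
  push_cast
  field_simp
  split_ifs <;> ring

end Matching

/-- A family of matchings modulo the primes in `R`, each on all but at most one class. -/
structure IsMatchingFamily (R : Finset ℕ) (U : ℕ → ℕ → Prop) (Rel : ℕ → ℕ → ℕ → Prop) : Prop where
  prime : ∀ p ∈ R, p.Prime
  matching : ∀ p ∈ R, IsMatching p (U p) (Rel p)
  le_classCount : ∀ p ∈ R, p ≤ classCount p (U p) + 1

/-- The family of kernels of a family of matchings. -/
noncomputable def kerFamily (U : ℕ → ℕ → Prop) (Rel : ℕ → ℕ → ℕ → Prop) (p a b : ℕ) : ℝ :=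
  ker p (U p) (Rel p) a b

namespace IsMatchingFamily

variable {R : Finset ℕ} {U : ℕ → ℕ → Prop} {Rel : ℕ → ℕ → ℕ → Prop}

lemma isOscillating (h : IsMatchingFamily R U Rel) : IsOscillating R (kerFamily U Rel) where
  prime := h.prime
  periodic p hp b := (h.matching p hp).periodic_ker b
  sum_eq_zero p hp b := (h.matching p hp).sum_ker_eq_zero b
  abs_le_one _ _ _ _ := abs_ker_le_one _ _

lemma modEq (h : IsMatchingFamily R U Rel) :
    IsMatchingFamily R U (fun p a b => a ≡ b [MOD p]) where
  prime := h.prime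
  matching p hp := (h.matching p hp).modEq (h.prime p hp).pos
  le_classCount := h.le_classCount

lemma corr_eq (h : IsMatchingFamily R U Rel) {p : ℕ} (hp : p ∈ R) (b b' : ℕ) :
    corr (kerFamily U Rel) p b b' = kerFamily U (fun p a b => a ≡ b [MOD p]) p b b' :=
  (h.matching p hp).sum_ker_mul_ker b b'

lemma classCount_pos (h : IsMatchingFamily R U Rel) {p : ℕ} (hp : p ∈ R) :
    0 < classCount p (U p) := by
  have := h.le_classCount p hp
  have := (h.prime p hp).two_le
  omega

lemma one_div_classCount_le (h : IsMatchingFamily R U Rel) {p : ℕ} (hp : p ∈ R) :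
    1 / (classCount p (U p) : ℝ) ≤ 2 * (1 / p) := by
  have h1 : (p : ℝ) ≤ classCount p (U p) + 1 := by exact_mod_cast h.le_classCount p hp
  have h2 : (2 : ℝ) ≤ p := by exact_mod_cast (h.prime p hp).two_le
  rw [mul_one_div, div_le_div_iff₀ (by linarith) (by linarith)]
  linarith

lemma sum_low_le (h : IsMatchingFamily R U Rel) {T : Finset (Finset ℕ)} (hT : ∀ e ∈ T, e ⊆ R)
    {E₀ : ℝ} (hE₀ : 0 < E₀) (hlow : ∀ e ∈ T, E₀ ≤ ∏ p ∈ e, (p : ℝ)) {E₁ : ℕ}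
    (hhigh : ∀ e ∈ T, ∏ p ∈ e, p ≤ E₁) {S : Finset ℕ} {a v : ℕ} (hS : S ⊆ Ico a (a + v)) :
    ∑ e ∈ T, (∑ b ∈ S, ∑ b' ∈ S, ∏ p ∈ e, corr (kerFamily U Rel) p b b') / ∏ p ∈ e, (p : ℝ)
      ≤ #S * (v / E₀ ^ 2) + E₁ * (#S * √(#S)) := by
  set K := kerFamily U (fun p a b => a ≡ b [MOD p]) with hK
  have hosc : IsOscillating R K := h.modEq.isOscillating
  have hcorr : ∀ e ∈ T, ∀ b b', ∏ p ∈ e, corr (kerFamily U Rel) p b b' = ∏ p ∈ e, K p b b' :=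
    fun e he b b' => prod_congr rfl fun p hp => h.corr_eq (hT e he hp) b b'
  have hcorr' : ∀ e ∈ T, ∀ b b', ∏ p ∈ e, corr K p b b' = ∏ p ∈ e, K p b b' :=
    fun e he b b' => prod_congr rfl fun p hp => h.modEq.corr_eq (hT e he hp) b b'
  set V : Finset ℕ → ℝ := fun e => ∑ b ∈ S, ∑ b' ∈ S, ∏ p ∈ e, K p b b' with hV
  have hV0 : ∀ e ∈ T, 0 ≤ V e := fun e he => by
    have := hosc.sum_corr_nonneg (hT e he) S
    simp_rw [hcorr' e he] at this
    exact this
  have hprime : ∀ e ∈ T, ∀ p ∈ e, p.Prime := fun e he p hp => h.prime p (hT e he hp)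
  have hN0 : ∀ e ∈ T, 0 < ∏ p ∈ e, (p : ℝ) := fun e he => hE₀.trans_le (hlow e he)
  set W := ∑ e ∈ T, V e / ∏ p ∈ e, (p : ℝ) with hW
  have hgoal : ∑ e ∈ T, (∑ b ∈ S, ∑ b' ∈ S, ∏ p ∈ e, corr (kerFamily U Rel) p b b')
      / ∏ p ∈ e, (p : ℝ) = W := by
    refine sum_congr rfl fun e he => ?_
    simp_rw [hcorr e he]
    rfl
  rw [hgoal]
  have hcardT : #T ≤ E₁ := card_le_of_prod_le hprime hhigh
  have hWeq : W = ∑ n ∈ S, ∑ e ∈ T, (1 / ∏ p ∈ e, (p : ℝ)) * ∑ b ∈ S, ∏ p ∈ e, K p n b := by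
    rw [sum_comm]
    refine sum_congr rfl fun e _ => ?_
    rw [← mul_sum]
    simp only [hV]
    ring
  have hsq : √(#S : ℝ) ^ 2 = #S := Real.sq_sqrt (Nat.cast_nonneg _)
  have hWsq : W ^ 2 ≤ #S * (v / E₀ ^ 2) * W + (E₁ * (#S * √(#S))) ^ 2 := by
    calc W ^ 2 ≤ #S * ∑ n ∈ S,
          (∑ e ∈ T, (1 / ∏ p ∈ e, (p : ℝ)) * ∑ b ∈ S, ∏ p ∈ e, K p n b) ^ 2 := by
          rw [hWeq]
          exact sq_sum_le_card_mul_sum_sq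
      _ ≤ #S * ∑ n ∈ Ico a (a + v),
          (∑ e ∈ T, (1 / ∏ p ∈ e, (p : ℝ)) * ∑ b ∈ S, ∏ p ∈ e, K p n b) ^ 2 := by
          refine mul_le_mul_of_nonneg_left ?_ (Nat.cast_nonneg _)
          exact sum_le_sum_of_subset_of_nonneg hS fun _ _ _ => sq_nonneg _
      _ ≤ #S * (v / E₀ ^ 2 * W + E₁ ^ 2 * (#S) ^ 2) := by
          refine mul_le_mul_of_nonneg_left ?_ (Nat.cast_nonneg _)
          refine (hosc.sum_sq_le T hT (fun e => 1 / ∏ p ∈ e, (p : ℝ)) S a v).trans ?_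
          refine add_le_add ?_ ?_
          · rw [hW, mul_sum]
            refine sum_le_sum fun e he => ?_
            simp_rw [hcorr' e he]
            change _ * V e ≤ _
            have h0 := hN0 e he
            have h1 := hlow e he
            have h2 := hV0 e he
            set N := ∏ p ∈ e, (p : ℝ)
            calc (1 / N) ^ 2 * (v / N) * V e = v * (1 / N ^ 2) * (V e / N) := by
                  field_simp
              _ ≤ v * (1 / E₀ ^ 2) * (V e / N) := by gcongr
              _ = _ := by ring
          · refine mul_le_mul_of_nonneg_right (pow_le_pow_left₀ (sum_nonneg fun e he => ?_) ?_ 2)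
              (by positivity)
            · have := hN0 e he
              positivity
            · calc ∑ e ∈ T, |1 / ∏ p ∈ e, (p : ℝ)| * ∏ p ∈ e, (p : ℝ) = ∑ e ∈ T, (1 : ℝ) := by
                    refine sum_congr rfl fun e he => ?_
                    have := hN0 e he
                    rw [abs_of_pos (by positivity), one_div_mul_cancel this.ne']
                _ ≤ E₁ := by simpa using hcardT
      _ = _ := by rw [mul_pow, mul_pow, hsq]; ring
  have hα : 0 ≤ #S * (v / E₀ ^ 2) := by positivity
  have hβ : 0 ≤ E₁ * (#S * √(#S : ℝ)) := by positivity
  by_contra! hcon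
  nlinarith

lemma sum_high_le (h : IsMatchingFamily R U Rel) {T : Finset (Finset ℕ)} (hT : ∀ e ∈ T, e ⊆ R)
    {k : ℕ} (hk : ∀ e ∈ T, #e ≤ k) {E₁ : ℝ} (hE₁ : 0 < E₁)
    (hhigh : ∀ e ∈ T, E₁ ≤ ∏ p ∈ e, (p : ℝ)) {S : Finset ℕ} {L : ℝ} (hL1 : 1 ≤ L)
    (hL : ∑ p ∈ R, (1 : ℝ) / p ≤ L) {w : ℝ}
    (hw0 : 0 ≤ w) (hw : ∀ b ∈ S, ∀ b' ∈ S, b ≠ b' → (#{p ∈ R | b ≡ b' [MOD p]} : ℝ) ≤ w) :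
    ∑ e ∈ T, (∑ b ∈ S, ∑ b' ∈ S, ∏ p ∈ e, corr (kerFamily U Rel) p b b') / ∏ p ∈ e, (p : ℝ)
      ≤ #S * (Real.exp 1 * L ^ k) + (#S) ^ 2 * (Real.exp 1 * (w + 2 * L) ^ k / E₁) := by
  set K := kerFamily U (fun p a b => a ≡ b [MOD p]) with hK
  have hsub : T ⊆ {s ∈ R.powerset | #s ≤ k} := fun e he => by
    rw [mem_filter, mem_powerset]
    exact ⟨hT e he, hk e he⟩
  have hN0 : ∀ e ∈ T, 0 < ∏ p ∈ e, (p : ℝ) := fun e he => hE₁.trans_le (hhigh e he)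
  have hdiag : ∀ b, ∑ e ∈ T, (∏ p ∈ e, corr (kerFamily U Rel) p b b) / ∏ p ∈ e, (p : ℝ)
      ≤ Real.exp 1 * L ^ k := by
    intro b
    refine le_trans ?_ (sum_prod_card_le R (a := fun p => 1 / (p : ℝ))
      (fun p _ => by positivity) hL1 hL k)
    refine (sum_le_sum fun e he => ?_).trans
      (sum_le_sum_of_subset_of_nonneg hsub fun s _ _ => prod_nonneg fun p _ => by positivity)
    simp only [one_div]
    rw [prod_inv_distrib, div_eq_mul_inv]
    have h1 : ∏ p ∈ e, corr (kerFamily U Rel) p b b ≤ 1 := by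
      rw [prod_congr rfl fun p hp => h.corr_eq (hT e he hp) b b]
      exact (le_abs_self _).trans (h.modEq.isOscillating.abs_prod_le_one (hT e he) b b)
    have := hN0 e he
    exact mul_le_of_le_one_left (by positivity) h1
  have hoff : ∀ b ∈ S, ∀ b' ∈ S, b ≠ b' →
      ∑ e ∈ T, (∏ p ∈ e, corr (kerFamily U Rel) p b b') / ∏ p ∈ e, (p : ℝ)
      ≤ Real.exp 1 * (w + 2 * L) ^ k / E₁ := by
    intro b hb b' hb' hbb
    set f : ℕ → ℝ := fun p => (if b ≡ b' [MOD p] then 1 else 0) + 2 * (1 / p) with hf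
    have hf0 : ∀ p, 0 ≤ f p := fun p => by simp only [hf]; positivity
    have hfsum : ∑ p ∈ R, f p ≤ w + 2 * L := by
      rw [hf, sum_add_distrib, sum_boole, ← mul_sum]
      have := hw b hb b' hb' hbb
      linarith
    rw [le_div_iff₀ hE₁, sum_mul]
    refine le_trans ?_ (sum_prod_card_le R (fun p _ => hf0 p) (by linarith) hfsum k)
    refine (sum_le_sum fun e he => ?_).trans
      (sum_le_sum_of_subset_of_nonneg hsub fun s _ _ => prod_nonneg fun p _ => hf0 p)
    have h0 := hN0 e he
    have h1 : ∏ p ∈ e, corr (kerFamily U Rel) p b b' ≤ ∏ p ∈ e, f p := by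
      rw [prod_congr rfl fun p hp => h.corr_eq (hT e he hp) b b']
      refine (le_abs_self _).trans ?_
      rw [abs_prod]
      refine prod_le_prod (fun _ _ => abs_nonneg _) fun p hp => ?_
      refine (abs_ker_le _ _).trans ?_
      simp only [hf]
      gcongr
      · split_ifs <;> simp
      · exact h.one_div_classCount_le (hT e he hp)
    have h2 : 0 ≤ ∏ p ∈ e, f p := prod_nonneg fun p _ => hf0 p
    calc (∏ p ∈ e, corr (kerFamily U Rel) p b b') / (∏ p ∈ e, (p : ℝ)) * E₁
        ≤ (∏ p ∈ e, f p) / (∏ p ∈ e, (p : ℝ)) * ∏ p ∈ e, (p : ℝ) := by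
          gcongr
          exact hhigh e he
      _ = _ := div_mul_cancel₀ _ h0.ne'
  calc ∑ e ∈ T, (∑ b ∈ S, ∑ b' ∈ S, ∏ p ∈ e, corr (kerFamily U Rel) p b b') / ∏ p ∈ e, (p : ℝ)
      = ∑ b ∈ S, ∑ b' ∈ S, ∑ e ∈ T, (∏ p ∈ e, corr (kerFamily U Rel) p b b')
          / ∏ p ∈ e, (p : ℝ) := by
        simp_rw [sum_div]
        rw [sum_comm]
        exact sum_congr rfl fun b _ => sum_comm
    _ ≤ ∑ b ∈ S, ∑ b' ∈ S, ((if b = b' then Real.exp 1 * L ^ k else 0)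
          + Real.exp 1 * (w + 2 * L) ^ k / E₁) := by
        refine sum_le_sum fun b hb => sum_le_sum fun b' hb' => ?_
        split_ifs with hbb
        · subst hbb
          exact (hdiag b).trans (le_add_of_nonneg_right (by positivity))
        · rw [zero_add]
          exact hoff b hb b' hb' hbb
    _ = _ := by
        simp_rw [sum_add_distrib]
        simp
        ring

/-- A bilinear estimate on average over the moduli. -/
lemma sq_sum_abs_bilinear_le (h : IsMatchingFamily R U Rel) {T : Finset (Finset ℕ)}
    (hT : ∀ e ∈ T, e ⊆ R) {k : ℕ} (hk : ∀ e ∈ T, #e ≤ k) {E₀ : ℝ} (hE₀ : 0 < E₀)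
    (hlow : ∀ e ∈ T, E₀ ≤ ∏ p ∈ e, (p : ℝ)) {D : ℕ} (hD : ∀ e ∈ T, ∏ p ∈ e, p ≤ D)
    {E₁ : ℕ} (hE₁ : 0 < E₁) {L : ℝ} (hL1 : 1 ≤ L) (hL : ∑ p ∈ R, (1 : ℝ) / p ≤ L)
    {A B : Finset ℕ} {a b y v : ℕ} (hA : A ⊆ Ico a (a + y)) (hB : B ⊆ Ico b (b + v)) {w : ℝ}
    (hw0 : 0 ≤ w) (hw : ∀ q ∈ B, ∀ q' ∈ B, q ≠ q' → (#{p ∈ R | q ≡ q' [MOD p]} : ℝ) ≤ w) :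
    (∑ e ∈ T, |∑ n ∈ A, ∑ q ∈ B, ∏ p ∈ e, kerFamily U Rel p n q|) ^ 2
      ≤ #A * (y * (#B * (v / E₀ ^ 2) + E₁ * (#B * √(#B)) + (#B * (Real.exp 1 * L ^ k)
        + (#B) ^ 2 * (Real.exp 1 * (w + 2 * L) ^ k / E₁))) + D ^ 4 * (#B) ^ 2) := by
  have hosc := h.isOscillating
  have hprime : ∀ e ∈ T, ∀ p ∈ e, p.Prime := fun e he p hp => h.prime p (hT e he hp)
  set V : Finset ℕ → ℝ := fun e =>
    ∑ b ∈ B, ∑ b' ∈ B, ∏ p ∈ e, corr (kerFamily U Rel) p b b' with hV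
  set θ : Finset ℕ → ℝ := fun e =>
    SignType.sign (∑ n ∈ A, ∑ q ∈ B, ∏ p ∈ e, kerFamily U Rel p n q) with hθ
  have hθ1 : ∀ e, |θ e| ≤ 1 := fun e => by
    simp only [hθ]
    rcases lt_trichotomy (∑ n ∈ A, ∑ q ∈ B, ∏ p ∈ e, kerFamily U Rel p n q) 0 with h | h | h
    · simp [sign_neg h]
    · simp [h]
    · simp [sign_pos h]
  have hW : ∑ e ∈ T, V e / ∏ p ∈ e, (p : ℝ) ≤ #B * (v / E₀ ^ 2) + E₁ * (#B * √(#B))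
      + (#B * (Real.exp 1 * L ^ k) + (#B) ^ 2 * (Real.exp 1 * (w + 2 * L) ^ k / E₁)) := by
    rw [← sum_filter_add_sum_filter_not T (fun e => ∏ p ∈ e, p ≤ E₁)]
    refine add_le_add ?_ ?_
    · exact h.sum_low_le (fun e he => hT e (mem_filter.1 he).1) hE₀
        (fun e he => hlow e (mem_filter.1 he).1) (fun e he => (mem_filter.1 he).2) hB
    · refine h.sum_high_le (fun e he => hT e (mem_filter.1 he).1)
        (fun e he => hk e (mem_filter.1 he).1) (by exact_mod_cast hE₁) (fun e he => ?_) hL1 hL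
        hw0 hw
      rw [← Nat.cast_prod]
      exact_mod_cast (not_le.1 (mem_filter.1 he).2).le
  have hcardT : #T ≤ D := card_le_of_prod_le hprime hD
  have hN : ∑ e ∈ T, ∏ p ∈ e, (p : ℝ) ≤ D ^ 2 := by
    calc ∑ e ∈ T, ∏ p ∈ e, (p : ℝ) ≤ ∑ e ∈ T, (D : ℝ) := sum_le_sum fun e he => by
          rw [← Nat.cast_prod]
          exact_mod_cast hD e he
      _ = #T * (D : ℝ) := by simp
      _ ≤ D * D := by gcongr
      _ = _ := by ring
  have hlin : ∑ e ∈ T, |∑ n ∈ A, ∑ q ∈ B, ∏ p ∈ e, kerFamily U Rel p n q|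
      = ∑ n ∈ A, ∑ e ∈ T, θ e * ∑ q ∈ B, ∏ p ∈ e, kerFamily U Rel p n q := by
    rw [sum_comm]
    refine sum_congr rfl fun e _ => ?_
    rw [← mul_sum, hθ, sign_mul_self]
  calc (∑ e ∈ T, |∑ n ∈ A, ∑ q ∈ B, ∏ p ∈ e, kerFamily U Rel p n q|) ^ 2
      ≤ #A * ∑ n ∈ A, (∑ e ∈ T, θ e * ∑ q ∈ B, ∏ p ∈ e, kerFamily U Rel p n q) ^ 2 := by
        rw [hlin]
        exact sq_sum_le_card_mul_sum_sq
    _ ≤ #A * ∑ n ∈ Ico a (a + y),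
          (∑ e ∈ T, θ e * ∑ q ∈ B, ∏ p ∈ e, kerFamily U Rel p n q) ^ 2 := by
        refine mul_le_mul_of_nonneg_left ?_ (Nat.cast_nonneg _)
        exact sum_le_sum_of_subset_of_nonneg hA fun _ _ _ => sq_nonneg _
    _ ≤ #A * (y * (∑ e ∈ T, V e / ∏ p ∈ e, (p : ℝ)) + D ^ 4 * (#B) ^ 2) := by
        refine mul_le_mul_of_nonneg_left ?_ (Nat.cast_nonneg _)
        refine (hosc.sum_sq_le T hT θ B a y).trans ?_
        refine add_le_add ?_ ?_
        · rw [mul_sum]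
          refine sum_le_sum fun e he => ?_
          have h0 : 0 ≤ ∏ p ∈ e, (p : ℝ) := prod_nonneg fun _ _ => Nat.cast_nonneg _
          have h1 : 0 ≤ V e := hosc.sum_corr_nonneg (hT e he) B
          have h2 : θ e ^ 2 ≤ 1 := (sq_le_one_iff_abs_le_one _).2 (hθ1 e)
          change _ * V e ≤ _
          calc θ e ^ 2 * (y / ∏ p ∈ e, (p : ℝ)) * V e
              ≤ 1 * (y / ∏ p ∈ e, (p : ℝ)) * V e := by gcongr
            _ = _ := by ring
        · refine mul_le_mul_of_nonneg_right ?_ (by positivity)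
          have h1 : ∑ e ∈ T, |θ e| * ∏ p ∈ e, (p : ℝ) ≤ D ^ 2 := by
            refine le_trans (sum_le_sum fun e _ => ?_) hN
            exact mul_le_of_le_one_left (prod_nonneg fun _ _ => Nat.cast_nonneg _) (hθ1 e)
          calc (∑ e ∈ T, |θ e| * ∏ p ∈ e, (p : ℝ)) ^ 2 ≤ ((D : ℝ) ^ 2) ^ 2 :=
                pow_le_pow_left₀ (sum_nonneg fun e _ => mul_nonneg (abs_nonneg _)
                  (prod_nonneg fun _ _ => Nat.cast_nonneg _)) h1 2
            _ = _ := by ring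
    _ ≤ _ := by gcongr

end IsMatchingFamily

lemma one_add_pow_le {t : ℝ} (ht0 : 0 ≤ t) (ht1 : t ≤ 1) (k : ℕ) :
    (1 + t) ^ k ≤ 1 + 2 ^ k * t := by
  suffices (1 + t) ^ k ≤ 1 + (2 ^ k - 1) * t by nlinarith
  induction k with
  | zero => simp
  | succ k ih =>
    have h1 : (1 : ℝ) ≤ 2 ^ k := one_le_pow₀ (by norm_num)
    calc (1 + t) ^ (k + 1) = (1 + t) ^ k * (1 + t) := pow_succ _ _
      _ ≤ (1 + (2 ^ k - 1) * t) * (1 + t) := by gcongr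
      _ ≤ _ := by
        rw [pow_succ]
        nlinarith [mul_nonneg (sub_nonneg.2 h1) (mul_nonneg ht0 (sub_nonneg.2 ht1))]

lemma sum_prod_card_not_disjoint_le {ι : Type*} [DecidableEq ι] (S B : Finset ι) (hB : B ⊆ S)
    {a : ι → ℝ} (ha : ∀ p ∈ S, 0 ≤ a p) {L : ℝ} (hL1 : 1 ≤ L) (hL : ∑ p ∈ S, a p ≤ L) (k : ℕ) :
    ∑ s ∈ {s ∈ S.powerset | #s ≤ k} with ¬ Disjoint s B, ∏ p ∈ s, a p
      ≤ (∑ p ∈ B, a p) * (Real.exp 1 * L ^ k) := by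
  have hnn : ∀ s ⊆ S, 0 ≤ ∏ p ∈ s, a p := fun s hs => prod_nonneg fun p hp => ha p (hs hp)
  set 𝒮 := {s ∈ S.powerset | #s ≤ k} with h𝒮
  have hmem : ∀ {s}, s ∈ 𝒮 ↔ s ⊆ S ∧ #s ≤ k := by simp [h𝒮]
  calc ∑ s ∈ 𝒮 with ¬ Disjoint s B, ∏ p ∈ s, a p
      ≤ ∑ s ∈ 𝒮 with ¬ Disjoint s B, ∑ p ∈ B, if p ∈ s then ∏ q ∈ s, a q else 0 := by
        refine sum_le_sum fun s hs => ?_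
        rw [mem_filter, not_disjoint_iff] at hs
        obtain ⟨hs, p, hps, hpB⟩ := hs
        have h0 := hnn s (hmem.1 hs).1
        calc ∏ p ∈ s, a p = if p ∈ s then ∏ q ∈ s, a q else 0 := by rw [if_pos hps]
          _ ≤ _ := single_le_sum (f := fun p => if p ∈ s then ∏ q ∈ s, a q else 0)
            (fun p _ => by positivity) hpB
    _ ≤ ∑ s ∈ 𝒮, ∑ p ∈ B, if p ∈ s then ∏ q ∈ s, a q else 0 := by
        refine sum_le_sum_of_subset_of_nonneg (filter_subset _ _) fun s hs _ =>
          sum_nonneg fun p _ => ?_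
        have h0 := hnn s (hmem.1 hs).1
        positivity
    _ = ∑ p ∈ B, ∑ s ∈ 𝒮 with p ∈ s, ∏ q ∈ s, a q := by
        rw [sum_comm]
        exact sum_congr rfl fun p _ => (sum_filter _ _).symm
    _ ≤ ∑ p ∈ B, a p * (Real.exp 1 * L ^ k) := by
        refine sum_le_sum fun p hp => ?_
        have hap := ha p (hB hp)
        calc ∑ s ∈ 𝒮 with p ∈ s, ∏ q ∈ s, a q
            = ∑ s ∈ 𝒮 with p ∈ s, a p * ∏ q ∈ s.erase p, a q := by
              refine sum_congr rfl fun s hs => ?_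
              rw [mul_prod_erase s a (mem_filter.1 hs).2]
          _ = a p * ∑ t ∈ ({s ∈ 𝒮 | p ∈ s}).image (fun s => s.erase p), ∏ q ∈ t, a q := by
              rw [← mul_sum, sum_image]
              intro s hs t ht hst
              simp only [coe_filter, Set.mem_ofPred_eq] at hs ht
              rw [← insert_erase hs.2, ← insert_erase ht.2]
              exact congrArg _ hst
          _ ≤ a p * (Real.exp 1 * L ^ k) := by
              refine mul_le_mul_of_nonneg_left ?_ hap
              refine le_trans (sum_le_sum_of_subset_of_nonneg (fun t ht => ?_) fun s hs _ => ?_)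
                (sum_prod_card_le S ha hL1 hL k)
              · obtain ⟨s, hs, rfl⟩ := mem_image.1 ht
                have hs' := hmem.1 (mem_filter.1 hs).1
                rw [mem_filter, mem_powerset]
                exact ⟨(erase_subset _ _).trans hs'.1, (card_le_card (erase_subset _ _)).trans hs'.2⟩
              · exact hnn s (hmem.1 hs).1
    _ = _ := by rw [sum_mul]

namespace IsMatchingFamily

variable {R : Finset ℕ} {U : ℕ → ℕ → Prop} {Rel : ℕ → ℕ → ℕ → Prop}

open Classical in
/-- The indicator function of a matching, split into its mean and the kernel. -/
lemma indicator_eq (p n q : ℕ) :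
    (if U p n ∧ U p q ∧ Rel p n q then (1 : ℝ) else 0)
      = kerFamily U Rel p n q + (if U p n ∧ U p q then 1 / (classCount p (U p) : ℝ) else 0) := by
  by_cases h1 : U p n <;> by_cases h2 : U p q <;> by_cases h3 : Rel p n q <;>
    simp [kerFamily, ker, h1, h2, h3]

open Classical in
lemma sum_card_eq (A B s : Finset ℕ) :
    (#{x ∈ A ×ˢ B | ∀ p ∈ s, U p x.1 ∧ U p x.2 ∧ Rel p x.1 x.2} : ℝ)
      = ∑ e ∈ s.powerset, (∏ p ∈ s \ e, 1 / (classCount p (U p) : ℝ))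
        * ∑ n ∈ A with ∀ p ∈ s \ e, U p n, ∑ q ∈ B with ∀ p ∈ s \ e, U p q,
          ∏ p ∈ e, kerFamily U Rel p n q := by
  have h1 : ∀ g : Finset ℕ, ∀ n q, ∏ p ∈ g, (if U p n ∧ U p q then
      1 / (classCount p (U p) : ℝ) else 0) = if (∀ p ∈ g, U p n) ∧ ∀ p ∈ g, U p q then
        ∏ p ∈ g, 1 / (classCount p (U p) : ℝ) else 0 := by
    intro g n q
    split_ifs with h
    · exact prod_congr rfl fun p hp => if_pos ⟨h.1 p hp, h.2 p hp⟩
    · rw [← forall₂_and] at h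
      push Not at h
      obtain ⟨p, hp, h⟩ := h
      exact prod_eq_zero hp (if_neg fun h' => h h'.1 h'.2)
  calc (#{x ∈ A ×ˢ B | ∀ p ∈ s, U p x.1 ∧ U p x.2 ∧ Rel p x.1 x.2} : ℝ)
      = ∑ x ∈ A ×ˢ B, ∏ p ∈ s, (if U p x.1 ∧ U p x.2 ∧ Rel p x.1 x.2 then (1 : ℝ) else 0) := by
        rw [← sum_boole]
        exact sum_congr rfl fun x _ => (prod_boole).symm
    _ = ∑ x ∈ A ×ˢ B, ∑ e ∈ s.powerset, (∏ p ∈ e, kerFamily U Rel p x.1 x.2)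
          * if (∀ p ∈ s \ e, U p x.1) ∧ ∀ p ∈ s \ e, U p x.2 then
            ∏ p ∈ s \ e, 1 / (classCount p (U p) : ℝ) else 0 := by
        refine sum_congr rfl fun x _ => ?_
        simp_rw [indicator_eq]
        rw [prod_add]
        simp_rw [h1]
    _ = _ := by
        rw [sum_comm]
        refine sum_congr rfl fun e _ => ?_
        rw [mul_sum, sum_product, sum_filter]
        refine sum_congr rfl fun n _ => ?_
        split_ifs with hn
        · rw [mul_sum, sum_filter]
          refine sum_congr rfl fun q _ => ?_
          by_cases hq : ∀ p ∈ s \ e, U p q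
          · rw [if_pos ⟨hn, hq⟩, if_pos hq, mul_comm]
          · rw [if_neg (fun h => hq h.2), if_neg hq, mul_zero]
        · refine sum_eq_zero fun q _ => ?_
          rw [if_neg (fun h => hn h.1), mul_zero]

lemma one_div_classCount_le' (h : IsMatchingFamily R U Rel) {p : ℕ} (hp : p ∈ R) {E₀ : ℝ}
    (hE₀ : 0 < E₀) (hpE : E₀ ≤ p) :
    1 / (classCount p (U p) : ℝ) ≤ (1 + 2 / E₀) * (1 / p) := by
  have h1 : (p : ℝ) ≤ classCount p (U p) + 1 := by exact_mod_cast h.le_classCount p hp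
  have h2 : (2 : ℝ) ≤ p := by exact_mod_cast (h.prime p hp).two_le
  have h3 : 2 / (p : ℝ) ≤ 2 / E₀ := by gcongr
  calc 1 / (classCount p (U p) : ℝ) ≤ (1 + 2 / (p : ℝ)) * (1 / p) := by
        rw [div_le_iff₀ (by linarith)]
        have h4 : (1 + 2 / (p : ℝ)) * (1 / p) * (p - 1) ≤ (1 + 2 / (p : ℝ)) * (1 / p)
            * classCount p (U p) := by
          gcongr
          linarith
        refine le_trans ?_ h4
        rw [show (1 + 2 / (p : ℝ)) * (1 / p) * (p - 1) = ((p + 2) * (p - 1)) / (p * p) by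
          field_simp, le_div_iff₀ (by positivity)]
        nlinarith
    _ ≤ _ := by gcongr

lemma classCount_le (p : ℕ) (U : ℕ → Prop) : classCount p U ≤ p := by
  classical
  exact (card_le_card (filter_subset _ _)).trans (card_range p).le

open Classical in
/-- Equidistribution in a box, on average over the moduli. -/
lemma sum_abs_card_sub_le (h : IsMatchingFamily R U Rel) (k : ℕ) {E₀ : ℝ} (hE₀ : 2 ≤ E₀)
    (hlow : ∀ p ∈ R, E₀ ≤ p) {L : ℝ} (hL1 : 1 ≤ L) (hL : ∑ p ∈ R, (1 : ℝ) / p ≤ L)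
    {A B : Finset ℕ} {u T : ℝ} (hu : ∀ n ∈ A ∪ B, (#{p ∈ R | ¬ U p n} : ℝ) ≤ u)
    (hT : ∀ A' ⊆ A, ∀ B' ⊆ B, ∑ e ∈ R.powerset with #e ≤ k ∧ e.Nonempty,
      |∑ n ∈ A', ∑ q ∈ B', ∏ p ∈ e, kerFamily U Rel p n q| ≤ T) :
    ∑ s ∈ R.powerset with #s ≤ k,
      |(#{x ∈ A ×ˢ B | ∀ p ∈ s, U p x.1 ∧ U p x.2 ∧ Rel p x.1 x.2} : ℝ)
        - #A * #B * ∏ p ∈ s, 1 / (p : ℝ)|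
      ≤ #A * #B * ((2 ^ (k + 1) + 2 * u) / E₀ * (Real.exp 1 * L ^ k))
        + Real.exp 1 * (2 * L) ^ k * T := by
  have hE0 : 0 < E₀ := by linarith
  set 𝒮 := {s ∈ R.powerset | #s ≤ k} with h𝒮
  have hmem : ∀ {s}, s ∈ 𝒮 ↔ s ⊆ R ∧ #s ≤ k := by simp [h𝒮]
  set c : Finset ℕ → ℝ := fun s => ∏ p ∈ s, 1 / (classCount p (U p) : ℝ) with hc
  set A' : Finset ℕ → Finset ℕ := fun g => {n ∈ A | ∀ p ∈ g, U p n} with hA'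
  set B' : Finset ℕ → Finset ℕ := fun g => {n ∈ B | ∀ p ∈ g, U p n} with hB'
  set J : Finset ℕ → Finset ℕ → ℝ := fun g e =>
    ∑ n ∈ A' g, ∑ q ∈ B' g, ∏ p ∈ e, kerFamily U Rel p n q with hJ
  have hc0 : ∀ s, 0 ≤ c s := fun s => prod_nonneg fun p _ => by positivity
  have hmain : ∀ s ∈ 𝒮,
      |(#{x ∈ A ×ˢ B | ∀ p ∈ s, U p x.1 ∧ U p x.2 ∧ Rel p x.1 x.2} : ℝ)
        - #A * #B * ∏ p ∈ s, 1 / (p : ℝ)|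
      ≤ |c s * (#(A' s) * #(B' s)) - #A * #B * ∏ p ∈ s, 1 / (p : ℝ)|
        + ∑ e ∈ s.powerset with e.Nonempty, c (s \ e) * |J (s \ e) e| := by
    intro s _
    rw [sum_card_eq]
    have h1 := sum_filter_add_sum_filter_not s.powerset (fun e => e.Nonempty)
      (fun e => c (s \ e) * J (s \ e) e)
    have h2 : ({e ∈ s.powerset | ¬ e.Nonempty}) = {∅} := by
      ext e
      simp only [mem_filter, mem_powerset, not_nonempty_iff_eq_empty, mem_singleton]
      constructor
      · exact fun h => h.2
      · rintro rfl
        exact ⟨empty_subset _, rfl⟩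
    rw [h2, sum_singleton, sdiff_empty] at h1
    have h3 : J s ∅ = #(A' s) * #(B' s) := by simp [hJ]
    rw [h3] at h1
    change |∑ e ∈ s.powerset, c (s \ e) * J (s \ e) e - _| ≤ _
    rw [← h1, add_sub_assoc, add_comm]
    refine (abs_add_le _ _).trans (add_le_add le_rfl ?_)
    refine (abs_sum_le_sum_abs _ _).trans (sum_le_sum fun e _ => ?_)
    rw [abs_mul, abs_of_nonneg (hc0 _)]
  have hcsum : ∑ g ∈ 𝒮, c g ≤ Real.exp 1 * (2 * L) ^ k := by
    refine sum_prod_card_le R (fun p _ => by positivity) (by linarith) ?_ k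
    calc ∑ p ∈ R, 1 / (classCount p (U p) : ℝ) ≤ ∑ p ∈ R, 2 * (1 / (p : ℝ)) :=
          sum_le_sum fun p hp => h.one_div_classCount_le hp
      _ ≤ 2 * L := by rw [← mul_sum]; linarith
  have hJsum : ∑ s ∈ 𝒮, ∑ e ∈ s.powerset with e.Nonempty, c (s \ e) * |J (s \ e) e|
      ≤ Real.exp 1 * (2 * L) ^ k * T := by
    set 𝒯 := {e ∈ R.powerset | #e ≤ k ∧ e.Nonempty} with h𝒯
    have hmem' : ∀ {e}, e ∈ 𝒯 ↔ e ⊆ R ∧ #e ≤ k ∧ e.Nonempty := by simp [h𝒯]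
    have hT0 : 0 ≤ T := (sum_nonneg fun _ _ => abs_nonneg _).trans
      (hT ∅ (empty_subset _) ∅ (empty_subset _))
    calc ∑ s ∈ 𝒮, ∑ e ∈ s.powerset with e.Nonempty, c (s \ e) * |J (s \ e) e|
        = ∑ e ∈ 𝒯, ∑ s ∈ 𝒮 with e ⊆ s, c (s \ e) * |J (s \ e) e| := by
          refine sum_comm' fun s e => ?_
          simp only [mem_filter, mem_powerset, hmem, hmem']
          constructor
          · rintro ⟨⟨h1, h2⟩, h3, h4⟩
            exact ⟨⟨⟨h1, h2⟩, h3⟩, h3.trans h1, (card_le_card h3).trans h2, h4⟩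
          · tauto
      _ = ∑ e ∈ 𝒯, ∑ g ∈ ({s ∈ 𝒮 | e ⊆ s}).image (fun s => s \ e), c g * |J g e| := by
          refine sum_congr rfl fun e _ => ?_
          rw [sum_image]
          intro s hs t ht hst
          simp only [coe_filter, Set.mem_ofPred_eq] at hs ht
          simp only at hst
          rw [← sdiff_union_of_subset hs.2, hst, sdiff_union_of_subset ht.2]
      _ ≤ ∑ e ∈ 𝒯, ∑ g ∈ 𝒮, c g * |J g e| := by
          refine sum_le_sum fun e _ => sum_le_sum_of_subset_of_nonneg (fun g hg => ?_)
            fun g _ _ => mul_nonneg (hc0 g) (abs_nonneg _)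
          obtain ⟨s, hs, rfl⟩ := mem_image.1 hg
          have hs' := hmem.1 (mem_filter.1 hs).1
          exact hmem.2 ⟨sdiff_subset.trans hs'.1, (card_le_card sdiff_subset).trans hs'.2⟩
      _ = ∑ g ∈ 𝒮, c g * ∑ e ∈ 𝒯, |J g e| := by
          rw [sum_comm]
          exact sum_congr rfl fun g _ => by rw [mul_sum]
      _ ≤ ∑ g ∈ 𝒮, c g * T := by
          refine sum_le_sum fun g _ => mul_le_mul_of_nonneg_left ?_ (hc0 g)
          exact hT _ (filter_subset _ _) _ (filter_subset _ _)
      _ = (∑ g ∈ 𝒮, c g) * T := by rw [sum_mul]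
      _ ≤ _ := by gcongr
  have hN0 : ∀ s : Finset ℕ, 0 ≤ ∏ p ∈ s, 1 / (p : ℝ) := fun s =>
    prod_nonneg fun p _ => by positivity
  have hNsum : ∑ s ∈ 𝒮, ∏ p ∈ s, 1 / (p : ℝ) ≤ Real.exp 1 * L ^ k :=
    sum_prod_card_le R (fun p _ => by positivity) hL1 hL k
  have hcN : ∀ s ∈ 𝒮, c s ≤ (1 + 2 ^ (k + 1) / E₀) * ∏ p ∈ s, 1 / (p : ℝ) := by
    intro s hs
    have hs' := hmem.1 hs
    calc c s ≤ ∏ p ∈ s, (1 + 2 / E₀) * (1 / (p : ℝ)) :=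
          prod_le_prod (fun p _ => by positivity) fun p hp =>
            h.one_div_classCount_le' (hs'.1 hp) hE0 (hlow p (hs'.1 hp))
      _ = (1 + 2 / E₀) ^ #s * ∏ p ∈ s, 1 / (p : ℝ) := by rw [prod_mul_distrib, prod_const]
      _ ≤ (1 + 2 ^ (k + 1) / E₀) * ∏ p ∈ s, 1 / (p : ℝ) := by
          refine mul_le_mul_of_nonneg_right ?_ (hN0 s)
          have h1 : 2 / E₀ ≤ 1 := by rw [div_le_one hE0]; exact hE₀
          have h2 : 0 ≤ 2 / E₀ := by positivity
          calc (1 + 2 / E₀) ^ #s ≤ (1 + 2 / E₀) ^ k :=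
                pow_le_pow_right₀ (by linarith) hs'.2
            _ ≤ 1 + 2 ^ k * (2 / E₀) := one_add_pow_le h2 h1 k
            _ = _ := by rw [pow_succ]; ring
  have hNc : ∀ s ∈ 𝒮, ∏ p ∈ s, 1 / (p : ℝ) ≤ c s := by
    intro s hs
    refine prod_le_prod (fun p _ => by positivity) fun p hp => ?_
    have h1 := h.classCount_pos ((hmem.1 hs).1 hp)
    have h2 := classCount_le p (U p)
    gcongr
  set Bad : ℕ × ℕ → Finset ℕ := fun x => {p ∈ R | ¬ U p x.1} ∪ {p ∈ R | ¬ U p x.2} with hBad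
  have hBadR : ∀ x, Bad x ⊆ R := fun x => union_subset (filter_subset _ _) (filter_subset _ _)
  have hdiff : ∀ s ∈ 𝒮, (#A * #B : ℝ) - #(A' s) * #(B' s)
      ≤ ∑ x ∈ A ×ˢ B, if ¬ Disjoint s (Bad x) then 1 else 0 := by
    intro s hs
    have h1 : (#A * #B : ℝ) = ∑ x ∈ A ×ˢ B, 1 := by simp [card_product]
    have h2 : (#(A' s) * #(B' s) : ℝ) = ∑ x ∈ A ×ˢ B, if x ∈ A' s ×ˢ B' s then 1 else 0 := by
      rw [← Nat.cast_mul, ← card_product, sum_boole, filter_mem_eq_inter,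
        inter_eq_right.2 (product_subset_product (filter_subset _ _) (filter_subset _ _))]
    rw [h1, h2, ← sum_sub_distrib]
    refine sum_le_sum fun x hx => ?_
    by_cases hd : Disjoint s (Bad x)
    · have h3 : x ∈ A' s ×ˢ B' s := by
        rw [mem_product] at hx
        simp only [hA', hB', mem_product, mem_filter]
        rw [disjoint_left] at hd
        refine ⟨⟨hx.1, fun p hp => ?_⟩, hx.2, fun p hp => ?_⟩
        · by_contra hU
          exact hd hp (mem_union_left _ (mem_filter.2 ⟨(hmem.1 hs).1 hp, hU⟩))
        · by_contra hU
          exact hd hp (mem_union_right _ (mem_filter.2 ⟨(hmem.1 hs).1 hp, hU⟩))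
      simp [h3, hd]
    · rw [if_pos hd]
      split_ifs <;> simp
  have hBadsum : ∀ x ∈ A ×ˢ B, ∑ s ∈ 𝒮 with ¬ Disjoint s (Bad x), ∏ p ∈ s, 1 / (p : ℝ)
      ≤ 2 * u / E₀ * (Real.exp 1 * L ^ k) := by
    intro x hx
    rw [mem_product] at hx
    refine (sum_prod_card_not_disjoint_le R (Bad x) (hBadR x) (fun p _ => by positivity) hL1 hL
      k).trans (mul_le_mul_of_nonneg_right ?_ (by positivity))
    calc ∑ p ∈ Bad x, 1 / (p : ℝ) ≤ ∑ p ∈ Bad x, 1 / E₀ := sum_le_sum fun p hp => by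
          have := hlow p (hBadR x hp)
          gcongr
      _ = #(Bad x) / E₀ := by rw [sum_const, nsmul_eq_mul, mul_one_div]
      _ ≤ 2 * u / E₀ := by
          gcongr
          have h1 : (#(Bad x) : ℝ) ≤ #{p ∈ R | ¬ U p x.1} + #{p ∈ R | ¬ U p x.2} := by
            exact_mod_cast card_union_le _ _
          have h2 := hu x.1 (mem_union_left _ hx.1)
          have h3 := hu x.2 (mem_union_right _ hx.2)
          linarith
  have hmain2 : ∑ s ∈ 𝒮, |c s * (#(A' s) * #(B' s)) - #A * #B * ∏ p ∈ s, 1 / (p : ℝ)|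
      ≤ #A * #B * ((2 ^ (k + 1) + 2 * u) / E₀ * (Real.exp 1 * L ^ k)) := by
    calc ∑ s ∈ 𝒮, |c s * (#(A' s) * #(B' s)) - #A * #B * ∏ p ∈ s, 1 / (p : ℝ)|
        ≤ ∑ s ∈ 𝒮, (#A * #B * (2 ^ (k + 1) / E₀) * (∏ p ∈ s, 1 / (p : ℝ))
          + ∑ x ∈ A ×ˢ B, if ¬ Disjoint s (Bad x) then ∏ p ∈ s, 1 / (p : ℝ) else 0) := by
          refine sum_le_sum fun s hs => ?_
          have h1 := hcN s hs
          have h2 := hNc s hs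
          have h3 := hN0 s
          have h4 : (#(A' s) * #(B' s) : ℝ) ≤ #A * #B := by
            have h5 : #(A' s) ≤ #A := card_le_card (filter_subset _ _)
            have h6 : #(B' s) ≤ #B := card_le_card (filter_subset _ _)
            exact_mod_cast Nat.mul_le_mul h5 h6
          have h5 : (∏ p ∈ s, 1 / (p : ℝ)) * ((#A * #B : ℝ) - #(A' s) * #(B' s))
              ≤ ∑ x ∈ A ×ˢ B, if ¬ Disjoint s (Bad x) then ∏ p ∈ s, 1 / (p : ℝ) else 0 := by
            refine (mul_le_mul_of_nonneg_left (hdiff s hs) h3).trans_eq ?_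
            rw [mul_sum]
            exact sum_congr rfl fun x _ => by rw [mul_ite, mul_one, mul_zero]
          have h6 : (0 : ℝ) ≤ #(A' s) * #(B' s) := by positivity
          set N := ∏ p ∈ s, 1 / (p : ℝ)
          have h7 : (c s - N) * (#(A' s) * #(B' s)) ≤ #A * #B * (2 ^ (k + 1) / E₀) * N := by
            calc (c s - N) * (#(A' s) * #(B' s)) ≤ (2 ^ (k + 1) / E₀ * N) * (#A * #B) := by
                  gcongr
                  linarith
              _ = _ := by ring
          have h8 : 0 ≤ (c s - N) * (#(A' s) * #(B' s)) := mul_nonneg (by linarith) h6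
          have h9 : 0 ≤ N * ((#A * #B : ℝ) - #(A' s) * #(B' s)) := mul_nonneg h3 (by linarith)
          rw [abs_le]
          constructor <;> linarith
      _ = #A * #B * (2 ^ (k + 1) / E₀) * (∑ s ∈ 𝒮, ∏ p ∈ s, 1 / (p : ℝ))
          + ∑ x ∈ A ×ˢ B, ∑ s ∈ 𝒮 with ¬ Disjoint s (Bad x), ∏ p ∈ s, 1 / (p : ℝ) := by
          rw [sum_add_distrib, ← mul_sum, sum_comm]
          congr 1
          exact sum_congr rfl fun x _ => (sum_filter _ _).symm
      _ ≤ #A * #B * (2 ^ (k + 1) / E₀) * (Real.exp 1 * L ^ k)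
          + ∑ x ∈ A ×ˢ B, 2 * u / E₀ * (Real.exp 1 * L ^ k) := by
          gcongr with x hx
          exact hBadsum x hx
      _ = _ := by
          rw [sum_const, card_product, nsmul_eq_mul, Nat.cast_mul]
          ring
  calc _ ≤ ∑ s ∈ 𝒮, (|c s * (#(A' s) * #(B' s)) - #A * #B * ∏ p ∈ s, 1 / (p : ℝ)|
        + ∑ e ∈ s.powerset with e.Nonempty, c (s \ e) * |J (s \ e) e|) := sum_le_sum hmain
    _ ≤ _ := by
        rw [sum_add_distrib]
        exact add_le_add hmain2 hJsum

end IsMatchingFamily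

/-! ### Divisors of `s(mPQ)` -/

lemma isMatching_of_not_dvd {p c A m : ℕ} (hp : p.Prime) (hA : ¬ p ∣ A) (hm : ¬ p ∣ m)
    (hcA : c + m = A) :
    IsMatching p (fun n => ¬ p ∣ c * n + A) (fun a b => p ∣ c * a * b + A * (a + b) + A) := by
  have := Fact.mk hp
  have hA' : (A : ZMod p) ≠ 0 := by rwa [Ne, ZMod.natCast_eq_zero_iff]
  have hm' : (m : ZMod p) ≠ 0 := by rwa [Ne, ZMod.natCast_eq_zero_iff]
  have hcA' : (c : ZMod p) + m = A := by exact_mod_cast congrArg (Nat.cast (R := ZMod p)) hcA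
  have hU : ∀ n, ¬ p ∣ c * n + A ↔ (c * n + A : ZMod p) ≠ 0 := fun n => by
    rw [← ZMod.natCast_eq_zero_iff]
    push_cast
    rfl
  have hR : ∀ a b, p ∣ c * a * b + A * (a + b) + A ↔
      (c * a * b + A * (a + b) + A : ZMod p) = 0 := fun a b => by
    rw [← ZMod.natCast_eq_zero_iff]
    push_cast
    rfl
  simp_rw [hU, hR]
  refine ⟨fun a => ?_, fun b a => ?_, fun a b b' hb => ?_, fun b hb => ?_,
    fun a a' b ha ha' hb h h' => ?_, fun a b b' ha hb hb' h h' => ?_⟩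
  · simp
  · simp
  · rw [← ZMod.natCast_eq_natCast_iff] at hb
    rw [hb]
  · refine ⟨(-(A * (b + 1)) / (c * b + A) : ZMod p).val, ZMod.val_lt _, ?_, ?_⟩
    · rw [ZMod.natCast_zmod_val]
      intro h
      have h1 : (c * (-(A * (b + 1)) / (c * b + A)) + A : ZMod p) * (c * b + A) = A * m := by
        rw [add_mul, mul_assoc, div_mul_cancel₀ _ hb, ← hcA']
        ring
      rw [h, zero_mul] at h1
      exact mul_ne_zero hA' hm' h1.symm
    · rw [ZMod.natCast_zmod_val]
      field_simp
      ring
  · rw [← ZMod.natCast_eq_natCast_iff]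
    have h1 : ((a : ZMod p) - a') * (c * b + A) = 0 := by linear_combination h - h'
    rcases mul_eq_zero.1 h1 with h1 | h1
    · exact sub_eq_zero.1 h1
    · exact absurd h1 hb
  · rw [← ZMod.natCast_eq_natCast_iff]
    have h1 : ((b : ZMod p) - b') * (c * a + A) = 0 := by linear_combination h - h'
    rcases mul_eq_zero.1 h1 with h1 | h1
    · exact sub_eq_zero.1 h1
    · exact absurd h1 ha

lemma le_classCount_add_one {p c A : ℕ} (hp : p.Prime) (hA : ¬ p ∣ A) :
    p ≤ classCount p (fun n => ¬ p ∣ c * n + A) + 1 := by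
  classical
  have := Fact.mk hp
  have hA' : (A : ZMod p) ≠ 0 := by rwa [Ne, ZMod.natCast_eq_zero_iff]
  have h1 := card_filter_add_card_filter_not (s := range p) (fun n => ¬ p ∣ c * n + A)
  rw [card_range] at h1
  have h2 : #{n ∈ range p | ¬ ¬ p ∣ c * n + A} ≤ 1 := by
    rw [card_le_one]
    intro a ha b hb
    simp only [not_not, mem_filter, mem_range] at ha hb
    obtain ⟨ha, hpa⟩ := ha
    obtain ⟨hb, hpb⟩ := hb
    rw [← ZMod.natCast_eq_zero_iff] at hpa hpb
    push_cast at hpa hpb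
    have h3 : (c : ZMod p) * (a - b) = 0 := by linear_combination hpa - hpb
    rcases mul_eq_zero.1 h3 with h3 | h3
    · rw [h3, zero_mul, zero_add] at hpa
      exact absurd hpa hA'
    · rw [sub_eq_zero, ZMod.natCast_eq_natCast_iff] at h3
      exact h3.eq_of_lt_of_lt ha hb
  have h3 : classCount p (fun n => ¬ p ∣ c * n + A) = #{n ∈ range p | ¬ p ∣ c * n + A} := by
    unfold classCount
    congr
  omega

lemma not_dvd_of_dvd {p c A m a b : ℕ} (hp : p.Prime) (hA : ¬ p ∣ A) (hm : ¬ p ∣ m)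
    (hcA : c + m = A) (h : p ∣ c * a * b + A * (a + b) + A) : ¬ p ∣ c * a + A := by
  have := Fact.mk hp
  have hA' : (A : ZMod p) ≠ 0 := by rwa [Ne, ZMod.natCast_eq_zero_iff]
  have hm' : (m : ZMod p) ≠ 0 := by rwa [Ne, ZMod.natCast_eq_zero_iff]
  have hcA' : (c : ZMod p) + m = A := by exact_mod_cast congrArg (Nat.cast (R := ZMod p)) hcA
  intro h'
  rw [← ZMod.natCast_eq_zero_iff] at h h'
  push_cast at h h'
  have h1 : (A : ZMod p) * (a + 1) = 0 := by linear_combination h - b * h'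
  rcases mul_eq_zero.1 h1 with h1 | h1
  · exact hA' h1
  · exact hm' (by linear_combination hcA' + h' - c * h1)

/-- The sum of all divisors. -/
def sig (n : ℕ) : ℕ := ∑ d ∈ n.divisors, d

lemma sOf_add_self (n : ℕ) : sOf n + n = sig n :=
  (Nat.sum_divisors_eq_sum_properDivisors_add_self (n := n)).symm

lemma sig_mul {m n : ℕ} (h : m.Coprime n) : sig (m * n) = sig m * sig n :=
  h.sum_divisors_mul

lemma sig_prime {p : ℕ} (hp : p.Prime) : sig p = p + 1 := by
  rw [sig, hp.sum_divisors, add_comm]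

lemma sOf_mul_prime {m P : ℕ} (hP : P.Prime) (hm : ¬ P ∣ m) :
    sOf (m * P) = sOf m * P + sig m := by
  have h1 := sOf_add_self (m * P)
  rw [sig_mul ((Nat.Prime.coprime_iff_not_dvd hP).2 hm).symm, sig_prime hP] at h1
  have h2 := sOf_add_self m
  rw [← h2] at h1 ⊢
  linarith

lemma sOf_mul_prime_mul_prime {m P Q : ℕ} (hP : P.Prime) (hQ : Q.Prime) (hPQ : P ≠ Q)
    (hPm : ¬ P ∣ m) (hQm : ¬ Q ∣ m) :
    sOf (m * Q * P) = sOf m * P * Q + sig m * (P + Q) + sig m := by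
  have h1 : ¬ P ∣ m * Q := by
    rw [hP.dvd_mul, Nat.prime_dvd_prime_iff_eq hP hQ]
    tauto
  have h2 := sOf_add_self (m * Q)
  rw [sOf_mul_prime hQ hQm] at h2
  rw [sOf_mul_prime hP h1, sOf_mul_prime hQ hQm, ← h2, ← sOf_add_self m]
  ring

lemma sig_pos {n : ℕ} (hn : n ≠ 0) : 0 < sig n :=
  hn.bot_lt.trans_le (by rw [← sOf_add_self]; exact Nat.le_add_left _ _)

lemma sOf_pos {n : ℕ} (hn : 2 ≤ n) : 0 < sOf n := by
  have h : 1 ∈ n.properDivisors := by simp; omega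
  exact zero_lt_one.trans_le (single_le_sum (f := fun d => d) (fun _ _ => Nat.zero_le _) h)

lemma sig_le_sq {n : ℕ} : sig n ≤ n ^ 2 := by
  rcases Nat.eq_zero_or_pos n with rfl | hn
  · simp [sig]
  · calc sig n ≤ ∑ d ∈ n.divisors, n := sum_le_sum fun d hd => Nat.divisor_le hd
      _ = #n.divisors * n := by simp
      _ ≤ n * n := Nat.mul_le_mul_right _ (Nat.card_divisors_le_self n)
      _ = n ^ 2 := (sq n).symm

lemma sOf_le_sq {n : ℕ} : sOf n ≤ n ^ 2 :=
  le_trans (by rw [← sOf_add_self]; exact Nat.le_add_right _ _) sig_le_sq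

/-! ### Divisibility of `s(mPQ)` on average over a box -/

lemma isMatchingFamily_sOf {m : ℕ} {R : Finset ℕ} (hR : ∀ p ∈ R, p.Prime)
    (hRm : ∀ p ∈ R, ¬ p ∣ m ∧ ¬ p ∣ sig m) :
    IsMatchingFamily R (fun p n => ¬ p ∣ sOf m * n + sig m)
      (fun p a b => p ∣ sOf m * a * b + sig m * (a + b) + sig m) where
  prime := hR
  matching p hp := isMatching_of_not_dvd (hR p hp) (hRm p hp).2 (hRm p hp).1 (sOf_add_self m)
  le_classCount p hp := le_classCount_add_one (hR p hp) (hRm p hp).2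

lemma sum_abs_card_dvd_sOf_sub_le (k : ℕ) {m : ℕ} (hm : 0 < m) {R : Finset ℕ}
    (hR : ∀ p ∈ R, p.Prime) (hRm : ∀ p ∈ R, ¬ p ∣ m ∧ ¬ p ∣ sig m)
    {A B : Finset ℕ} (hA : ∀ p ∈ A, p.Prime ∧ ¬ p ∣ m) (hB : ∀ p ∈ B, p.Prime ∧ ¬ p ∣ m)
    (hAB : Disjoint A B) {a b y v : ℕ} (hAy : A ⊆ Ico a (a + y)) (hBv : B ⊆ Ico b (b + v))
    {E₀ : ℝ} (hE₀ : 2 ≤ E₀) (hlow : ∀ p ∈ R, E₀ ≤ p)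
    {L ℓ : ℝ} (hL1 : 1 ≤ L) (hL : ∑ p ∈ R, 1 / (p : ℝ) ≤ L)
    (hℓ : ∀ n ∈ A ∪ B, Real.log (m * n) ≤ ℓ)
    {D E₁ : ℕ} (hD : ∀ e ⊆ R, #e ≤ k → ∏ p ∈ e, p ≤ D) (hv : 0 < v)
    (h1 : E₁ * E₀ ^ 2 ≤ √v) (h2 : Real.exp 1 * L ^ k * E₀ ^ 2 ≤ v)
    (h3 : Real.exp 1 * (2 * ℓ + 2 * L) ^ k * E₀ ^ 2 ≤ E₁) (h4 : D ^ 4 * E₀ ^ 2 ≤ y) (hℓ0 : 0 ≤ ℓ) :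
    ∑ s ∈ R.powerset with #s ≤ k,
      |(#{x ∈ A ×ˢ B | ∀ p ∈ s, p ∣ sOf (m * x.2 * x.1)} : ℝ) - #A * #B * ∏ p ∈ s, 1 / (p : ℝ)|
      ≤ #A * #B * ((2 ^ (k + 1) + 8 * ℓ) / E₀ * (Real.exp 1 * L ^ k)) +
        Real.exp 1 * (2 * L) ^ k * (3 * √(#A * #B * (y * v)) / E₀) := by
  classical
  have hF := isMatchingFamily_sOf hR hRm
  set U : ℕ → ℕ → Prop := fun p n => ¬ p ∣ sOf m * n + sig m with hU
  set Rel : ℕ → ℕ → ℕ → Prop :=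
    fun p a b => p ∣ sOf m * a * b + sig m * (a + b) + sig m with hRel
  have hE0 : 0 < E₀ := by linarith
  have hv' : (0 : ℝ) < v := by exact_mod_cast hv
  have hcount : ∀ s ∈ R.powerset, {x ∈ A ×ˢ B | ∀ p ∈ s, p ∣ sOf (m * x.2 * x.1)} =
      {x ∈ A ×ˢ B | ∀ p ∈ s, U p x.1 ∧ U p x.2 ∧ Rel p x.1 x.2} := by
    intro s hs
    ext x
    simp only [mem_filter]
    refine and_congr_right fun hx => forall₂_congr fun p hp => ?_
    have hx := mem_product.1 hx
    have hpR := mem_powerset.1 hs hp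
    have hne : x.1 ≠ x.2 := fun h => disjoint_left.1 hAB hx.1 (h ▸ hx.2)
    rw [sOf_mul_prime_mul_prime (hA _ hx.1).1 (hB _ hx.2).1 hne (hA _ hx.1).2 (hB _ hx.2).2]
    refine ⟨fun h => ⟨?_, ?_, h⟩, fun h => h.2.2⟩
    · exact not_dvd_of_dvd (hR p hpR) (hRm p hpR).2 (hRm p hpR).1 (sOf_add_self m) h
    · refine not_dvd_of_dvd (b := x.1) (hR p hpR) (hRm p hpR).2 (hRm p hpR).1 (sOf_add_self m) ?_
      rwa [mul_right_comm, add_comm x.2]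
  have hprime : ∀ n ∈ A ∪ B, n.Prime ∧ ¬ n ∣ m := fun n hn =>
    (mem_union.1 hn).elim (hA n) (hB n)
  have hu : ∀ n ∈ A ∪ B, (#{p ∈ R | ¬ U p n} : ℝ) ≤ 4 * ℓ := by
    intro n hn
    have hn' := hprime n hn
    have hmn : 2 ≤ m * n := hn'.1.two_le.trans (Nat.le_mul_of_pos_left n hm)
    have hs := sOf_mul_prime hn'.1 hn'.2
    have hs0 := sOf_pos hmn
    calc (#{p ∈ R | ¬ U p n} : ℝ) ≤ 2 * Real.log (sOf (m * n) : ℕ) := by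
          refine card_le_two_mul_log hs0.ne' fun p hp => ?_
          have hp := mem_filter.1 hp
          simp only [hU, not_not] at hp
          exact ⟨hR p hp.1, hs ▸ hp.2⟩
      _ ≤ 2 * Real.log ((m * n : ℕ) ^ 2 : ℝ) := by
          gcongr
          exact_mod_cast sOf_le_sq
      _ = 4 * Real.log (m * n) := by
          rw [Real.log_pow]
          push_cast
          ring
      _ ≤ _ := by linarith [hℓ n hn]
  have hw : ∀ q ∈ B, ∀ q' ∈ B, q ≠ q' → (#{p ∈ R | q ≡ q' [MOD p]} : ℝ) ≤ 2 * ℓ := by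
    have key : ∀ q ∈ B, ∀ q' ∈ B, q < q' → (#{p ∈ R | q ≡ q' [MOD p]} : ℝ) ≤ 2 * ℓ := by
      intro q hq q' hq' h
      calc (#{p ∈ R | q ≡ q' [MOD p]} : ℝ) ≤ 2 * Real.log (q' - q : ℕ) := by
            refine card_le_two_mul_log (Nat.sub_ne_zero_of_lt h) fun p hp => ?_
            have hp := mem_filter.1 hp
            exact ⟨hR p hp.1, (Nat.modEq_iff_dvd' h.le).1 hp.2⟩
        _ ≤ 2 * Real.log (m * q') := by
            gcongr
            · exact_mod_cast Nat.sub_pos_of_lt h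
            · exact_mod_cast (Nat.sub_le q' q).trans (Nat.le_mul_of_pos_left q' hm)
        _ ≤ _ := by linarith [hℓ q' (mem_union_right _ hq')]
    intro q hq q' hq' hne
    rcases hne.lt_or_gt with h | h
    · exact key q hq q' hq' h
    · simp_rw [Nat.ModEq.comm (a := q)]
      exact key q' hq' q hq h
  have hBv' : (#B : ℝ) ≤ v := by exact_mod_cast (card_le_card hBv).trans (by simp)
  have hE₁ : 0 < E₁ := by
    have : (0 : ℝ) < E₁ := lt_of_lt_of_le (by positivity) h3
    exact_mod_cast this
  have hE₁' : (0 : ℝ) < E₁ := by exact_mod_cast hE₁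
  have hT : ∀ A' ⊆ A, ∀ B' ⊆ B, ∑ e ∈ R.powerset with #e ≤ k ∧ e.Nonempty,
      |∑ n ∈ A', ∑ q ∈ B', ∏ p ∈ e, kerFamily U Rel p n q| ≤ 3 * √(#A * #B * (y * v)) / E₀ := by
    intro A' hA' B' hB'
    refine abs_le_of_sq_le_sq' ?_ (by positivity) |>.2
    have hcA : (#A' : ℝ) ≤ #A := by exact_mod_cast card_le_card hA'
    have hcB : (#B' : ℝ) ≤ #B := by exact_mod_cast card_le_card hB'
    refine (hF.sq_sum_abs_bilinear_le (T := {e ∈ R.powerset | #e ≤ k ∧ e.Nonempty})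
      (fun e he => mem_powerset.1 (mem_filter.1 he).1) (fun e he => (mem_filter.1 he).2.1) hE0
      ?_ (fun e he => hD e (mem_powerset.1 (mem_filter.1 he).1) (mem_filter.1 he).2.1) hE₁ hL1 hL
      (hA'.trans hAy) (hB'.trans hBv) (w := 2 * ℓ) (by positivity)
      fun q hq q' hq' => hw q (hB' hq) q' (hB' hq')).trans ?_
    · intro e he
      obtain ⟨he, -, p, hp⟩ := mem_filter.1 he
      have he := mem_powerset.1 he
      calc E₀ ≤ p := hlow p (he hp)
        _ ≤ _ := by
          rw [← Nat.cast_prod]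
          exact_mod_cast Nat.le_of_dvd (prod_pos fun q hq => (hR q (he hq)).pos)
            (dvd_prod_of_mem (fun q : ℕ => q) hp)
    · have hy : (0 : ℝ) ≤ y := by positivity
      have hsv : √(v : ℝ) * √v = v := Real.mul_self_sqrt hv'.le
      have hsv0 : 0 < √(v : ℝ) := Real.sqrt_pos.2 hv'
      have e1 : (E₁ : ℝ) * (#B * √(#B : ℝ)) ≤ #B * v / E₀ ^ 2 := by
        rw [le_div_iff₀ (by positivity)]
        calc (E₁ : ℝ) * (#B * √(#B : ℝ)) * E₀ ^ 2 = #B * (√(#B : ℝ) * (E₁ * E₀ ^ 2)) := by ring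
          _ ≤ #B * (√v * √v) := by gcongr
          _ = _ := by rw [hsv]
      have e2 : (#B : ℝ) * (Real.exp 1 * L ^ k) ≤ #B * v / E₀ ^ 2 := by
        rw [le_div_iff₀ (by positivity)]
        calc (#B : ℝ) * (Real.exp 1 * L ^ k) * E₀ ^ 2 = #B * (Real.exp 1 * L ^ k * E₀ ^ 2) := by
              ring
          _ ≤ _ := by gcongr
      have e3 : (#B : ℝ) ^ 2 * (Real.exp 1 * (2 * ℓ + 2 * L) ^ k / E₁) ≤ #B * v / E₀ ^ 2 := by
        rw [le_div_iff₀ (by positivity)]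
        calc (#B : ℝ) ^ 2 * (Real.exp 1 * (2 * ℓ + 2 * L) ^ k / E₁) * E₀ ^ 2
            = (#B : ℝ) * #B * (Real.exp 1 * (2 * ℓ + 2 * L) ^ k * E₀ ^ 2 / E₁) := by ring
          _ ≤ (#B : ℝ) * v * 1 := by
              gcongr
              exact (div_le_one hE₁').2 h3
          _ = _ := mul_one _
      have e4 : (D : ℝ) ^ 4 * #B ^ 2 ≤ y * (#B * v / E₀ ^ 2) := by
        rw [mul_div_assoc', le_div_iff₀ (by positivity)]
        calc (D : ℝ) ^ 4 * #B ^ 2 * E₀ ^ 2 = D ^ 4 * E₀ ^ 2 * ((#B : ℝ) * #B) := by ring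
          _ ≤ y * ((#B : ℝ) * v) := by gcongr
      calc (#A' : ℝ) * (y * (#B' * (v / E₀ ^ 2) + E₁ * (#B' * √(#B' : ℝ)) +
            (#B' * (Real.exp 1 * L ^ k) + #B' ^ 2 *
              (Real.exp 1 * (2 * ℓ + 2 * L) ^ k / E₁))) + D ^ 4 * #B' ^ 2)
          ≤ #A * (y * (#B * (v / E₀ ^ 2) + E₁ * (#B * √(#B : ℝ)) +
            (#B * (Real.exp 1 * L ^ k) + #B ^ 2 *
              (Real.exp 1 * (2 * ℓ + 2 * L) ^ k / E₁))) + D ^ 4 * #B ^ 2) := by gcongr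
        _ ≤ #A * (y * (#B * v / E₀ ^ 2 + #B * v / E₀ ^ 2 +
            (#B * v / E₀ ^ 2 + #B * v / E₀ ^ 2)) + y * (#B * v / E₀ ^ 2)) := by
            rw [← mul_div_assoc]
            gcongr
        _ = 5 * (#A * #B * (y * v) / E₀ ^ 2) := by ring
        _ ≤ 9 * (#A * #B * (y * v) / E₀ ^ 2) := by
            have : 0 ≤ (#A : ℝ) * #B * (y * v) / E₀ ^ 2 := by positivity
            linarith
        _ = _ := by
            rw [div_pow, mul_pow, Real.sq_sqrt (by positivity)]
            ring
  have hmain := hF.sum_abs_card_sub_le k hE₀ hlow hL1 hL (A := A) (B := B) (u := 4 * ℓ)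
    (fun n hn => by convert hu n hn) hT
  refine le_trans (le_of_eq ?_) (hmain.trans (le_of_eq ?_))
  · refine sum_congr rfl fun s hs => ?_
    congr! 4
    convert hcount s (mem_filter.1 hs).1
  · ring

/-! ### An upper bound on average -/

lemma card_le_of_modEq {T : Finset ℕ} {N M : ℕ} (hT : ∀ t ∈ T, t ≤ N)
    (h : ∀ t ∈ T, ∀ t' ∈ T, t ≡ t' [MOD M]) : #T ≤ N / M + 1 := by
  rw [← card_range (N / M + 1)]
  refine card_le_card_of_injOn (fun t => t / M) (fun t ht => ?_) fun t ht t' ht' htt => ?_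
  · simpa [Nat.lt_succ_iff] using Nat.div_le_div_right (hT t ht)
  · have h1 : t % M = t' % M := h t ht t' ht'
    have h2 : t / M = t' / M := htt
    rw [← Nat.div_add_mod t M, ← Nat.div_add_mod t' M, h1, h2]

lemma modEq_prod {s : Finset ℕ} (hs : ∀ p ∈ s, p.Prime) {a b : ℕ}
    (h : ∀ p ∈ s, a ≡ b [MOD p]) : a ≡ b [MOD ∏ p ∈ s, p] := by
  rw [← Int.natCast_modEq_iff, Int.modEq_iff_dvd]
  push_cast
  refine prod_dvd_of_coprime (fun p hp q hq hpq => ?_) fun p hp => ?_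
  · exact Nat.isCoprime_iff_coprime.2 ((Nat.coprime_primes (hs p hp) (hs q hq)).2 hpq)
  · exact Int.modEq_iff_dvd.1 (Int.natCast_modEq_iff.2 (h p hp))

lemma card_powerset_filter_le (Q : Finset ℕ) (k : ℕ) :
    (#{s ∈ Q.powerset | #s ≤ k} : ℝ) ≤ Real.exp 1 * (1 + #Q) ^ k := by
  have h := sum_prod_card_le Q (a := fun _ => 1) (fun _ _ => zero_le_one) (L := 1 + #Q)
    (by linarith [Nat.cast_nonneg (α := ℝ) #Q]) (by simp) k
  simpa using h

lemma sum_inv_Icc_le (N : ℕ) : ∑ m ∈ Icc 1 N, 1 / (m : ℝ) ≤ 1 + Real.log N := by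
  have h := harmonic_le_one_add_log N
  rw [harmonic_eq_sum_Icc] at h
  simpa using h

lemma card_mul_le_div {x : ℝ} (hx : 0 ≤ x) (d : ℕ) :
    (#{n ∈ Icc 1 ⌊x⌋₊ | d ∣ n} : ℝ) ≤ x * (1 / d) := by
  have h : #{n ∈ Icc 1 ⌊x⌋₊ | d ∣ n} = ⌊x⌋₊ / d := by
    rw [← Nat.card_multiples' ⌊x⌋₊ d]
    congr 1
    ext n
    simp only [mem_filter, mem_Icc, mem_range]
    constructor
    · rintro ⟨h1, h2⟩
      exact ⟨by omega, by omega, h2⟩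
    · rintro ⟨h1, h2, h3⟩
      exact ⟨⟨by omega, by omega⟩, h3⟩
  rw [h, mul_one_div]
  exact Nat.cast_div_le.trans (by gcongr; exact Nat.floor_le hx)

lemma card_many_prime_factors_le {x : ℝ} (hx : 0 ≤ x) {R : Finset ℕ} (hR : ∀ p ∈ R, p.Prime)
    {L : ℝ} (hL : ∑ p ∈ R, 1 / (p : ℝ) ≤ L) (r : ℕ) :
    (#{n ∈ Icc 1 ⌊x⌋₊ | r ≤ #{p ∈ R | p ∣ n}} : ℝ) ≤ x * Real.exp (Real.exp 1 * L - r) := by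
  have hsub : {n ∈ Icc 1 ⌊x⌋₊ | r ≤ #{p ∈ R | p ∣ n}} ⊆
      (powersetCard r R).biUnion fun E => {n ∈ Icc 1 ⌊x⌋₊ | ∏ p ∈ E, p ∣ n} := by
    intro n hn
    obtain ⟨hn, h⟩ := mem_filter.1 hn
    obtain ⟨E, hE, hEr⟩ := exists_subset_card_eq h
    refine mem_biUnion.2 ⟨E, mem_powersetCard.2 ⟨hE.trans (filter_subset _ _), hEr⟩,
      mem_filter.2 ⟨hn, ?_⟩⟩
    rw [prod_primes_dvd_iff fun p hp => hR p (mem_filter.1 (hE hp)).1]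
    exact fun p hp => (mem_filter.1 (hE hp)).2
  calc (#{n ∈ Icc 1 ⌊x⌋₊ | r ≤ #{p ∈ R | p ∣ n}} : ℝ)
      ≤ ∑ E ∈ powersetCard r R, (#{n ∈ Icc 1 ⌊x⌋₊ | ∏ p ∈ E, p ∣ n} : ℝ) := by
        exact_mod_cast (card_le_card hsub).trans card_biUnion_le
    _ ≤ ∑ E ∈ powersetCard r R, x * ∏ p ∈ E, 1 / (p : ℝ) := by
        refine sum_le_sum fun E _ => (card_mul_le_div hx _).trans_eq ?_
        push_cast
        simp
    _ ≤ _ := by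
        rw [← mul_sum]
        gcongr
        exact sum_prod_powersetCard_le R (fun p _ => by positivity) hL r

lemma card_many_prime_factors_sOf_le {x X₀ y₀ : ℝ} {r : ℕ} (hx : 1 ≤ x) {R S : Finset ℕ}
    (hR : ∀ p ∈ R, p.Prime) (hS : S ⊆ Icc 1 ⌊x⌋₊)
    (hP : ∀ n ∈ S, ∃ m P : ℕ, P.Prime ∧ n = m * P ∧ ¬ P ∣ m ∧ X₀ < P)
    {L : ℝ} (hL : ∑ p ∈ R, 1 / (p : ℝ) ≤ L) (hyr : y₀ ^ r ≤ X₀)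
    (hRy : ∀ p ∈ R, (p : ℝ) ≤ y₀) :
    (#{n ∈ S | r ≤ #{p ∈ R | ¬ p ∣ n ∧ p ∣ sOf n}} : ℝ) ≤
      2 * x * (1 + Real.log x) * Real.exp (Real.exp 1 * L - r) := by
  set N := ⌊x⌋₊ with hN
  have hNx : (N : ℝ) ≤ x := Nat.floor_le (by linarith)
  have hN1 : 1 ≤ N := by rw [hN, Nat.one_le_floor_iff]; exact hx
  set F : ℕ → Finset ℕ → Finset ℕ := fun m E =>
    {P ∈ Icc 1 (N / m) | P.Prime ∧ ¬ P ∣ m ∧ X₀ < P ∧ ∀ p ∈ E, ¬ p ∣ m * P ∧ p ∣ sOf (m * P)}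
    with hF
  have hsub : {n ∈ S | r ≤ #{p ∈ R | ¬ p ∣ n ∧ p ∣ sOf n}} ⊆
      (Icc 1 N).biUnion fun m => (powersetCard r R).biUnion fun E => (F m E).image (m * ·) := by
    intro n hn
    obtain ⟨hn, h⟩ := mem_filter.1 hn
    obtain ⟨E, hE, hEr⟩ := exists_subset_card_eq h
    obtain ⟨m, P, hPp, rfl, hPm, hXP⟩ := hP n hn
    have hn' := mem_Icc.1 (hS hn)
    have hm : 0 < m := Nat.pos_of_ne_zero (by rintro rfl; omega)
    refine mem_biUnion.2 ⟨m, mem_Icc.2 ⟨hm, (Nat.le_mul_of_pos_right m hPp.pos).trans hn'.2⟩,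
      mem_biUnion.2 ⟨E, mem_powersetCard.2 ⟨hE.trans (filter_subset _ _), hEr⟩,
      mem_image_of_mem _ (mem_filter.2 ⟨mem_Icc.2 ⟨hPp.one_le, ?_⟩, hPp, hPm, hXP, ?_⟩)⟩⟩
    · rw [Nat.le_div_iff_mul_le hm, mul_comm]
      exact hn'.2
    · exact fun p hp => (mem_filter.1 (hE hp)).2
  have hFcard : ∀ m ∈ Icc 1 N, ∀ E ∈ powersetCard r R,
      (#(F m E) : ℝ) ≤ 2 * x * (1 / m) * ∏ p ∈ E, 1 / (p : ℝ) := by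
    intro m hm E hE
    obtain ⟨hER, hEr⟩ := mem_powersetCard.1 hE
    have hm1 : (1 : ℝ) ≤ m := by exact_mod_cast (mem_Icc.1 hm).1
    have hEp : ∀ p ∈ E, p.Prime := fun p hp => hR p (hER hp)
    rcases (F m E).eq_empty_or_nonempty with h0 | ⟨P₀, hP₀⟩
    · rw [h0, card_empty, Nat.cast_zero]
      have : 0 ≤ ∏ p ∈ E, 1 / (p : ℝ) := prod_nonneg fun p _ => by positivity
      positivity
    · have hEpos : 0 < ∏ p ∈ E, p := prod_pos fun p hp => (hEp p hp).pos
      have hcard : #(F m E) ≤ (N / m) / (∏ p ∈ E, p) + 1 := by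
        refine card_le_of_modEq (fun t ht => (mem_Icc.1 (mem_filter.1 ht).1).2) fun t ht t' ht' => ?_
        refine modEq_prod hEp fun p hp => ?_
        obtain ⟨-, htp, htm, -, hE1⟩ := mem_filter.1 ht
        obtain ⟨-, htp', htm', -, hE1'⟩ := mem_filter.1 ht'
        have h1 := (hE1 p hp).2
        have h1' := (hE1' p hp).2
        rw [sOf_mul_prime htp htm] at h1
        rw [sOf_mul_prime htp' htm'] at h1'
        have hpm : ¬ p ∣ m := fun h => (hE1 p hp).1 (h.mul_right t)
        have hps : ¬ p ∣ sOf m := by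
          intro h
          have h2 : p ∣ sig m := (Nat.dvd_add_right (h.mul_right t)).1 h1
          rw [← sOf_add_self] at h2
          exact hpm ((Nat.dvd_add_right h).1 h2)
        have h3 : sOf m * t + sig m ≡ sOf m * t' + sig m [MOD p] :=
          ((Nat.modEq_zero_iff_dvd).2 h1).trans ((Nat.modEq_zero_iff_dvd).2 h1').symm
        exact (Nat.ModEq.add_right_cancel' _ h3).cancel_left_of_coprime
          ((Nat.Prime.coprime_iff_not_dvd (hEp p hp)).2 hps)
      have hEle : ((∏ p ∈ E, p : ℕ) : ℝ) ≤ N / m := by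
        calc ((∏ p ∈ E, p : ℕ) : ℝ) = ∏ p ∈ E, (p : ℝ) := by push_cast; rfl
          _ ≤ ∏ p ∈ E, y₀ := prod_le_prod (fun _ _ => by positivity) fun p hp => hRy p (hER hp)
          _ = y₀ ^ r := by rw [prod_const, hEr]
          _ ≤ X₀ := hyr
          _ ≤ P₀ := (mem_filter.1 hP₀).2.2.2.1.le
          _ ≤ ((N / m : ℕ) : ℝ) := by exact_mod_cast (mem_Icc.1 (mem_filter.1 hP₀).1).2
          _ ≤ _ := Nat.cast_div_le
      have hEpos' : (0 : ℝ) < ((∏ p ∈ E, p : ℕ) : ℝ) := by exact_mod_cast hEpos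
      calc (#(F m E) : ℝ) ≤ (((N / m) / (∏ p ∈ E, p) : ℕ) : ℝ) + 1 := by exact_mod_cast hcard
        _ ≤ N / m / ((∏ p ∈ E, p : ℕ) : ℝ) + N / m / ((∏ p ∈ E, p : ℕ) : ℝ) := by
            gcongr
            · exact Nat.cast_div_le.trans (by gcongr; exact Nat.cast_div_le)
            · rwa [one_le_div hEpos']
        _ ≤ x / m / ((∏ p ∈ E, p : ℕ) : ℝ) + x / m / ((∏ p ∈ E, p : ℕ) : ℝ) := by gcongr
        _ = _ := by
            push_cast
            rw [prod_div_distrib, prod_const_one]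
            ring
  calc (#{n ∈ S | r ≤ #{p ∈ R | ¬ p ∣ n ∧ p ∣ sOf n}} : ℝ)
      ≤ ∑ m ∈ Icc 1 N, ∑ E ∈ powersetCard r R, (#(F m E) : ℝ) := by
        refine (Nat.cast_le.2 ((card_le_card hsub).trans card_biUnion_le)).trans ?_
        push_cast
        refine sum_le_sum fun m _ => ?_
        refine (Nat.cast_le.2 card_biUnion_le).trans ?_
        push_cast
        exact sum_le_sum fun E _ => Nat.cast_le.2 card_image_le
    _ ≤ ∑ m ∈ Icc 1 N, ∑ E ∈ powersetCard r R, 2 * x * (1 / m) * ∏ p ∈ E, 1 / (p : ℝ) :=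
        sum_le_sum fun m hm => sum_le_sum fun E hE => hFcard m hm E hE
    _ = 2 * x * (∑ m ∈ Icc 1 N, 1 / (m : ℝ)) *
          ∑ E ∈ powersetCard r R, ∏ p ∈ E, 1 / (p : ℝ) := by
        simp_rw [← mul_sum]
        rw [← sum_mul, ← mul_sum]
    _ ≤ _ := by
        refine mul_le_mul (mul_le_mul_of_nonneg_left ?_ (by positivity)) ?_
          (sum_nonneg fun _ _ => prod_nonneg fun _ _ => by positivity)
          (mul_nonneg (by positivity) (by linarith [Real.log_nonneg hx]))
        · refine (sum_inv_Icc_le N).trans ?_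
          have : (0 : ℝ) < N := by exact_mod_cast hN1
          gcongr
        · exact sum_prod_powersetCard_le R (fun p _ => by positivity) hL r

lemma sum_card_dvd_sOf_le (k r : ℕ) {x X₀ y₀ : ℝ} (hx : 1 ≤ x) {R S : Finset ℕ}
    (hR : ∀ p ∈ R, p.Prime) (hS : S ⊆ Icc 1 ⌊x⌋₊)
    (hP : ∀ n ∈ S, ∃ m P : ℕ, P.Prime ∧ n = m * P ∧ ¬ P ∣ m ∧ X₀ < P)
    {L : ℝ} (hL : ∑ p ∈ R, 1 / (p : ℝ) ≤ L) (hy₀ : 1 < y₀) (hyr : y₀ ^ r ≤ X₀) :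
    ∑ s ∈ R.powerset with #s ≤ k, (#{n ∈ S | ∀ p ∈ s, p ∣ sOf n} : ℝ) ≤
      Real.exp 1 * (1 + (2 * r + 2 * Real.log x / Real.log y₀)) ^ k * #S +
      Real.exp 1 * (1 + 4 * Real.log x) ^ k *
        (x * (3 + 2 * Real.log x) * Real.exp (Real.exp 1 * L - r)) := by
  have hx0 : 0 ≤ x := by linarith
  have hlogx : 0 ≤ Real.log x := Real.log_nonneg hx
  have hlogy : 0 < Real.log y₀ := Real.log_pos hy₀
  set ω : ℕ → ℕ := fun n => #{p ∈ R | p ∣ sOf n} with hω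
  set W : ℝ := 2 * r + 2 * Real.log x / Real.log y₀ with hW
  have hW0 : 0 ≤ W := by positivity
  have hSn : ∀ n ∈ S, 2 ≤ n ∧ Real.log (sOf n : ℕ) ≤ 2 * Real.log x := by
    intro n hn
    obtain ⟨m, P, hPp, rfl, hPm, hXP⟩ := hP n hn
    have hn' := mem_Icc.1 (hS hn)
    have hm : 0 < m := Nat.pos_of_ne_zero (by rintro rfl; omega)
    have h2 : 2 ≤ m * P := hPp.two_le.trans (Nat.le_mul_of_pos_left P hm)
    refine ⟨h2, ?_⟩
    have h3 := sOf_pos h2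
    calc Real.log (sOf (m * P) : ℕ) ≤ Real.log (x ^ 2) := by
          refine Real.log_le_log (by exact_mod_cast h3) ?_
          calc (sOf (m * P) : ℝ) ≤ ((m * P : ℕ) : ℝ) ^ 2 := by exact_mod_cast sOf_le_sq
            _ ≤ x ^ 2 := by
              gcongr
              exact (Nat.le_floor_iff hx0).1 hn'.2
      _ = _ := by rw [Real.log_pow]; push_cast; ring
  have hω4 : ∀ n ∈ S, (ω n : ℝ) ≤ 4 * Real.log x := by
    intro n hn
    have h1 : (ω n : ℝ) ≤ 2 * Real.log (sOf n : ℕ) :=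
      card_le_two_mul_log (sOf_pos (hSn n hn).1).ne' fun p hp =>
        ⟨hR p (mem_filter.1 hp).1, (mem_filter.1 hp).2⟩
    linarith [(hSn n hn).2]
  have hbad : (#{n ∈ S | W < ω n} : ℝ) ≤ x * (3 + 2 * Real.log x) *
      Real.exp (Real.exp 1 * L - r) := by
    set R₀ := R.filter fun p : ℕ => (p : ℝ) ≤ y₀ with hR₀
    have hsub : {n ∈ S | W < ω n} ⊆ {n ∈ Icc 1 ⌊x⌋₊ | r ≤ #{p ∈ R | p ∣ n}} ∪
        {n ∈ S | r ≤ #{p ∈ R₀ | ¬ p ∣ n ∧ p ∣ sOf n}} := by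
      intro n hn
      obtain ⟨hn, hWn⟩ := mem_filter.1 hn
      rw [mem_union, mem_filter, mem_filter]
      by_contra! hcon
      have h1 := hcon.1 (hS hn)
      have h2 := hcon.2 hn
      have h3 : (#(R.filter fun p : ℕ => y₀ < (p : ℝ) ∧ p ∣ sOf n) : ℝ) ≤ 2 * Real.log x / Real.log y₀ := by
        rw [le_div_iff₀ hlogy]
        refine le_trans (card_mul_log_le (sOf_pos (hSn n hn).1).ne' (by linarith) ?_)
          (hSn n hn).2
        intro p hp
        have hp := mem_filter.1 hp
        exact ⟨hR p hp.1, hp.2.2, hp.2.1.le⟩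
      have h4 : ω n ≤ #{p ∈ R | p ∣ n} + #{p ∈ R₀ | ¬ p ∣ n ∧ p ∣ sOf n} +
          #(R.filter fun p : ℕ => y₀ < (p : ℝ) ∧ p ∣ sOf n) := by
        refine (card_le_card ?_).trans ((card_union_le _ _).trans
          (Nat.add_le_add_right (card_union_le _ _) _))
        intro p hp
        obtain ⟨hpR, hps⟩ := mem_filter.1 hp
        simp only [mem_union, mem_filter, hR₀]
        rcases le_or_gt (p : ℝ) y₀ with h | h
        · tauto
        · tauto
      have h1' : (#{p ∈ R | p ∣ n} : ℝ) ≤ r := by exact_mod_cast h1.le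
      have h2' : (#{p ∈ R₀ | ¬ p ∣ n ∧ p ∣ sOf n} : ℝ) ≤ r := by exact_mod_cast h2.le
      have h4' : (ω n : ℝ) ≤ #{p ∈ R | p ∣ n} + #{p ∈ R₀ | ¬ p ∣ n ∧ p ∣ sOf n} +
          #(R.filter fun p : ℕ => y₀ < (p : ℝ) ∧ p ∣ sOf n) := by exact_mod_cast h4
      linarith
    have h1 := card_many_prime_factors_le hx0 hR hL r
    have h2 := card_many_prime_factors_sOf_le (R := R₀) hx
      (fun p hp => hR p (mem_filter.1 hp).1) hS hP
      ((sum_le_sum_of_subset_of_nonneg (filter_subset _ _) fun _ _ _ => by positivity).trans hL)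
      hyr fun p hp => (mem_filter.1 hp).2
    have h3 : (#{n ∈ S | W < ω n} : ℝ) ≤ #{n ∈ Icc 1 ⌊x⌋₊ | r ≤ #{p ∈ R | p ∣ n}} +
        #{n ∈ S | r ≤ #{p ∈ R₀ | ¬ p ∣ n ∧ p ∣ sOf n}} := by
      exact_mod_cast (card_le_card hsub).trans (card_union_le _ _)
    linarith
  calc ∑ s ∈ R.powerset with #s ≤ k, (#{n ∈ S | ∀ p ∈ s, p ∣ sOf n} : ℝ)
      = ∑ n ∈ S, (#{s ∈ ({p ∈ R | p ∣ sOf n}).powerset | #s ≤ k} : ℝ) := by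
        have h := sum_card_bipartiteAbove_eq_sum_card_bipartiteBelow
          (s := {s ∈ R.powerset | #s ≤ k}) (t := S) fun s n => ∀ p ∈ s, p ∣ sOf n
        rw [← Nat.cast_sum, ← Nat.cast_sum]
        refine congrArg _ (h.trans (sum_congr rfl fun n _ => ?_))
        rw [bipartiteBelow, filter_filter]
        congr 1
        ext s
        simp only [mem_filter, mem_powerset, subset_iff]
        constructor
        · rintro ⟨h1, h2, h3⟩
          exact ⟨fun p hp => ⟨h1 hp, h3 p hp⟩, h2⟩
        · rintro ⟨h1, h2⟩
          exact ⟨fun p hp => (h1 hp).1, h2, fun p hp => (h1 hp).2⟩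
    _ ≤ ∑ n ∈ S, Real.exp 1 * (1 + (ω n : ℝ)) ^ k :=
        sum_le_sum fun n _ => card_powerset_filter_le _ k
    _ ≤ ∑ n ∈ S, (Real.exp 1 * (1 + W) ^ k +
          if W < ω n then Real.exp 1 * (1 + 4 * Real.log x) ^ k else 0) := by
        refine sum_le_sum fun n hn => ?_
        split_ifs with h
        · refine (?_ : _ ≤ Real.exp 1 * (1 + 4 * Real.log x) ^ k).trans
            (le_add_of_nonneg_left (by positivity))
          gcongr
          exact hω4 n hn
        · rw [add_zero]
          gcongr
          exact not_lt.1 h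
    _ = Real.exp 1 * (1 + W) ^ k * #S +
          Real.exp 1 * (1 + 4 * Real.log x) ^ k * #{n ∈ S | W < ω n} := by
        rw [sum_add_distrib, sum_const, nsmul_eq_mul, ← sum_filter, sum_const, nsmul_eq_mul]
        ring
    _ ≤ _ := by gcongr

/-! ### Sparse sets -/

lemma sum_inv_sq_le_of_lt {S : Finset ℕ} {y : ℝ} (hy : 0 < y) (hS : ∀ q ∈ S, y < q) :
    ∑ q ∈ S, 1 / (q : ℝ) ^ 2 ≤ 2 / y := by
  obtain ⟨N, hN⟩ := S.bddAbove
  calc ∑ q ∈ S, 1 / (q : ℝ) ^ 2 ≤ ∑ q ∈ Ioo ⌊y⌋₊ (N + 1), ((q : ℝ) ^ 2)⁻¹ := by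
        simp_rw [one_div]
        refine sum_le_sum_of_subset_of_nonneg (fun q hq => mem_Ioo.2 ⟨?_, ?_⟩)
          fun _ _ _ => by positivity
        · exact (Nat.floor_lt hy.le).2 (hS q hq)
        · exact Nat.lt_succ_of_le (hN hq)
    _ ≤ 2 / (⌊y⌋₊ + 1) := by exact_mod_cast sum_Ioo_inv_sq_le (α := ℝ) ⌊y⌋₊ (N + 1)
    _ ≤ 2 / y := by
        gcongr
        exact (Nat.lt_floor_add_one y).le

lemma card_le_mul_sum_inv {ι : Type*} {x : ℝ} (hx : 0 ≤ x) {S : Finset ℕ} (hS : S ⊆ Icc 1 ⌊x⌋₊)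
    (I : Finset ι) (d : ι → ℕ) (h : ∀ n ∈ S, ∃ i ∈ I, d i ∣ n) :
    (#S : ℝ) ≤ x * ∑ i ∈ I, 1 / (d i : ℝ) := by
  have hsub : S ⊆ I.biUnion fun i => {n ∈ Icc 1 ⌊x⌋₊ | d i ∣ n} := by
    intro n hn
    obtain ⟨i, hi, hin⟩ := h n hn
    exact mem_biUnion.2 ⟨i, hi, mem_filter.2 ⟨hS hn, hin⟩⟩
  calc (#S : ℝ) ≤ ∑ i ∈ I, (#{n ∈ Icc 1 ⌊x⌋₊ | d i ∣ n} : ℝ) := by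
        exact_mod_cast (card_le_card hsub).trans card_biUnion_le
    _ ≤ ∑ i ∈ I, x * (1 / (d i : ℝ)) := sum_le_sum fun i _ => card_mul_le_div hx _
    _ = _ := by rw [mul_sum]

lemma card_sq_dvd_le {x y : ℝ} (hx : 0 ≤ x) (hy : 0 < y) {S : Finset ℕ} (hS : S ⊆ Icc 1 ⌊x⌋₊)
    (h : ∀ n ∈ S, ∃ q : ℕ, y < q ∧ q ^ 2 ∣ n) : (#S : ℝ) ≤ x * (2 / y) := by
  refine (card_le_mul_sum_inv hx hS ((Icc 1 ⌊x⌋₊).filter fun q : ℕ => y < (q : ℝ))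
    (fun q => q ^ 2) fun n hn => ?_).trans ?_
  · obtain ⟨q, hq, hqn⟩ := h n hn
    have hn' := mem_Icc.1 (hS hn)
    have hq0 : 0 < q := by
      have : (0 : ℝ) < q := hy.trans hq
      exact_mod_cast this
    refine ⟨q, mem_filter.2 ⟨mem_Icc.2 ⟨hq0, ?_⟩, hq⟩, hqn⟩
    exact (Nat.le_of_dvd hn'.1 ((dvd_pow_self q two_ne_zero).trans hqn)).trans hn'.2
  · gcongr
    push_cast
    exact sum_inv_sq_le_of_lt hy fun q hq => (mem_filter.1 hq).2

lemma card_close_divisors_le {x X₀ δ : ℝ} (hx : 1 ≤ x) (hX₀ : 0 < X₀) (hδ : 0 < δ) (hδ1 : δ ≤ 1)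
    {S : Finset ℕ} (hS : S ⊆ Icc 1 ⌊x⌋₊)
    (h : ∀ n ∈ S, ∃ P Q : ℕ, X₀ < P ∧ Q < P ∧ P < Real.exp δ * Q ∧ P * Q ∣ n) :
    (#S : ℝ) ≤ x * (3 * (δ * (1 + Real.log x) + 2 / X₀)) := by
  set I := (Icc 1 ⌊x⌋₊).filter fun P : ℕ => X₀ < (P : ℝ) with hI
  set J : ℕ → Finset ℕ := fun P => (range P).filter fun Q : ℕ => (P : ℝ) < Real.exp δ * Q with hJ
  have hJcard : ∀ P, (#(J P) : ℝ) ≤ δ * P + 1 := by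
    intro P
    have hsub : J P ⊆ Ico (P - ⌈δ * P⌉₊) P := by
      intro Q hQ
      obtain ⟨hQ, hPQ⟩ := mem_filter.1 hQ
      have hQ := mem_range.1 hQ
      refine mem_Ico.2 ⟨?_, hQ⟩
      rw [Nat.sub_le_iff_le_add]
      have h1 : (P : ℝ) ≤ Q + δ * P := by
        have h2 : (P : ℝ) * Real.exp (-δ) ≤ Q := by
          rw [Real.exp_neg, ← div_eq_mul_inv, div_le_iff₀ (Real.exp_pos _), mul_comm]
          exact hPQ.le
        have h3 : 1 - δ ≤ Real.exp (-δ) := by linarith [Real.add_one_le_exp (-δ)]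
        nlinarith [Nat.cast_nonneg (α := ℝ) P]
      have h4 : (P : ℝ) ≤ Q + ⌈δ * P⌉₊ := h1.trans (by gcongr; exact Nat.le_ceil _)
      exact_mod_cast h4
    calc (#(J P) : ℝ) ≤ ((P - (P - ⌈δ * P⌉₊) : ℕ) : ℝ) := by
          exact_mod_cast (card_le_card hsub).trans (by simp)
      _ ≤ (⌈δ * P⌉₊ : ℝ) := by exact_mod_cast (by omega)
      _ ≤ _ := (Nat.ceil_lt_add_one (by positivity)).le
  have hexp : Real.exp δ ≤ 3 :=
    (Real.exp_le_exp.2 hδ1).trans (by linarith [Real.exp_one_lt_d9])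
  have hlogx : 0 ≤ Real.log x := Real.log_nonneg hx
  refine (card_le_mul_sum_inv (by linarith) hS (I.sigma J) (fun i => i.1 * i.2)
    fun n hn => ?_).trans ?_
  · obtain ⟨P, Q, hP, hQP, hPQ, hn'⟩ := h n hn
    have hn1 := mem_Icc.1 (hS hn)
    refine ⟨⟨P, Q⟩, mem_sigma.2 ⟨mem_filter.2 ⟨mem_Icc.2 ⟨(Nat.zero_le Q).trans_lt hQP, ?_⟩, hP⟩,
      mem_filter.2 ⟨mem_range.2 hQP, hPQ⟩⟩, hn'⟩
    exact (Nat.le_of_dvd hn1.1 ((dvd_mul_right P Q).trans hn')).trans hn1.2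
  · gcongr
    rw [sum_sigma]
    calc ∑ P ∈ I, ∑ Q ∈ J P, 1 / ((P * Q : ℕ) : ℝ)
        ≤ ∑ P ∈ I, (3 * (δ * (1 / P) + 1 / (P : ℝ) ^ 2)) := by
          refine sum_le_sum fun P hP => ?_
          have hP0 : (0 : ℝ) < P := hX₀.trans (mem_filter.1 hP).2
          calc ∑ Q ∈ J P, 1 / ((P * Q : ℕ) : ℝ) ≤ ∑ Q ∈ J P, 3 / (P : ℝ) ^ 2 := by
                refine sum_le_sum fun Q hQ => ?_
                have hPQ := (mem_filter.1 hQ).2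
                have hQ0 : (0 : ℝ) < Q := by
                  by_contra! hcon
                  nlinarith [Real.exp_pos δ]
                push_cast
                rw [div_le_div_iff₀ (by positivity) (by positivity)]
                have hPQ3 : (P : ℝ) ≤ 3 * Q := hPQ.le.trans (by gcongr)
                nlinarith
            _ = #(J P) * (3 / (P : ℝ) ^ 2) := by rw [sum_const, nsmul_eq_mul]
            _ ≤ (δ * P + 1) * (3 / (P : ℝ) ^ 2) := by
                gcongr
                exact hJcard P
            _ = _ := by field_simp
      _ = 3 * (δ * ∑ P ∈ I, 1 / (P : ℝ) + ∑ P ∈ I, 1 / (P : ℝ) ^ 2) := by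
          rw [← mul_sum, sum_add_distrib, ← mul_sum]
      _ ≤ _ := by
          gcongr
          · calc ∑ P ∈ I, 1 / (P : ℝ) ≤ ∑ P ∈ Icc 1 ⌊x⌋₊, 1 / (P : ℝ) :=
                  sum_le_sum_of_subset_of_nonneg (filter_subset _ _) fun _ _ _ => by positivity
              _ ≤ 1 + Real.log ⌊x⌋₊ := sum_inv_Icc_le _
              _ ≤ _ := by
                  have : 0 < ⌊x⌋₊ := Nat.floor_pos.2 hx
                  gcongr
                  exact Nat.floor_le (by linarith)
          · exact sum_inv_sq_le_of_lt hX₀ fun P hP => (mem_filter.1 hP).2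

lemma card_smooth_mul_prime_le {x X₀ : ℝ} (hx : 1 ≤ x) (hX₀ : 1 < X₀) {z : ℕ} {S : Finset ℕ}
    (hS : S ⊆ Icc 1 ⌊x⌋₊)
    (h : ∀ n ∈ S, ∃ m P : ℕ, n = m * P ∧ P.Prime ∧ X₀ < P ∧ ∀ p, p.Prime → p ∣ m → p ≤ z) :
    (#S : ℝ) ≤ 5 * x / Real.log X₀ * Real.exp (2 * ∑ p ∈ Nat.primesLE z, 1 / (p : ℝ)) := by
  classical
  have hlog : 0 < Real.log X₀ := Real.log_pos hX₀
  set I := {m ∈ Icc 1 ⌊x⌋₊ | (∀ p, p.Prime → p ∣ m → p ≤ z) ∧ X₀ < x / m} with hI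
  have hsub : S ⊆ I.biUnion fun m => (Nat.primesLE ⌊x / m⌋₊).image (m * ·) := by
    intro n hn
    obtain ⟨m, P, rfl, hP, hXP, hm⟩ := h n hn
    have hn' := mem_Icc.1 (hS hn)
    have hm0 : 0 < m := Nat.pos_of_ne_zero (by rintro rfl; omega)
    have hle : (P : ℝ) ≤ x / m := by
      rw [le_div_iff₀ (by exact_mod_cast hm0), mul_comm]
      exact_mod_cast (Nat.le_floor_iff (by linarith)).1 hn'.2
    refine mem_biUnion.2 ⟨m, mem_filter.2 ⟨mem_Icc.2 ⟨hm0, ?_⟩, hm, hXP.trans_le hle⟩,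
      mem_image_of_mem _ (Nat.mem_primesLE.2 ⟨Nat.le_floor hle, hP⟩)⟩
    exact (Nat.le_mul_of_pos_right m hP.pos).trans hn'.2
  calc (#S : ℝ) ≤ ∑ m ∈ I, (#(Nat.primesLE ⌊x / m⌋₊) : ℝ) := by
        exact_mod_cast (card_le_card hsub).trans
          (card_biUnion_le.trans (sum_le_sum fun m _ => card_image_le))
    _ ≤ ∑ m ∈ I, 5 * x / Real.log X₀ * (1 / m) := by
        refine sum_le_sum fun m hm => ?_
        have hXm := (mem_filter.1 hm).2.2
        refine (card_primesLE_le (hX₀.trans hXm)).trans ?_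
        rw [mul_one_div, div_right_comm, ← mul_div_assoc]
        have : 0 < x / m := by linarith
        gcongr
    _ = 5 * x / Real.log X₀ * ∑ m ∈ I, 1 / (m : ℝ) := by rw [mul_sum]
    _ ≤ _ := by
        gcongr
        exact sum_inv_le_of_forall_prime_le I z fun m hm => (mem_filter.1 hm).2.1

lemma sig_prime_pow {q : ℕ} (hq : q.Prime) (a : ℕ) :
    sig (q ^ a) = ∑ i ∈ range (a + 1), q ^ i := by
  rw [sig, Nat.sum_divisors_prime_pow hq]

lemma exists_prime_pow_of_dvd_sig {n p : ℕ} (hn : n ≠ 0) (hp : p.Prime) (h : p ∣ sig n) :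
    ∃ q a : ℕ, q.Prime ∧ 1 ≤ a ∧ q ^ a ∣ n ∧ p ∣ sig (q ^ a) := by
  rw [Nat.multiplicative_factorization sig (fun _ _ h => sig_mul h) (by simp [sig]) hn,
    Finsupp.prod, hp.prime.dvd_finsetProd_iff] at h
  obtain ⟨q, hq, hpq⟩ := h
  have hq' := Nat.support_factorization n ▸ hq
  refine ⟨q, n.factorization q, Nat.prime_of_mem_primeFactors hq',
    Nat.one_le_iff_ne_zero.2 (Finsupp.mem_support_iff.1 hq), Nat.ordProj_dvd n q, hpq⟩

lemma card_dvd_sig_le {x T : ℝ} (hx : 1 ≤ x) (hT : 2 ≤ T) {S : Finset ℕ} (hS : S ⊆ Icc 1 ⌊x⌋₊)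
    (h : ∀ n ∈ S, ∃ p : ℕ, p.Prime ∧ T < p ∧ p ∣ n ∧ p ∣ sig n) :
    (#S : ℝ) ≤ x * (4 * (1 + Real.log x) / T) + x * (3 / √(T / 2)) := by
  classical
  have hx0 : 0 ≤ x := by linarith
  set t := √(T / 2) with ht
  have ht0 : 0 < t := Real.sqrt_pos.2 (by linarith)
  have ht2 : t ^ 2 = T / 2 := Real.sq_sqrt (by linarith)
  set N := ⌊x⌋₊ with hN
  have hN1 : 1 ≤ N := by rw [hN, Nat.one_le_floor_iff]; exact hx
  set P1 : ℕ → Prop := fun n => ∃ p j : ℕ, T < p ∧ 1 ≤ j ∧ 1 < p * j ∧ p * (p * j - 1) ∣ n with hP1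
  have hsplit : ∀ n ∈ S, ¬ P1 n → ∃ q a : ℕ, q.Prime ∧ 2 ≤ a ∧ t ^ 2 < (q ^ a : ℕ) ∧ q ^ a ∣ n := by
    intro n hn hnP
    obtain ⟨p, hp, hTp, hpn, hps⟩ := h n hn
    have hn1 := mem_Icc.1 (hS hn)
    obtain ⟨q, a, hq, ha, hqn, hpq⟩ := exists_prime_pow_of_dvd_sig (by omega) hp hps
    have hne : p ≠ q := by
      rintro rfl
      rw [sig_prime_pow hq, sum_range_succ', pow_zero] at hpq
      have h1 : p ∣ ∑ i ∈ range a, p ^ (i + 1) := dvd_sum fun i _ => dvd_pow_self p (by omega)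
      exact hp.one_lt.ne' (Nat.dvd_one.1 ((Nat.dvd_add_right h1).1 hpq))
    have ha1 : a ≠ 1 := by
      rintro rfl
      rw [pow_one] at hpq hqn
      rw [sig_prime hq] at hpq
      obtain ⟨j, hj⟩ := hpq
      refine hnP ⟨p, j, hTp, Nat.pos_of_ne_zero (by rintro rfl; omega), ?_, ?_⟩
      · have := hq.two_le
        omega
      · rw [← hj, Nat.add_sub_cancel]
        exact ((Nat.coprime_primes hp hq).2 hne).mul_dvd_of_dvd_of_dvd hpn hqn
    refine ⟨q, a, hq, by omega, ?_, hqn⟩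
    have h1 : p < 2 * q ^ a := by
      refine (Nat.le_of_dvd (sig_pos (pow_ne_zero _ hq.ne_zero)) hpq).trans_lt ?_
      rw [sig_prime_pow hq, sum_range_succ]
      have := Nat.geomSum_lt (m := q) (n := a) (s := range a) hq.two_le fun k hk => mem_range.1 hk
      omega
    have h2 : (p : ℝ) < 2 * (q ^ a : ℕ) := by exact_mod_cast h1
    linarith
  have h1 : (#{n ∈ S | P1 n} : ℝ) ≤ x * (4 * (1 + Real.log x) / T) := by
    refine (card_le_mul_sum_inv hx0 ((filter_subset _ _).trans hS)
      (((Icc 1 N).filter fun p : ℕ => T < (p : ℝ)) ×ˢ Icc 1 N)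
      (fun i => i.1 * (i.1 * i.2 - 1)) fun n hn => ?_).trans ?_
    · obtain ⟨hn, p, j, hTp, hj, hpj, hd⟩ := mem_filter.1 hn
      have hn1 := mem_Icc.1 (hS hn)
      have hp2 : 2 ≤ p := by
        have : (2 : ℝ) ≤ p := by linarith
        exact_mod_cast this
      have hle := Nat.le_of_dvd hn1.1 hd
      have hpj1 : 1 ≤ p * j - 1 := by omega
      have hpj2 : j ≤ p * j - 1 := by
        have : 2 * j ≤ p * j := Nat.mul_le_mul_right j hp2
        omega
      refine ⟨(p, j), mem_product.2 ⟨mem_filter.2 ⟨mem_Icc.2 ⟨by omega, ?_⟩, hTp⟩,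
        mem_Icc.2 ⟨hj, ?_⟩⟩, hd⟩
      · exact (Nat.le_mul_of_pos_right p hpj1).trans (hle.trans hn1.2)
      · exact hpj2.trans ((Nat.le_mul_of_pos_left _ (by omega)).trans (hle.trans hn1.2))
    · gcongr
      calc _ ≤ ∑ i ∈ ((Icc 1 N).filter fun p : ℕ => T < (p : ℝ)) ×ˢ Icc 1 N,
            2 * (1 / (i.1 : ℝ) ^ 2 * (1 / i.2)) := by
            refine sum_le_sum fun i hi => ?_
            obtain ⟨hi1, hi2⟩ := mem_product.1 hi
            have hp2 : (2 : ℝ) ≤ i.1 := by linarith [(mem_filter.1 hi1).2]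
            have hj1 : (1 : ℝ) ≤ i.2 := by exact_mod_cast (mem_Icc.1 hi2).1
            have hp2' : 2 ≤ i.1 := by exact_mod_cast hp2
            have hle : 1 ≤ i.1 * i.2 := Nat.mul_pos (by omega) (mem_Icc.1 hi2).1
            push_cast [Nat.cast_sub hle]
            have hpj : 2 ≤ (i.1 : ℝ) * i.2 := by nlinarith
            rw [div_mul_div_comm, mul_one, mul_one_div, div_le_div_iff₀
              (mul_pos (by linarith) (by linarith)) (by positivity)]
            nlinarith
        _ = 2 * ((∑ p ∈ (Icc 1 N).filter fun p : ℕ => T < (p : ℝ), 1 / (p : ℝ) ^ 2) *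
              ∑ j ∈ Icc 1 N, 1 / (j : ℝ)) := by
            rw [← mul_sum, sum_mul_sum, sum_product]
        _ ≤ 2 * (2 / T * (1 + Real.log x)) := by
            have h0 : 0 ≤ ∑ j ∈ Icc 1 N, 1 / (j : ℝ) := sum_nonneg fun _ _ => by positivity
            gcongr
            · exact sum_inv_sq_le_of_lt (by linarith) fun p hp => (mem_filter.1 hp).2
            · refine (sum_inv_Icc_le _).trans ?_
              gcongr
              exact Nat.floor_le hx0
        _ = _ := by ring
  have h2 : (#{n ∈ S | ¬ P1 n} : ℝ) ≤ x * (3 / t) := by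
    set M := ⌊t ^ 2⌋₊ + 1 with hM
    have hMt : t ^ 2 ≤ (M : ℝ) := by
      rw [hM]
      push_cast
      exact (Nat.lt_floor_add_one _).le
    refine (card_le_mul_sum_inv hx0 ((filter_subset _ _).trans hS) (Icc 2 N)
      (fun q => q ^ max 2 (Nat.clog q M)) fun n hn => ?_).trans ?_
    · obtain ⟨hn, hnP⟩ := mem_filter.1 hn
      have hn1 := mem_Icc.1 (hS hn)
      obtain ⟨q, a, hq, ha, hta, hd⟩ := hsplit n hn hnP
      refine ⟨q, mem_Icc.2 ⟨hq.two_le, ?_⟩, (pow_dvd_pow q (max_le ha ?_)).trans hd⟩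
      · exact (Nat.le_of_dvd hn1.1 ((dvd_pow_self q (by omega)).trans hd)).trans hn1.2
      · refine Nat.clog_le_of_le_pow ?_
        exact (Nat.floor_lt (by positivity)).2 hta
    · gcongr
      calc ∑ q ∈ Icc 2 N, 1 / ((q ^ max 2 (Nat.clog q M) : ℕ) : ℝ)
          ≤ ∑ q ∈ Icc 2 N, if (q : ℝ) ≤ t then 1 / t ^ 2 else 1 / (q : ℝ) ^ 2 := by
            refine sum_le_sum fun q hq => ?_
            have hq2 := (mem_Icc.1 hq).1
            have hq0 : (0 : ℝ) < q := by exact_mod_cast (by omega : 0 < q)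
            split_ifs
            · gcongr
              refine hMt.trans ?_
              exact_mod_cast (Nat.le_pow_clog (by omega) M).trans
                (Nat.pow_le_pow_right (by omega) (le_max_right _ _))
            · gcongr
              exact_mod_cast Nat.pow_le_pow_right (by omega) (le_max_left _ _)
        _ = #((Icc 2 N).filter fun q : ℕ => (q : ℝ) ≤ t) * (1 / t ^ 2) +
              ∑ q ∈ (Icc 2 N).filter fun q : ℕ => ¬ (q : ℝ) ≤ t, 1 / (q : ℝ) ^ 2 := by
            rw [sum_ite, sum_const, nsmul_eq_mul]
        _ ≤ t * (1 / t ^ 2) + 2 / t := by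
            gcongr
            · calc (#((Icc 2 N).filter fun q : ℕ => (q : ℝ) ≤ t) : ℝ) ≤ #(Icc 1 ⌊t⌋₊) := by
                    refine Nat.cast_le.2 (card_le_card fun q hq => ?_)
                    obtain ⟨hq, hqt⟩ := mem_filter.1 hq
                    have := (mem_Icc.1 hq).1
                    exact mem_Icc.2 ⟨by omega, Nat.le_floor hqt⟩
                _ ≤ t := by
                    rw [Nat.card_Icc, Nat.add_sub_cancel]
                    exact Nat.floor_le ht0.le
            · exact sum_inv_sq_le_of_lt ht0 fun q hq => not_le.1 (mem_filter.1 hq).2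
        _ = _ := by
            field_simp
            norm_num
  have h3 : (#S : ℝ) = #{n ∈ S | P1 n} + #{n ∈ S | ¬ P1 n} := by
    exact_mod_cast (card_filter_add_card_filter_not (s := S) P1).symm
  linarith

lemma card_smooth_le {x y : ℝ} (hx : 1 < x) (hy : 1 ≤ y) {S : Finset ℕ} (hS : S ⊆ Icc 1 ⌊x⌋₊)
    (h : ∀ n ∈ S, ∀ p : ℕ, p.Prime → p ∣ n → (p : ℝ) ≤ y) :
    (#S : ℝ) ≤ √x + 4 * x * (Real.log y + Real.log 4) / Real.log x := by
  have hx0 : 0 < x := by linarith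
  have hlog : 0 < Real.log x := Real.log_pos hx
  have hsum := sum_log_le_of_forall_prime_le S (y := ⌊y⌋₊) (by rwa [Nat.one_le_floor_iff]) hS
    fun n hn p hp hpn => Nat.le_floor (h n hn p hp hpn)
  have h1 : (#(S.filter fun n : ℕ => (n : ℝ) ≤ √x) : ℝ) ≤ √x := by
    calc (#(S.filter fun n : ℕ => (n : ℝ) ≤ √x) : ℝ) ≤ #(Icc 1 ⌊√x⌋₊) := by
          refine Nat.cast_le.2 (card_le_card fun n hn => ?_)
          obtain ⟨hn, hnx⟩ := mem_filter.1 hn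
          exact mem_Icc.2 ⟨(mem_Icc.1 (hS hn)).1, Nat.le_floor hnx⟩
      _ ≤ √x := by
          rw [Nat.card_Icc, Nat.add_sub_cancel]
          exact Nat.floor_le (Real.sqrt_nonneg _)
  have h2 : (#(S.filter fun n : ℕ => ¬ (n : ℝ) ≤ √x) : ℝ) * (Real.log x / 2) ≤
      2 * x * (Real.log y + Real.log 4) := by
    calc (#(S.filter fun n : ℕ => ¬ (n : ℝ) ≤ √x) : ℝ) * (Real.log x / 2)
        = ∑ n ∈ S.filter fun n : ℕ => ¬ (n : ℝ) ≤ √x, Real.log (√x) := by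
          rw [sum_const, nsmul_eq_mul, Real.log_sqrt hx0.le]
      _ ≤ ∑ n ∈ S.filter fun n : ℕ => ¬ (n : ℝ) ≤ √x, Real.log n := by
          refine sum_le_sum fun n hn => ?_
          have := not_le.1 (mem_filter.1 hn).2
          have := Real.sqrt_pos.2 hx0
          gcongr
      _ ≤ ∑ n ∈ S, Real.log n := by
          refine sum_le_sum_of_subset_of_nonneg (filter_subset _ _) fun n hn _ => ?_
          exact Real.log_nonneg (by exact_mod_cast (mem_Icc.1 (hS hn)).1)
      _ ≤ _ := hsum
      _ ≤ _ := by
          have hy1 : (0 : ℝ) < ⌊y⌋₊ := by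
            exact_mod_cast Nat.floor_pos.2 hy
          have : (1 : ℝ) ≤ ⌊y⌋₊ := by exact_mod_cast Nat.floor_pos.2 hy
          have h3 : 0 ≤ Real.log ⌊y⌋₊ + Real.log 4 :=
            add_nonneg (Real.log_nonneg this) (Real.log_nonneg (by norm_num))
          gcongr
          · exact Nat.floor_le hx0.le
          · exact Nat.floor_le (by linarith)
  have h3 : (#S : ℝ) = #(S.filter fun n : ℕ => (n : ℝ) ≤ √x) +
      #(S.filter fun n : ℕ => ¬ (n : ℝ) ≤ √x) := by
    exact_mod_cast (card_filter_add_card_filter_not (s := S) fun n : ℕ => (n : ℝ) ≤ √x).symm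
  have h4 : (#(S.filter fun n : ℕ => ¬ (n : ℝ) ≤ √x) : ℝ) ≤
      4 * x * (Real.log y + Real.log 4) / Real.log x := by
    rw [le_div_iff₀ hlog]
    linarith
  linarith

/-! ### Covering `Ω_x` by boxes -/

lemma maxPrimeFac_mem {n : ℕ} (hn : 2 ≤ n) : maxPrimeFac n ∈ n.primeFactors := by
  rw [maxPrimeFac, if_neg (by omega)]
  obtain ⟨p, hp, h⟩ := exists_mem_eq_sup n.primeFactors (Nat.nonempty_primeFactors.2 (by omega)) id
  rw [h]
  exact hp

lemma prime_maxPrimeFac {n : ℕ} (hn : 2 ≤ n) : (maxPrimeFac n).Prime :=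
  Nat.prime_of_mem_primeFactors (maxPrimeFac_mem hn)

lemma maxPrimeFac_dvd {n : ℕ} (hn : 2 ≤ n) : maxPrimeFac n ∣ n :=
  Nat.dvd_of_mem_primeFactors (maxPrimeFac_mem hn)

lemma le_maxPrimeFac {n p : ℕ} (hn : n ≠ 0) (hp : p.Prime) (h : p ∣ n) : p ≤ maxPrimeFac n := by
  rw [maxPrimeFac, if_neg (by rintro rfl; exact hp.one_lt.ne' (Nat.dvd_one.1 h))]
  exact le_sup (f := id) (Nat.mem_primeFactors.2 ⟨hp, h, hn⟩)

lemma maxPrimeFac_eq {n p : ℕ} (hn : 2 ≤ n) (hp : p.Prime) (h : p ∣ n)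
    (hmax : ∀ q, q.Prime → q ∣ n → q ≤ p) : maxPrimeFac n = p :=
  le_antisymm (hmax _ (prime_maxPrimeFac hn) (maxPrimeFac_dvd hn)) (le_maxPrimeFac (by omega) hp h)

/-- The composite `n ≤ x` whose largest prime factor exceeds `X₀` and divides `n` exactly once. -/
noncomputable def omegaSet (x X₀ : ℝ) : Finset ℕ :=
  (Icc 2 ⌊x⌋₊).filter fun n : ℕ =>
    ¬ n.Prime ∧ (maxPrimeFac n : ℝ) > X₀ ∧ ¬ (maxPrimeFac n) ^ 2 ∣ n

lemma mem_omegaSet {x X₀ : ℝ} {n : ℕ} : n ∈ omegaSet x X₀ ↔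
    (2 ≤ n ∧ n ≤ ⌊x⌋₊) ∧ ¬ n.Prime ∧ X₀ < maxPrimeFac n ∧ ¬ maxPrimeFac n ^ 2 ∣ n := by
  simp [omegaSet]

lemma omegaSet_subset (x X₀ : ℝ) : omegaSet x X₀ ⊆ Icc 1 ⌊x⌋₊ := fun n hn => by
  have := (mem_omegaSet.1 hn).1
  exact mem_Icc.2 ⟨by omega, this.2⟩

lemma exists_eq_mul_prime {x X₀ : ℝ} {n : ℕ} (hn : n ∈ omegaSet x X₀) :
    ∃ m P : ℕ, P.Prime ∧ n = m * P ∧ ¬ P ∣ m ∧ X₀ < P := by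
  obtain ⟨⟨h2, -⟩, -, hX, hsq⟩ := mem_omegaSet.1 hn
  obtain ⟨m, hm⟩ := maxPrimeFac_dvd h2
  refine ⟨m, maxPrimeFac n, prime_maxPrimeFac h2, by rw [mul_comm]; exact hm, fun h => hsq ?_, hX⟩
  rw [sq]
  nth_rw 3 [hm]
  exact mul_dvd_mul_left _ h

lemma le_card_omegaSet {x X₀ : ℝ} (hx : 1 < x) (hX₀ : 1 ≤ X₀) :
    x - (2 + 5 * x / Real.log x + (√x + 4 * x * (Real.log X₀ + Real.log 4) / Real.log x) +
      x * (2 / X₀)) ≤ #(omegaSet x X₀) := by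
  classical
  have hN : x - 1 < ⌊x⌋₊ := Nat.sub_one_lt_floor x
  set T₁ := (Icc 2 ⌊x⌋₊).filter fun n : ℕ => ∀ p, p.Prime → p ∣ n → (p : ℝ) ≤ X₀
  set T₂ := (Icc 2 ⌊x⌋₊).filter fun n : ℕ => ∃ q : ℕ, X₀ < q ∧ q ^ 2 ∣ n
  have hsub : ∀ n ∈ Icc 2 ⌊x⌋₊, n ∈ Icc 1 ⌊x⌋₊ := fun n hn => by
    have := mem_Icc.1 hn
    exact mem_Icc.2 ⟨by omega, this.2⟩
  have h1 := card_smooth_le (S := T₁) hx hX₀ (fun n hn => hsub n (mem_filter.1 hn).1)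
    fun n hn => (mem_filter.1 hn).2
  have h2 := card_sq_dvd_le (S := T₂) (by linarith : 0 ≤ x) (by linarith : 0 < X₀)
    (fun n hn => hsub n (mem_filter.1 hn).1) fun n hn => (mem_filter.1 hn).2
  have h3 := card_primesLE_le hx
  have hcov : Icc 2 ⌊x⌋₊ ⊆ ((omegaSet x X₀ ∪ Nat.primesLE ⌊x⌋₊) ∪ T₁) ∪ T₂ := fun n hn => by
    have hn2 := mem_Icc.1 hn
    by_cases hp : n.Prime
    · simp [Nat.mem_primesLE, hp, hn2.2]
    by_cases hX : X₀ < maxPrimeFac n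
    · by_cases hsq : maxPrimeFac n ^ 2 ∣ n
      · exact mem_union_right _ (mem_filter.2 ⟨hn, _, hX, hsq⟩)
      · exact mem_union_left _ (mem_union_left _ (mem_union_left _
          (mem_omegaSet.2 ⟨hn2, hp, hX, hsq⟩)))
    · refine mem_union_left _ (mem_union_right _ (mem_filter.2 ⟨hn, fun p hp hpn => ?_⟩))
      refine le_trans ?_ (not_lt.1 hX)
      exact_mod_cast le_maxPrimeFac (by omega) hp hpn
  have hc := (card_le_card hcov).trans ((card_union_le _ _).trans (Nat.add_le_add_right
    ((card_union_le _ _).trans (Nat.add_le_add_right (card_union_le _ _) _)) _))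
  rw [Nat.card_Icc] at hc
  have hc' : ⌊x⌋₊ ≤ #(omegaSet x X₀) + #(Nat.primesLE ⌊x⌋₊) + #T₁ + #T₂ + 1 := by omega
  have hc'' : (⌊x⌋₊ : ℝ) ≤ #(omegaSet x X₀) + #(Nat.primesLE ⌊x⌋₊) + #T₁ + #T₂ + 1 := by
    exact_mod_cast hc'
  linarith

/-- The primes `P` admissible as largest prime factor in the box `(m, j)` of mesh `δ`. -/
noncomputable def boxTop (x X₀ δ : ℝ) (i : ℕ × ℕ) : Finset ℕ :=
  (Icc 1 ⌊x⌋₊).filter fun P : ℕ => P.Prime ∧ X₀ < P ∧ Real.exp ((i.2 + 1) * δ) ≤ P ∧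
    i.1 * Real.exp ((i.2 + 1) * δ) * P ≤ x

open Classical in
/-- The primes `Q` admissible as second largest prime factor in the box `(m, j)` of mesh `δ`. -/
noncomputable def boxMid (x : ℝ) (z : ℕ) (δ : ℝ) (i : ℕ × ℕ) : Finset ℕ :=
  (Icc 1 ⌊x⌋₊).filter fun Q : ℕ => Q.Prime ∧ z < Q ∧ (∀ p, p.Prime → p ∣ i.1 → p < Q) ∧
    Real.exp (i.2 * δ) ≤ Q ∧ (Q : ℝ) < Real.exp ((i.2 + 1) * δ)

lemma mem_boxTop {x X₀ δ : ℝ} {i : ℕ × ℕ} {P : ℕ} : P ∈ boxTop x X₀ δ i ↔ P ∈ Icc 1 ⌊x⌋₊ ∧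
    P.Prime ∧ X₀ < P ∧ Real.exp ((i.2 + 1) * δ) ≤ P ∧
      i.1 * Real.exp ((i.2 + 1) * δ) * P ≤ x := by
  rw [boxTop, mem_filter]

lemma mem_boxMid {x δ : ℝ} {z : ℕ} {i : ℕ × ℕ} {Q : ℕ} : Q ∈ boxMid x z δ i ↔ Q ∈ Icc 1 ⌊x⌋₊ ∧
    Q.Prime ∧ z < Q ∧ (∀ p, p.Prime → p ∣ i.1 → p < Q) ∧
      Real.exp (i.2 * δ) ≤ Q ∧ (Q : ℝ) < Real.exp ((i.2 + 1) * δ) := by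
  classical exact mem_filter

/-- The range of the box indices `(m, j)`. -/
noncomputable def boxIndex (x δ : ℝ) : Finset (ℕ × ℕ) :=
  Icc 1 ⌊x⌋₊ ×ˢ range (⌊Real.log x / δ⌋₊ + 1)

/-- The triples `(m, Q, P)`, sorted into boxes. -/
noncomputable def boxTriples (x X₀ : ℝ) (z : ℕ) (δ : ℝ) : Finset (Σ _ : ℕ × ℕ, ℕ × ℕ) :=
  (boxIndex x δ).sigma fun i => boxTop x X₀ δ i ×ˢ boxMid x z δ i

/-- The integer `m Q P` attached to a triple. -/
def boxValue (t : Σ _ : ℕ × ℕ, ℕ × ℕ) : ℕ := t.1.1 * t.2.2 * t.2.1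

/-- The integers captured by the boxes. -/
noncomputable def boxSet (x X₀ : ℝ) (z : ℕ) (δ : ℝ) : Finset ℕ :=
  (boxTriples x X₀ z δ).image boxValue

section Box
variable {x X₀ δ : ℝ} {z m j P Q : ℕ}

lemma lt_of_mem_box (hP : P ∈ boxTop x X₀ δ (m, j)) (hQ : Q ∈ boxMid x z δ (m, j)) : Q < P := by
  have h1 := (mem_boxTop.1 hP).2.2.2.1
  have h2 := (mem_boxMid.1 hQ).2.2.2.2.2
  exact_mod_cast h2.trans_le h1

lemma prime_le_of_dvd_box (hP : P ∈ boxTop x X₀ δ (m, j)) (hQ : Q ∈ boxMid x z δ (m, j)) {q : ℕ}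
    (hq : q.Prime) (h : q ∣ m * Q * P) : q ≤ P := by
  have hPp := (mem_boxTop.1 hP).2.1
  have hQP := lt_of_mem_box hP hQ
  obtain ⟨-, hQp, -, hm, -⟩ := mem_boxMid.1 hQ
  rcases (hq.dvd_mul).1 h with h | h
  · rcases (hq.dvd_mul).1 h with h | h
    · exact (hm q hq h).le.trans hQP.le
    · exact (Nat.le_of_dvd hQp.pos h).trans hQP.le
  · exact Nat.le_of_dvd hPp.pos h

lemma not_dvd_of_mem_box (hP : P ∈ boxTop x X₀ δ (m, j)) (hQ : Q ∈ boxMid x z δ (m, j)) :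
    ¬ Q ∣ m ∧ ¬ P ∣ m := by
  have hPp := (mem_boxTop.1 hP).2.1
  have hQP := lt_of_mem_box hP hQ
  obtain ⟨-, hQp, -, hm, -⟩ := mem_boxMid.1 hQ
  exact ⟨fun h => (hm Q hQp h).false, fun h => (hm P hPp h).not_gt hQP⟩

lemma mul_mul_le_of_mem_box (hP : P ∈ boxTop x X₀ δ (m, j)) (hQ : Q ∈ boxMid x z δ (m, j)) :
    ((m * Q * P : ℕ) : ℝ) ≤ x := by
  have h1 := (mem_boxTop.1 hP).2.2.2.2
  have h2 := (mem_boxMid.1 hQ).2.2.2.2.2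
  refine le_trans ?_ h1
  push_cast
  gcongr

lemma mul_mul_mem_omegaSet (hm : 0 < m) (hP : P ∈ boxTop x X₀ δ (m, j))
    (hQ : Q ∈ boxMid x z δ (m, j)) :
    m * Q * P ∈ omegaSet x X₀ ∧ maxPrimeFac (m * Q * P) = P := by
  have hPp := (mem_boxTop.1 hP).2.1
  have hX := (mem_boxTop.1 hP).2.2.1
  have hQp := (mem_boxMid.1 hQ).2.1
  have hQP := lt_of_mem_box hP hQ
  have hle := Nat.le_floor (mul_mul_le_of_mem_box hP hQ)
  have hmQ : 2 ≤ m * Q := hQp.two_le.trans (Nat.le_mul_of_pos_left _ hm)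
  have h2 : 2 ≤ m * Q * P := hmQ.trans (Nat.le_mul_of_pos_right _ hPp.pos)
  have hmax := maxPrimeFac_eq h2 hPp (Dvd.intro_left _ rfl)
    fun q hq h => prime_le_of_dvd_box hP hQ hq h
  refine ⟨mem_omegaSet.2 ⟨⟨h2, hle⟩, Nat.not_prime_mul (by omega) hPp.one_lt.ne', ?_, ?_⟩, hmax⟩
  · rwa [hmax]
  · rw [hmax, sq, Nat.mul_dvd_mul_iff_right hPp.pos, hPp.dvd_mul]
    rintro (h | h)
    · exact (not_dvd_of_mem_box hP hQ).2 h
    · exact (Nat.le_of_dvd hQp.pos h).not_gt hQP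

lemma maxPrimeFac_mul_of_mem_box (hm : 0 < m) (hQ : Q ∈ boxMid x z δ (m, j)) :
    maxPrimeFac (m * Q) = Q := by
  obtain ⟨-, hQp, -, hmQ, -⟩ := mem_boxMid.1 hQ
  refine maxPrimeFac_eq (hQp.two_le.trans (Nat.le_mul_of_pos_left _ hm)) hQp
    (Dvd.intro_left _ rfl) fun q hq h => ?_
  rcases (hq.dvd_mul).1 h with h | h
  · exact (hmQ q hq h).le
  · exact Nat.le_of_dvd hQp.pos h

end Box

lemma boxValue_injOn (x X₀ : ℝ) (z : ℕ) {δ : ℝ} (hδ : 0 < δ) :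
    Set.InjOn boxValue (boxTriples x X₀ z δ : Set (Σ _ : ℕ × ℕ, ℕ × ℕ)) := by
  rintro ⟨⟨m, j⟩, P, Q⟩ h ⟨⟨m', j'⟩, P', Q'⟩ h' heq
  simp only [boxValue] at heq
  simp only [boxTriples, coe_sigma, Set.mem_sigma_iff, mem_coe, mem_product, boxIndex,
    mem_Icc] at h h'
  obtain ⟨⟨⟨hm, -⟩, -⟩, hP, hQ⟩ := h
  obtain ⟨⟨⟨hm', -⟩, -⟩, hP', hQ'⟩ := h'
  have e1 : P = P' := by
    rw [← (mul_mul_mem_omegaSet hm hP hQ).2, ← (mul_mul_mem_omegaSet hm' hP' hQ').2, heq]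
  subst e1
  have e2 := Nat.eq_of_mul_eq_mul_right (mem_boxTop.1 hP).2.1.pos heq
  have e3 : Q = Q' := by
    rw [← maxPrimeFac_mul_of_mem_box hm hQ, ← maxPrimeFac_mul_of_mem_box hm' hQ', e2]
  subst e3
  have e4 := Nat.eq_of_mul_eq_mul_right (mem_boxMid.1 hQ).2.1.pos e2
  subst e4
  obtain ⟨-, -, -, -, h1, h2⟩ := mem_boxMid.1 hQ
  obtain ⟨-, -, -, -, h3, h4⟩ := mem_boxMid.1 hQ'
  have key : ∀ a b : ℕ, Real.exp (a * δ) < Real.exp ((b + 1) * δ) → a ≤ b := fun a b h => by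
    have := lt_of_mul_lt_mul_right (Real.exp_lt_exp.1 h) hδ.le
    exact Nat.lt_succ_iff.1 (by exact_mod_cast this)
  have e5 : j = j' := le_antisymm (key _ _ (h1.trans_lt h4)) (key _ _ (h3.trans_lt h2))
  subst e5
  rfl

lemma card_filter_boxSet (x X₀ : ℝ) (z : ℕ) {δ : ℝ} (hδ : 0 < δ) (c : ℕ → Prop)
    [DecidablePred c] : #{n ∈ boxSet x X₀ z δ | c n} =
      ∑ i ∈ boxIndex x δ, #{t ∈ boxTop x X₀ δ i ×ˢ boxMid x z δ i | c (i.1 * t.2 * t.1)} := by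
  rw [boxSet, filter_image, card_image_of_injOn
    ((boxValue_injOn x X₀ z hδ).mono (coe_subset.2 (filter_subset _ _)))]
  rw [← card_sigma]
  congr 1
  ext ⟨i, t⟩
  rw [mem_filter, mem_sigma, boxTriples, mem_sigma, mem_filter, boxValue]
  tauto

lemma boxSet_subset (x X₀ : ℝ) (z : ℕ) (δ : ℝ) : boxSet x X₀ z δ ⊆ omegaSet x X₀ := by
  intro n hn
  obtain ⟨⟨⟨m, j⟩, P, Q⟩, ht, rfl⟩ := mem_image.1 hn
  simp only [boxTriples, mem_sigma, mem_product, boxIndex, mem_Icc] at ht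
  exact (mul_mul_mem_omegaSet ht.1.1.1 ht.2.1 ht.2.2).1

lemma mem_boxSet_or {x X₀ δ : ℝ} (hδ : 0 < δ) {z n : ℕ} (hn : n ∈ omegaSet x X₀) :
    n ∈ boxSet x X₀ z δ ∨
    (∃ m P : ℕ, n = m * P ∧ P.Prime ∧ X₀ < P ∧ ∀ p, p.Prime → p ∣ m → p ≤ z) ∨
    (∃ q : ℕ, (z : ℝ) < q ∧ q ^ 2 ∣ n) ∨ x < Real.exp δ * n ∨
    (∃ P Q : ℕ, X₀ < P ∧ Q < P ∧ P < Real.exp δ * Q ∧ P * Q ∣ n) := by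
  obtain ⟨⟨h2, hnx⟩, hnp, hX, hsq⟩ := mem_omegaSet.1 hn
  have hPp := prime_maxPrimeFac h2
  obtain ⟨m₀, hm₀⟩ := maxPrimeFac_dvd h2
  set P := maxPrimeFac n with hP
  have hPm : ¬ P ∣ m₀ := fun h => hsq (by rw [sq]; rw [hm₀]; exact mul_dvd_mul_left _ h)
  have hm₀2 : 2 ≤ m₀ := by
    rcases m₀ with _ | _ | m₀
    · omega
    · exact absurd (by rw [hm₀]; simpa using hPp) hnp
    · omega
  have hQp := prime_maxPrimeFac hm₀2
  obtain ⟨m, hm⟩ := maxPrimeFac_dvd hm₀2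
  have hQmax : ∀ q, q.Prime → q ∣ m₀ → q ≤ maxPrimeFac m₀ :=
    fun q hq h => le_maxPrimeFac (by omega) hq h
  set Q := maxPrimeFac m₀ with hQ
  have hQn : Q ∣ n := by
    rw [hm₀]
    exact (Dvd.intro _ hm.symm).mul_left _
  have hQP : Q < P := by
    refine lt_of_le_of_ne (le_maxPrimeFac (by omega) hQp hQn) fun h => hPm ?_
    rw [← h, hm]
    exact Dvd.intro _ rfl
  have hn_eq : n = m * Q * P := by rw [hm₀, hm]; ring
  have hm0 : 0 < m := Nat.pos_of_ne_zero fun h => by simp [h] at hn_eq; omega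
  by_cases hz : Q ≤ z
  · exact Or.inr (Or.inl ⟨m₀, P, by rw [hm₀, mul_comm], hPp, hX,
      fun p hp h => (hQmax p hp h).trans hz⟩)
  push Not at hz
  by_cases hQ2 : Q ^ 2 ∣ n
  · exact Or.inr (Or.inr (Or.inl ⟨Q, by exact_mod_cast hz, hQ2⟩))
  by_cases hx : x < Real.exp δ * n
  · exact Or.inr (Or.inr (Or.inr (Or.inl hx)))
  by_cases hPQ : (P : ℝ) < Real.exp δ * Q
  · refine Or.inr (Or.inr (Or.inr (Or.inr ⟨P, Q, hX, hQP, hPQ, ?_⟩)))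
    rw [hn_eq]
    exact Dvd.intro m (by ring)
  push Not at hx hPQ
  left
  have hQ1 : (1 : ℝ) ≤ Q := by exact_mod_cast hQp.one_lt.le
  have hQ0 : (0 : ℝ) < Q := by linarith
  have hlQ : 0 ≤ Real.log Q / δ := div_nonneg (Real.log_nonneg hQ1) hδ.le
  set j := ⌊Real.log Q / δ⌋₊ with hj
  have hn0 : n ≤ ⌊x⌋₊ := hnx
  have hn1 : n ≠ 0 := by omega
  have hjle : Real.exp (j * δ) ≤ Q := by
    rw [← Real.le_log_iff_exp_le hQ0, ← le_div_iff₀ hδ]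
    exact Nat.floor_le hlQ
  have hjlt : (Q : ℝ) < Real.exp ((j + 1) * δ) := by
    rw [← Real.log_lt_iff_lt_exp hQ0, ← div_lt_iff₀ hδ]
    exact Nat.lt_floor_add_one _
  have hjw : Real.exp ((j + 1) * δ) ≤ Real.exp δ * Q := by
    rw [add_mul, one_mul, Real.exp_add, mul_comm]
    gcongr
  have hQN : Q ≤ ⌊x⌋₊ := (Nat.le_of_dvd (by omega) hQn).trans hnx
  have hx1 : (n : ℝ) ≤ x := (Nat.le_floor_iff' hn1).1 hnx
  refine mem_image.2 ⟨⟨(m, j), (P, Q)⟩, ?_, hn_eq.symm⟩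
  simp only [boxTriples, mem_sigma, mem_product, boxIndex, mem_Icc, mem_boxTop, mem_boxMid,
    mem_range]
  refine ⟨⟨⟨hm0, ?_⟩, Nat.lt_succ_of_le (Nat.floor_le_floor ?_)⟩,
    ⟨⟨hPp.one_lt.le, ?_⟩, hPp, hX, hjw.trans hPQ, ?_⟩,
    ⟨hQp.one_lt.le, hQN⟩, hQp, hz, fun p hp h => ?_, hjle, hjlt⟩
  · refine le_trans (Nat.le_of_dvd (by omega) ?_) hnx
    rw [hn_eq, mul_assoc]
    exact Dvd.intro _ rfl
  · gcongr
    exact ((Nat.le_floor_iff' hQp.ne_zero).1 hQN)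
  · exact (Nat.le_of_dvd (by omega) (maxPrimeFac_dvd h2)).trans hnx
  · calc _ ≤ (m : ℝ) * (Real.exp δ * Q) * P := by gcongr
      _ = Real.exp δ * n := by rw [hn_eq]; push_cast; ring
      _ ≤ x := hx
  · refine lt_of_le_of_ne (hQmax p hp (hm ▸ h.mul_left Q)) fun hpQ => hQ2 ?_
    rw [hn_eq, sq]
    exact (mul_dvd_mul_right (hpQ ▸ h) Q).mul_right P

lemma card_sdiff_boxSet_le {x X₀ δ : ℝ} (hx : 1 ≤ x) (hX₀ : 1 < X₀) (hδ : 0 < δ) (hδ1 : δ ≤ 1)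
    {z : ℕ} (hz : 0 < z) :
    (#(omegaSet x X₀ \ boxSet x X₀ z δ) : ℝ) ≤
      5 * x / Real.log X₀ * Real.exp (2 * ∑ p ∈ Nat.primesLE z, 1 / (p : ℝ)) + x * (2 / z) +
        (δ * x + 1) + x * (3 * (δ * (1 + Real.log x) + 2 / X₀)) := by
  classical
  have hsub : omegaSet x X₀ \ boxSet x X₀ z δ ⊆ Icc 1 ⌊x⌋₊ :=
    sdiff_subset.trans (omegaSet_subset x X₀)
  set S := omegaSet x X₀ \ boxSet x X₀ z δ with hS
  set T₁ := S.filter fun n => ∃ m P : ℕ, n = m * P ∧ P.Prime ∧ X₀ < P ∧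
    ∀ p, p.Prime → p ∣ m → p ≤ z
  set T₂ := S.filter fun n => ∃ q : ℕ, (z : ℝ) < q ∧ q ^ 2 ∣ n
  set T₃ := S.filter fun n : ℕ => x < Real.exp δ * n
  set T₄ := S.filter fun n => ∃ P Q : ℕ, X₀ < P ∧ Q < P ∧ P < Real.exp δ * Q ∧ P * Q ∣ n
  have h1 := card_smooth_mul_prime_le (S := T₁) hx hX₀ (z := z) ((filter_subset _ _).trans hsub)
    fun n hn => (mem_filter.1 hn).2
  have h2 := card_sq_dvd_le (S := T₂) (by linarith : 0 ≤ x) (by exact_mod_cast hz : (0 : ℝ) < z)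
    ((filter_subset _ _).trans hsub) fun n hn => (mem_filter.1 hn).2
  have h4 := card_close_divisors_le (S := T₄) hx (by linarith) hδ hδ1
    ((filter_subset _ _).trans hsub) fun n hn => (mem_filter.1 hn).2
  have h3 : (#T₃ : ℝ) ≤ δ * x + 1 := by
    have hT : T₃ ⊆ Ioc ⌊x * Real.exp (-δ)⌋₊ ⌊x⌋₊ := fun n hn => by
      obtain ⟨hnS, hn⟩ := mem_filter.1 hn
      refine mem_Ioc.2 ⟨(Nat.floor_lt (by positivity)).2 ?_, (mem_Icc.1 (hsub hnS)).2⟩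
      rw [Real.exp_neg, ← div_eq_mul_inv, div_lt_iff₀ (Real.exp_pos _)]
      linarith
    have hc := card_le_card hT
    rw [Nat.card_Ioc] at hc
    have hle : ⌊x * Real.exp (-δ)⌋₊ ≤ ⌊x⌋₊ := Nat.floor_le_floor
      (mul_le_of_le_one_right (by linarith) (Real.exp_le_one_iff.2 (by linarith)))
    have hc' : (#T₃ : ℝ) ≤ ⌊x⌋₊ - ⌊x * Real.exp (-δ)⌋₊ := by
      rw [← Nat.cast_sub hle]
      exact_mod_cast hc
    have h5 := Nat.floor_le (by linarith : 0 ≤ x)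
    have h6 := Nat.sub_one_lt_floor (x * Real.exp (-δ))
    have h7 := Real.add_one_le_exp (-δ)
    nlinarith
  have hcov : S ⊆ ((T₁ ∪ T₂) ∪ T₃) ∪ T₄ := fun n hn => by
    have hn' := Finset.mem_sdiff.1 hn
    simp only [mem_union, T₁, T₂, T₃, T₄, mem_filter]
    rcases mem_boxSet_or hδ (z := z) hn'.1 with h | h | h | h | h
    · exact absurd h hn'.2
    · exact Or.inl (Or.inl (Or.inl ⟨hn, h⟩))
    · exact Or.inl (Or.inl (Or.inr ⟨hn, h⟩))
    · exact Or.inl (Or.inr ⟨hn, h⟩)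
    · exact Or.inr ⟨hn, h⟩
  have hc := (card_le_card hcov).trans ((card_union_le _ _).trans (Nat.add_le_add_right
    ((card_union_le _ _).trans (Nat.add_le_add_right (card_union_le _ _) _)) _))
  have hc' : (#S : ℝ) ≤ #T₁ + #T₂ + #T₃ + #T₄ := by exact_mod_cast hc
  linarith

lemma boxMid_subset_Ico {x δ : ℝ} {z : ℕ} (hδ : 0 < δ) (hδ1 : δ ≤ 1) {i : ℕ × ℕ}
    (hne : (boxMid x z δ i).Nonempty) (hz : 2 ≤ z * δ / 3) :
    ∃ b v : ℕ, boxMid x z δ i ⊆ Ico b (b + v) ∧ z * δ / 6 ≤ v ∧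
      (v : ℝ) ≤ 3 * δ * Real.exp ((i.2 + 1) * δ) := by
  set w := Real.exp (i.2 * δ) with hw
  have hw1 : Real.exp ((i.2 + 1) * δ) = Real.exp δ * w := by
    rw [add_mul, one_mul, Real.exp_add, mul_comm]
  have he1 : 1 + δ ≤ Real.exp δ := by linarith [Real.add_one_le_exp δ]
  have he2 : Real.exp δ ≤ 1 + 2 * δ := by
    have h := Real.abs_exp_sub_one_sub_id_le (x := δ) (by rwa [abs_of_pos hδ])
    have := (abs_le.1 h).2
    nlinarith
  have hw0 : 0 < w := Real.exp_pos _
  obtain ⟨Q, hQ⟩ := hne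
  have hQ' := mem_boxMid.1 hQ
  have hzw : z ≤ 3 * w := by
    have h1 : (z : ℝ) < Q := by exact_mod_cast hQ'.2.2.1
    have h2 := hQ'.2.2.2.2.2
    rw [hw1] at h2
    nlinarith
  have hδw : 2 ≤ δ * w := by nlinarith
  refine ⟨⌈w⌉₊, ⌈Real.exp δ * w⌉₊ - ⌈w⌉₊, fun q hq => ?_, ?_, ?_⟩
  · obtain ⟨-, -, -, -, h1, h2⟩ := mem_boxMid.1 hq
    rw [hw1] at h2
    rw [mem_Ico]
    have h3 : ⌈w⌉₊ ≤ q := Nat.ceil_le.2 h1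
    have h4 : q < ⌈Real.exp δ * w⌉₊ := Nat.lt_ceil.2 h2
    omega
  all_goals
    have hle : ⌈w⌉₊ ≤ ⌈Real.exp δ * w⌉₊ := Nat.ceil_le_ceil (by nlinarith)
    rw [Nat.cast_sub hle]
    have h1 := Nat.le_ceil w
    have h2 := Nat.ceil_lt_add_one hw0.le
    have h3 := Nat.le_ceil (Real.exp δ * w)
    have h4 := Nat.ceil_lt_add_one (by positivity : 0 ≤ Real.exp δ * w)
  · nlinarith
  · rw [hw1]
    nlinarith

lemma boxTop_subset_Ico {x X₀ δ : ℝ} {i : ℕ × ℕ} (hi : 0 < i.1)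
    (hne : (boxTop x X₀ δ i).Nonempty) :
    ∃ y : ℕ, boxTop x X₀ δ i ⊆ Ico 1 (1 + y) ∧ X₀ ≤ y ∧
      (y : ℝ) ≤ x / (i.1 * Real.exp ((i.2 + 1) * δ)) := by
  have hi' : (0 : ℝ) < i.1 := by exact_mod_cast hi
  set w := Real.exp ((i.2 + 1) * δ) with hw
  have hw0 : 0 < w := Real.exp_pos _
  have hle : ∀ P ∈ boxTop x X₀ δ i, (P : ℝ) ≤ x / (i.1 * w) := fun P hP => by
    rw [le_div_iff₀ (by positivity), mul_comm]
    exact (mem_boxTop.1 hP).2.2.2.2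
  obtain ⟨P, hP⟩ := hne
  have h0 : 0 ≤ x / (i.1 * w) := P.cast_nonneg.trans (hle P hP)
  refine ⟨⌊x / (i.1 * w)⌋₊, fun q hq => ?_, ?_, Nat.floor_le h0⟩
  · have h1 := Nat.le_floor (hle q hq)
    have h2 := (mem_Icc.1 (mem_boxTop.1 hq).1).1
    rw [mem_Ico]
    omega
  · refine (mem_boxTop.1 hP).2.2.1.le.trans ?_
    exact_mod_cast Nat.le_floor (hle P hP)

/-- The primes of `R` dividing neither `m` nor `σ(m)`. -/
def coprimePart (R : Finset ℕ) (m : ℕ) : Finset ℕ := R.filter fun p => ¬ p ∣ m ∧ ¬ p ∣ sig m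

lemma sum_abs_card_box_sub_le (k : ℕ) {x X₀ L : ℝ} {z D E₁ : ℕ} {R : Finset ℕ}
    (hx : 2 ≤ Real.log x) (hR : ∀ p ∈ R, p.Prime) (hlow : ∀ p ∈ R, Real.log x ^ 2 ≤ p)
    (hL1 : 1 ≤ L) (hL : ∑ p ∈ R, 1 / (p : ℝ) ≤ L) (hD : ∀ e ⊆ R, #e ≤ k → ∏ p ∈ e, p ≤ D)
    (hV : 1 ≤ z * (1 / Real.log x ^ 2) / 6)
    (h1 : E₁ * (Real.log x ^ 2) ^ 2 ≤ √(z * (1 / Real.log x ^ 2) / 6))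
    (h2 : Real.exp 1 * L ^ k * (Real.log x ^ 2) ^ 2 ≤ z * (1 / Real.log x ^ 2) / 6)
    (h3 : Real.exp 1 * (2 * Real.log x + 2 * L) ^ k * (Real.log x ^ 2) ^ 2 ≤ E₁)
    (h4 : D ^ 4 * (Real.log x ^ 2) ^ 2 ≤ X₀) {i : ℕ × ℕ} (hi : 0 < i.1) :
    ∑ s ∈ (coprimePart R i.1).powerset with #s ≤ k,
      |(#{t ∈ boxTop x X₀ (1 / Real.log x ^ 2) i ×ˢ boxMid x z (1 / Real.log x ^ 2) i |
          ∀ p ∈ s, p ∣ sOf (i.1 * t.2 * t.1)} : ℝ) -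
        #(boxTop x X₀ (1 / Real.log x ^ 2) i ×ˢ boxMid x z (1 / Real.log x ^ 2) i) *
          ∏ p ∈ s, 1 / (p : ℝ)| ≤
      #(boxTop x X₀ (1 / Real.log x ^ 2) i ×ˢ boxMid x z (1 / Real.log x ^ 2) i) *
        ((2 ^ (k + 1) + 8 * Real.log x) / Real.log x ^ 2 * (Real.exp 1 * L ^ k)) +
      Real.exp 1 * (2 * L) ^ k * (3 / Real.log x ^ 2) *
        (√(#(boxTop x X₀ (1 / Real.log x ^ 2) i ×ˢ boxMid x z (1 / Real.log x ^ 2) i) : ℝ) *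
          √(3 * (1 / Real.log x ^ 2) * x / i.1)) := by
  obtain ⟨m, j⟩ := i
  set ℓ := Real.log x with hℓ
  set δ := 1 / ℓ ^ 2 with hδ
  have hδ0 : 0 < δ := by positivity
  have hδ1 : δ ≤ 1 := by
    rw [hδ, div_le_one (by positivity)]
    nlinarith
  set A := boxTop x X₀ δ (m, j) with hA
  set B := boxMid x z δ (m, j) with hB
  have hsub : coprimePart R m ⊆ R := filter_subset _ _
  by_cases hAe : A.Nonempty
  swap
  · rw [not_nonempty_iff_eq_empty.1 hAe]
    simp
  by_cases hBe : B.Nonempty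
  swap
  · rw [not_nonempty_iff_eq_empty.1 hBe]
    simp
  obtain ⟨y, hAy, hXy, hyx⟩ := boxTop_subset_Ico hi hAe
  obtain ⟨b, v, hBv, hvz, hvδ⟩ := boxMid_subset_Ico hδ0 hδ1 hBe (by linarith)
  have hm : 0 < m := hi
  have hm1 : (1 : ℝ) ≤ m := by exact_mod_cast hm
  obtain ⟨P₀, hP₀⟩ := hAe
  obtain ⟨Q₀, hQ₀⟩ := hBe
  have hx0 : 0 ≤ x := (Nat.cast_nonneg _).trans (mul_mul_le_of_mem_box hP₀ hQ₀)
  have hlog : ∀ n ∈ A ∪ B, Real.log (m * n) ≤ ℓ := by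
    intro n hn
    have key : 0 < n ∧ ((m * n : ℕ) : ℝ) ≤ x := by
      rcases mem_union.1 hn with h | h
      · have hp := (mem_boxTop.1 h).2.1
        have hq := (mem_boxMid.1 hQ₀).2.1
        refine ⟨hp.pos, le_trans ?_ (mul_mul_le_of_mem_box h hQ₀)⟩
        exact_mod_cast Nat.mul_le_mul_right _ (Nat.le_mul_of_pos_right _ hq.pos)
      · have hp := (mem_boxTop.1 hP₀).2.1
        have hq := (mem_boxMid.1 h).2.1
        refine ⟨hq.pos, le_trans ?_ (mul_mul_le_of_mem_box hP₀ h)⟩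
        exact_mod_cast Nat.le_mul_of_pos_right _ hp.pos
    have hn1 : (1 : ℝ) ≤ n := by exact_mod_cast key.1
    push_cast at key
    exact Real.log_le_log (by nlinarith) key.2
  have hv0 : 0 < v := by
    have : (0 : ℝ) < v := by linarith
    exact_mod_cast this
  have hbound := sum_abs_card_dvd_sOf_sub_le k hm (R := coprimePart R m)
    (fun p hp => hR p (hsub hp)) (fun p hp => (mem_filter.1 hp).2) (A := A) (B := B)
    (fun p hp => ⟨(mem_boxTop.1 hp).2.1, (not_dvd_of_mem_box hp hQ₀).2⟩)
    (fun p hp => ⟨(mem_boxMid.1 hp).2.1, (not_dvd_of_mem_box hP₀ hp).1⟩)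
    (disjoint_left.2 fun p hp hq => (lt_of_mem_box hp hq).false) hAy hBv
    (E₀ := ℓ ^ 2) (by nlinarith) (fun p hp => hlow p (hsub hp)) hL1
    ((sum_le_sum_of_subset_of_nonneg hsub fun _ _ _ => by positivity).trans hL)
    hlog (fun e he => hD e (he.trans hsub)) hv0 (h1.trans (Real.sqrt_le_sqrt hvz))
    (h2.trans hvz) h3 (h4.trans hXy) (by linarith)
  rw [card_product]
  push_cast
  refine hbound.trans ?_
  have hw0 : 0 < Real.exp ((j + 1) * δ) := Real.exp_pos _
  have hyv : (y * v : ℝ) ≤ 3 * δ * x / m := by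
    calc (y * v : ℝ) ≤ x / (m * Real.exp ((j + 1) * δ)) * (3 * δ * Real.exp ((j + 1) * δ)) := by
          gcongr
      _ = _ := by field_simp
  have hs : √(#A * #B * (y * v) : ℝ) ≤ √(#A * #B : ℝ) * √(3 * δ * x / m) := by
    rw [← Real.sqrt_mul (by positivity)]
    exact Real.sqrt_le_sqrt (by gcongr)
  have hL0 : 0 ≤ L := by linarith
  have hfin : Real.exp 1 * (2 * L) ^ k * (3 * √(#A * #B * (y * v) : ℝ) / ℓ ^ 2) ≤
      Real.exp 1 * (2 * L) ^ k * (3 / ℓ ^ 2) * (√(#A * #B : ℝ) * √(3 * δ * x / m)) := by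
    calc _ ≤ Real.exp 1 * (2 * L) ^ k * (3 * (√(#A * #B : ℝ) * √(3 * δ * x / m)) / ℓ ^ 2) := by
          gcongr
      _ = _ := by ring
  linarith

lemma card_boxSet (x X₀ : ℝ) (z : ℕ) {δ : ℝ} (hδ : 0 < δ) : #(boxSet x X₀ z δ) =
    ∑ i ∈ boxIndex x δ, #(boxTop x X₀ δ i ×ˢ boxMid x z δ i) := by
  simpa using card_filter_boxSet x X₀ z hδ fun _ => True

lemma card_le_of_subset_Icc {x : ℝ} (hx : 0 ≤ x) {S : Finset ℕ} (hS : S ⊆ Icc 1 ⌊x⌋₊) :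
    (#S : ℝ) ≤ x := by
  refine le_trans ?_ (Nat.floor_le hx)
  have := card_le_card hS
  rw [Nat.card_Icc] at this
  exact_mod_cast this

lemma sum_sum_abs_card_box_sub_le (k : ℕ) {x X₀ L : ℝ} {z D E₁ : ℕ} {R : Finset ℕ} (hx1 : 1 ≤ x)
    (hx : 2 ≤ Real.log x) (hR : ∀ p ∈ R, p.Prime) (hlow : ∀ p ∈ R, Real.log x ^ 2 ≤ p)
    (hL1 : 1 ≤ L) (hL : ∑ p ∈ R, 1 / (p : ℝ) ≤ L) (hD : ∀ e ⊆ R, #e ≤ k → ∏ p ∈ e, p ≤ D)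
    (hV : 1 ≤ z * (1 / Real.log x ^ 2) / 6)
    (h1 : E₁ * (Real.log x ^ 2) ^ 2 ≤ √(z * (1 / Real.log x ^ 2) / 6))
    (h2 : Real.exp 1 * L ^ k * (Real.log x ^ 2) ^ 2 ≤ z * (1 / Real.log x ^ 2) / 6)
    (h3 : Real.exp 1 * (2 * Real.log x + 2 * L) ^ k * (Real.log x ^ 2) ^ 2 ≤ E₁)
    (h4 : D ^ 4 * (Real.log x ^ 2) ^ 2 ≤ X₀) :
    ∑ i ∈ boxIndex x (1 / Real.log x ^ 2), ∑ s ∈ (coprimePart R i.1).powerset with #s ≤ k,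
      |(#{t ∈ boxTop x X₀ (1 / Real.log x ^ 2) i ×ˢ boxMid x z (1 / Real.log x ^ 2) i |
          ∀ p ∈ s, p ∣ sOf (i.1 * t.2 * t.1)} : ℝ) -
        #(boxTop x X₀ (1 / Real.log x ^ 2) i ×ˢ boxMid x z (1 / Real.log x ^ 2) i) *
          ∏ p ∈ s, 1 / (p : ℝ)| ≤
      x * ((2 ^ (k + 1) + 8 * Real.log x) / Real.log x ^ 2 * (Real.exp 1 * L ^ k)) +
        Real.exp 1 * (2 * L) ^ k * (12 * x / Real.log x) := by
  have hbox : ∀ i ∈ boxIndex x (1 / Real.log x ^ 2), 0 < i.1 := fun i hi =>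
    (mem_Icc.1 (mem_product.1 hi).1).1
  refine (sum_le_sum fun i hi => sum_abs_card_box_sub_le k hx hR hlow hL1 hL hD hV h1 h2 h3 h4
    (hbox i hi)).trans ?_
  set ℓ := Real.log x with hℓ
  set δ := 1 / ℓ ^ 2 with hδ
  have hδ0 : 0 < δ := by positivity
  have hδ1 : δ ≤ 1 := by
    rw [hδ, div_le_one (by positivity)]
    nlinarith
  have hx0 : 0 ≤ x := by linarith
  have hL0 : 0 ≤ L := by linarith
  have hcard : ∑ i ∈ boxIndex x δ, (#(boxTop x X₀ δ i ×ˢ boxMid x z δ i) : ℝ) ≤ x := by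
    rw [← Nat.cast_sum, ← card_boxSet x X₀ z hδ0]
    exact card_le_of_subset_Icc hx0 ((boxSet_subset _ _ _ _).trans (omegaSet_subset _ _))
  have hinv : ∑ i ∈ boxIndex x δ, 3 * δ * x / (i.1 : ℝ) ≤ 12 * x * ℓ ^ 2 := by
    rw [boxIndex, sum_product]
    simp only [sum_const, card_range, nsmul_eq_mul]
    have h5 : ∑ m ∈ Icc 1 ⌊x⌋₊, 1 / (m : ℝ) ≤ 1 + ℓ := (sum_inv_Icc_le _).trans
      (add_le_add le_rfl (Real.log_le_log (by exact_mod_cast Nat.floor_pos.2 hx1)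
        (Nat.floor_le hx0)))
    have h6 : ((⌊ℓ / δ⌋₊ + 1 : ℕ) : ℝ) ≤ ℓ / δ + 1 := by
      push_cast
      gcongr
      exact Nat.floor_le (by positivity)
    calc ∑ m ∈ Icc 1 ⌊x⌋₊, ((⌊ℓ / δ⌋₊ + 1 : ℕ) : ℝ) * (3 * δ * x / (m : ℝ))
        = ((⌊ℓ / δ⌋₊ + 1 : ℕ) : ℝ) * (3 * δ * x) * ∑ m ∈ Icc 1 ⌊x⌋₊, 1 / (m : ℝ) := by
          rw [mul_sum]
          exact sum_congr rfl fun _ _ => by ring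
      _ ≤ (ℓ / δ + 1) * (3 * δ * x) * (1 + ℓ) := by
          have : 0 ≤ ∑ m ∈ Icc 1 ⌊x⌋₊, 1 / (m : ℝ) := sum_nonneg fun _ _ => by positivity
          gcongr
      _ = 3 * x * ((ℓ + δ) * (1 + ℓ)) := by field_simp
      _ ≤ 3 * x * ((ℓ + ℓ) * (ℓ + ℓ)) := by
          gcongr <;> linarith
      _ = _ := by ring
  have hcs : ∑ i ∈ boxIndex x δ, √(#(boxTop x X₀ δ i ×ˢ boxMid x z δ i) : ℝ) *
      √(3 * δ * x / i.1) ≤ 4 * x * ℓ := by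
    refine (Real.sum_sqrt_mul_sqrt_le _ (fun _ => by positivity) fun _ => by positivity).trans ?_
    rw [← Real.sqrt_mul (sum_nonneg fun _ _ => by positivity)]
    refine Real.sqrt_le_iff.2 ⟨by positivity, ?_⟩
    calc _ ≤ x * (12 * x * ℓ ^ 2) := by gcongr
      _ ≤ _ := by nlinarith [sq_nonneg (x * ℓ)]
  rw [sum_add_distrib, ← sum_mul, ← mul_sum]
  have e1 : Real.exp 1 * (2 * L) ^ k * (12 * x / ℓ) =
      Real.exp 1 * (2 * L) ^ k * (3 / ℓ ^ 2) * (4 * x * ℓ) := by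
    field_simp
    ring
  rw [e1]
  gcongr

lemma sig_mul_mul_of_mem_box {x X₀ δ : ℝ} {z m j P Q : ℕ} (hP : P ∈ boxTop x X₀ δ (m, j))
    (hQ : Q ∈ boxMid x z δ (m, j)) : sig m ∣ sig (m * Q * P) := by
  have hPp := (mem_boxTop.1 hP).2.1
  have hQp := (mem_boxMid.1 hQ).2.1
  obtain ⟨h1, h2⟩ := not_dvd_of_mem_box hP hQ
  have hc : (m * Q).Coprime P := by
    refine ((Nat.Prime.coprime_iff_not_dvd hPp).2 fun h => ?_).symm
    rcases hPp.dvd_mul.1 h with h | h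
    · exact h2 h
    · exact (Nat.le_of_dvd hQp.pos h).not_gt (lt_of_mem_box hP hQ)
  rw [sig_mul hc, sig_mul ((Nat.Prime.coprime_iff_not_dvd hQp).2 h1).symm, mul_assoc]
  exact Dvd.intro _ rfl

lemma dvd_and_dvd_sig_of_mem_box {x X₀ δ : ℝ} {z m j P Q p : ℕ} (hP : P ∈ boxTop x X₀ δ (m, j))
    (hQ : Q ∈ boxMid x z δ (m, j)) (h : p ∣ m ∨ p ∣ sig m) (hs : p ∣ sOf (m * Q * P)) :
    p ∣ m * Q * P ∧ p ∣ sig (m * Q * P) := by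
  have hadd := sOf_add_self (m * Q * P)
  rcases h with h | h
  · have h1 : p ∣ m * Q * P := (h.mul_right Q).mul_right P
    exact ⟨h1, hadd ▸ hs.add h1⟩
  · have h1 : p ∣ sig (m * Q * P) := h.trans (sig_mul_mul_of_mem_box hP hQ)
    refine ⟨(Nat.dvd_add_right hs).1 (hadd ▸ h1), h1⟩

lemma sum_prod_not_subset_coprimePart_le (k : ℕ) {x L : ℝ} (hx1 : 1 ≤ x) (hx : 0 < Real.log x)
    {R : Finset ℕ} (hR : ∀ p ∈ R, p.Prime) (hlow : ∀ p ∈ R, Real.log x ^ 2 < p) (hL1 : 1 ≤ L)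
    (hL : ∑ p ∈ R, 1 / (p : ℝ) ≤ L) {m : ℕ} (hm : m ∈ Icc 1 ⌊x⌋₊) :
    ∑ s ∈ {s ∈ R.powerset | #s ≤ k} with ¬ s ⊆ coprimePart R m, ∏ p ∈ s, 1 / (p : ℝ) ≤
      6 / Real.log x * (Real.exp 1 * L ^ k) := by
  have hL0 : 0 ≤ L := by linarith
  have hsub : coprimePart R m ⊆ R := filter_subset _ _
  have hm0 : 0 < m := (mem_Icc.1 hm).1
  set B := R \ coprimePart R m with hB
  have hBR : B ⊆ R := sdiff_subset
  calc _ = ∑ s ∈ {s ∈ R.powerset | #s ≤ k} with ¬ Disjoint s B, ∏ p ∈ s, 1 / (p : ℝ) := by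
        congr 1
        refine filter_congr fun s hs => not_congr ?_
        have hsR := mem_powerset.1 (mem_filter.1 hs).1
        constructor
        · exact fun h => disjoint_of_subset_left h disjoint_sdiff
        · refine fun h p hp => by_contra fun hc => ?_
          exact disjoint_left.1 h hp (Finset.mem_sdiff.2 ⟨hsR hp, hc⟩)
    _ ≤ (∑ p ∈ B, 1 / (p : ℝ)) * (Real.exp 1 * L ^ k) :=
        sum_prod_card_not_disjoint_le R B hBR (fun _ _ => by positivity) hL1 hL k
    _ ≤ 6 / Real.log x * (Real.exp 1 * L ^ k) := by
        gcongr
        have hB1 : #B ≤ #{p ∈ R | p ∣ m} + #{p ∈ R | p ∣ sig m} := by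
          refine (card_le_card fun p hp => ?_).trans (card_union_le _ _)
          obtain ⟨hp1, hp2⟩ := Finset.mem_sdiff.1 hp
          simp only [coprimePart, mem_filter, not_and, not_not] at hp2
          simp only [mem_union, mem_filter]
          tauto
        have hlogm : Real.log m ≤ Real.log x := Real.log_le_log (by exact_mod_cast hm0)
          ((Nat.le_floor_iff (by linarith)).1 (mem_Icc.1 hm).2)
        have c1 := card_le_two_mul_log (T := {p ∈ R | p ∣ m}) hm0.ne'
          fun p hp => ⟨hR p (mem_filter.1 hp).1, (mem_filter.1 hp).2⟩
        have c2 := card_le_two_mul_log (T := {p ∈ R | p ∣ sig m}) (sig_pos hm0.ne').ne'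
          fun p hp => ⟨hR p (mem_filter.1 hp).1, (mem_filter.1 hp).2⟩
        have c3 : Real.log (sig m : ℕ) ≤ 2 * Real.log m := by
          rw [show (2 : ℝ) = ((2 : ℕ) : ℝ) by norm_num, ← Real.log_pow]
          exact Real.log_le_log (by exact_mod_cast sig_pos hm0.ne')
            (by exact_mod_cast sig_le_sq)
        have hB2 : (#B : ℝ) ≤ #{p ∈ R | p ∣ m} + #{p ∈ R | p ∣ sig m} := by exact_mod_cast hB1
        calc ∑ p ∈ B, 1 / (p : ℝ) ≤ ∑ _p ∈ B, 1 / Real.log x ^ 2 := by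
              refine sum_le_sum fun p hp => ?_
              have := hlow p (hBR hp)
              gcongr
          _ = #B * (1 / Real.log x ^ 2) := by rw [sum_const, nsmul_eq_mul]
          _ ≤ (6 * Real.log x) * (1 / Real.log x ^ 2) := by gcongr; linarith
          _ = _ := by field_simp

open Classical in
/-- The integers captured by the boxes sharing a prime factor above `T` with their `σ`-value. -/
noncomputable def sharedSet (x X₀ : ℝ) (z : ℕ) (δ T : ℝ) : Finset ℕ :=
  (boxSet x X₀ z δ).filter fun n => ∃ p : ℕ, p.Prime ∧ T < p ∧ p ∣ n ∧ p ∣ sig n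

lemma sum_card_box_not_subset_le {x X₀ δ T : ℝ} {z : ℕ} (hδ : 0 < δ) {R s : Finset ℕ}
    (hR : ∀ p ∈ R, p.Prime) (hlow : ∀ p ∈ R, T < p) (hs : s ⊆ R) :
    ∑ i ∈ boxIndex x δ with ¬ s ⊆ coprimePart R i.1,
      #{t ∈ boxTop x X₀ δ i ×ˢ boxMid x z δ i | ∀ p ∈ s, p ∣ sOf (i.1 * t.2 * t.1)} ≤
      #{n ∈ sharedSet x X₀ z δ T | ∀ p ∈ s, p ∣ sOf n} := by
  classical
  rw [sharedSet, filter_filter]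
  rw [card_filter_boxSet x X₀ z hδ]
  refine (sum_le_sum fun i hi => card_le_card fun t ht => ?_).trans
    (sum_le_sum_of_subset (filter_subset _ _))
  obtain ⟨ht1, ht2⟩ := mem_filter.1 ht
  obtain ⟨hP, hQ⟩ := mem_product.1 ht1
  obtain ⟨p, hp, hpn⟩ := Finset.not_subset.1 (mem_filter.1 hi).2
  have hpR := hs hp
  have hor : p ∣ i.1 ∨ p ∣ sig i.1 := by
    simp only [coprimePart, mem_filter, not_and, not_not] at hpn
    have := hpn hpR
    tauto
  have h2 := dvd_and_dvd_sig_of_mem_box hP hQ hor (ht2 p hp)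
  exact mem_filter.2 ⟨ht1, ⟨p, hR p hpR, hlow p hpR, h2.1, h2.2⟩, ht2⟩

lemma sum_abs_card_boxSet_sub_le (k : ℕ) {x X₀ L : ℝ} {z D E₁ : ℕ} {R : Finset ℕ} (hx1 : 1 ≤ x)
    (hx : 2 ≤ Real.log x) (hR : ∀ p ∈ R, p.Prime) (hlow : ∀ p ∈ R, Real.log x ^ 2 < p)
    (hL1 : 1 ≤ L) (hL : ∑ p ∈ R, 1 / (p : ℝ) ≤ L) (hD : ∀ e ⊆ R, #e ≤ k → ∏ p ∈ e, p ≤ D)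
    (hV : 1 ≤ z * (1 / Real.log x ^ 2) / 6)
    (h1 : E₁ * (Real.log x ^ 2) ^ 2 ≤ √(z * (1 / Real.log x ^ 2) / 6))
    (h2 : Real.exp 1 * L ^ k * (Real.log x ^ 2) ^ 2 ≤ z * (1 / Real.log x ^ 2) / 6)
    (h3 : Real.exp 1 * (2 * Real.log x + 2 * L) ^ k * (Real.log x ^ 2) ^ 2 ≤ E₁)
    (h4 : D ^ 4 * (Real.log x ^ 2) ^ 2 ≤ X₀) :
    ∑ s ∈ R.powerset with #s ≤ k,
      |(#{n ∈ boxSet x X₀ z (1 / Real.log x ^ 2) | ∀ p ∈ s, p ∣ sOf n} : ℝ) -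
        #(boxSet x X₀ z (1 / Real.log x ^ 2)) * ∏ p ∈ s, 1 / (p : ℝ)| ≤
      x * ((2 ^ (k + 1) + 8 * Real.log x) / Real.log x ^ 2 * (Real.exp 1 * L ^ k)) +
        Real.exp 1 * (2 * L) ^ k * (12 * x / Real.log x) +
      (∑ s ∈ R.powerset with #s ≤ k, (#{n ∈ sharedSet x X₀ z (1 / Real.log x ^ 2)
        (Real.log x ^ 2) | ∀ p ∈ s, p ∣ sOf n} : ℝ)) +
      x * (6 / Real.log x * (Real.exp 1 * L ^ k)) := by
  have hmain := sum_sum_abs_card_box_sub_le k (X₀ := X₀) hx1 hx hR (fun p hp => (hlow p hp).le)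
    hL1 hL hD hV h1 h2 h3 h4
  have hδ : 0 < 1 / Real.log x ^ 2 := by positivity
  set δ := 1 / Real.log x ^ 2
  set I := boxIndex x δ with hI
  set 𝒮 := {s ∈ R.powerset | #s ≤ k} with h𝒮
  set W : ℕ × ℕ → Finset ℕ → ℝ := fun i s =>
    (#{t ∈ boxTop x X₀ δ i ×ˢ boxMid x z δ i | ∀ p ∈ s, p ∣ sOf (i.1 * t.2 * t.1)} : ℝ) with hW
  set V : ℕ × ℕ → ℝ := fun i => (#(boxTop x X₀ δ i ×ˢ boxMid x z δ i) : ℝ) with hVdef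
  have hVsum : (#(boxSet x X₀ z δ) : ℝ) = ∑ i ∈ I, V i := by
    rw [card_boxSet x X₀ z hδ]
    push_cast
    rfl
  have hstep : ∀ s ∈ 𝒮, |(#{n ∈ boxSet x X₀ z δ | ∀ p ∈ s, p ∣ sOf n} : ℝ) -
      #(boxSet x X₀ z δ) * ∏ p ∈ s, 1 / (p : ℝ)| ≤
      (∑ i ∈ I, if s ⊆ coprimePart R i.1 then |W i s - V i * ∏ p ∈ s, 1 / (p : ℝ)| else 0) +
        #{n ∈ sharedSet x X₀ z δ (Real.log x ^ 2) | ∀ p ∈ s, p ∣ sOf n} +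
        ∑ i ∈ I, V i * if ¬ s ⊆ coprimePart R i.1 then ∏ p ∈ s, 1 / (p : ℝ) else 0 := by
    intro s hs
    have hsR := mem_powerset.1 (mem_filter.1 hs).1
    have hsh := sum_card_box_not_subset_le (x := x) (X₀ := X₀) (z := z) hδ hR hlow hsR
    have hsh' : ∑ i ∈ I, (if ¬ s ⊆ coprimePart R i.1 then W i s else 0) ≤
        #{n ∈ sharedSet x X₀ z δ (Real.log x ^ 2) | ∀ p ∈ s, p ∣ sOf n} := by
      rw [← sum_filter]
      simp only [hW]
      exact_mod_cast hsh
    have hWsum : (#{n ∈ boxSet x X₀ z δ | ∀ p ∈ s, p ∣ sOf n} : ℝ) = ∑ i ∈ I, W i s := by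
      rw [card_filter_boxSet x X₀ z hδ]
      push_cast
      rfl
    rw [hWsum, hVsum, sum_mul, ← sum_sub_distrib]
    calc |∑ i ∈ I, (W i s - V i * ∏ p ∈ s, 1 / (p : ℝ))|
        ≤ ∑ i ∈ I, |W i s - V i * ∏ p ∈ s, 1 / (p : ℝ)| := abs_sum_le_sum_abs _ _
      _ ≤ ∑ i ∈ I,
          ((if s ⊆ coprimePart R i.1 then |W i s - V i * ∏ p ∈ s, 1 / (p : ℝ)| else 0) +
          (if ¬ s ⊆ coprimePart R i.1 then W i s else 0) +
          V i * if ¬ s ⊆ coprimePart R i.1 then ∏ p ∈ s, 1 / (p : ℝ) else 0) := by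
          refine sum_le_sum fun i _ => ?_
          by_cases hc : s ⊆ coprimePart R i.1
          · simp [hc]
          · simp only [hc, if_false, not_false_eq_true, if_true, zero_add]
            have hW0 : 0 ≤ W i s := Nat.cast_nonneg _
            have hV0 : 0 ≤ V i * ∏ p ∈ s, 1 / (p : ℝ) :=
              mul_nonneg (Nat.cast_nonneg _) (prod_nonneg fun _ _ => by positivity)
            rw [abs_le]
            constructor <;> linarith
      _ ≤ _ := by
          rw [sum_add_distrib, sum_add_distrib]
          gcongr
  refine (sum_le_sum hstep).trans ?_
  rw [sum_add_distrib, sum_add_distrib, sum_comm]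
  refine add_le_add (add_le_add ?_ le_rfl) ?_
  · refine le_trans (sum_le_sum fun i hi => ?_) hmain
    rw [← sum_filter]
    refine sum_le_sum_of_subset_of_nonneg (fun s hs => ?_) fun _ _ _ => abs_nonneg _
    obtain ⟨hs1, hs2⟩ := mem_filter.1 hs
    exact mem_filter.2 ⟨mem_powerset.2 hs2, (mem_filter.1 hs1).2⟩
  · rw [sum_comm]
    calc _ ≤ ∑ i ∈ I, V i * (6 / Real.log x * (Real.exp 1 * L ^ k)) := by
          refine sum_le_sum fun i hi => ?_
          rw [← mul_sum, ← sum_filter]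
          exact mul_le_mul_of_nonneg_left (sum_prod_not_subset_coprimePart_le k hx1 (by linarith)
            hR hlow hL1 hL (mem_product.1 hi).1) (Nat.cast_nonneg _)
      _ ≤ _ := by
          rw [← sum_mul, ← hVsum]
          gcongr
          exact card_le_of_subset_Icc (by linarith)
            ((boxSet_subset _ _ _ _).trans (omegaSet_subset _ _))

lemma sum_abs_card_omegaSet_sub_le (k : ℕ) {x X₀ L : ℝ} {z : ℕ} {δ : ℝ} {R : Finset ℕ}
    (hL1 : 1 ≤ L) (hL : ∑ p ∈ R, 1 / (p : ℝ) ≤ L) :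
    ∑ s ∈ R.powerset with #s ≤ k, |(#{n ∈ omegaSet x X₀ | ∀ p ∈ s, p ∣ sOf n} : ℝ) -
        #(omegaSet x X₀) * ∏ p ∈ s, 1 / (p : ℝ)| ≤
      (∑ s ∈ R.powerset with #s ≤ k, |(#{n ∈ boxSet x X₀ z δ | ∀ p ∈ s, p ∣ sOf n} : ℝ) -
        #(boxSet x X₀ z δ) * ∏ p ∈ s, 1 / (p : ℝ)|) +
      (∑ s ∈ R.powerset with #s ≤ k,
        (#{n ∈ omegaSet x X₀ \ boxSet x X₀ z δ | ∀ p ∈ s, p ∣ sOf n} : ℝ)) +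
      #(omegaSet x X₀ \ boxSet x X₀ z δ) * (Real.exp 1 * L ^ k) := by
  have hsub := boxSet_subset x X₀ z δ
  have hpi := sum_prod_card_le R (a := fun p : ℕ => 1 / (p : ℝ)) (fun _ _ => by positivity)
    hL1 hL k
  refine le_trans ?_ (add_le_add le_rfl (mul_le_mul_of_nonneg_left hpi (Nat.cast_nonneg _)))
  rw [mul_sum, ← sum_add_distrib, ← sum_add_distrib]
  refine sum_le_sum fun s _ => ?_
  set S := omegaSet x X₀ \ boxSet x X₀ z δ
  have hun : boxSet x X₀ z δ ∪ S = omegaSet x X₀ := union_sdiff_of_subset hsub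
  have hdis : Disjoint (boxSet x X₀ z δ) S := disjoint_sdiff
  have e1 : (#(omegaSet x X₀) : ℝ) = #(boxSet x X₀ z δ) + #S := by
    rw [← hun, card_union_of_disjoint hdis]
    push_cast
    rfl
  have e2 : (#{n ∈ omegaSet x X₀ | ∀ p ∈ s, p ∣ sOf n} : ℝ) =
      #{n ∈ boxSet x X₀ z δ | ∀ p ∈ s, p ∣ sOf n} + #{n ∈ S | ∀ p ∈ s, p ∣ sOf n} := by
    rw [← hun, filter_union, card_union_of_disjoint (disjoint_filter_filter hdis)]
    push_cast
    rfl
  rw [e1, e2]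
  set π := ∏ p ∈ s, 1 / (p : ℝ)
  have hπ : 0 ≤ π := prod_nonneg fun _ _ => by positivity
  have h0 : (0 : ℝ) ≤ #{n ∈ S | ∀ p ∈ s, p ∣ sOf n} := Nat.cast_nonneg _
  have h1 : (0 : ℝ) ≤ #S * π := by positivity
  rw [abs_le]
  have h2 := neg_abs_le ((#{n ∈ boxSet x X₀ z δ | ∀ p ∈ s, p ∣ sOf n} : ℝ) -
    #(boxSet x X₀ z δ) * π)
  have h3 := le_abs_self ((#{n ∈ boxSet x X₀ z δ | ∀ p ∈ s, p ∣ sOf n} : ℝ) -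
    #(boxSet x X₀ z δ) * π)
  constructor <;> linarith

/-! ### Choice of parameters -/

/-- The size relations between `x`, `ℓ = log x`, `u = log log x`, `a = log₃ x` and `b = log₄ x`
under which the final estimates hold. -/
structure Regime (k : ℕ) (x ℓ u a b : ℝ) : Prop where
  one_lt : 1 < x
  log_eq : Real.log x = ℓ
  log_log_eq : Real.log ℓ = u
  le_b : 16 ≤ b
  le_log : 12 * 16 ^ (k + 1) ≤ ℓ
  log_log_le : 11 * u ≤ ℓ
  b_le_u : (k + 34) * b ≤ u
  a_pos : 0 < a
  b_le_a : 8 * k * b ≤ a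
  u_mul_b_le : 8 * u * b ≤ ℓ

namespace Regime
variable {k : ℕ} {x ℓ u a b : ℝ}

lemma log_ge (h : Regime k x ℓ u a b) : 192 ≤ ℓ := by
  have h1 := h.le_log
  have h2 : (16 : ℝ) ≤ 16 ^ (k + 1) := le_self_pow₀ (by norm_num) (by omega)
  linarith

lemma b_le (h : Regime k x ℓ u a b) : b ≤ u := by
  have h1 := h.b_le_u
  have h2 := h.le_b
  have h3 : (0 : ℝ) ≤ k := Nat.cast_nonneg k
  nlinarith

lemma u_ge (h : Regime k x ℓ u a b) : 16 ≤ u := h.le_b.trans h.b_le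

lemma log_le_self (h : Regime k x ℓ u a b) : ℓ ≤ x := by
  have := Real.log_le_sub_one_of_pos (by linarith [h.one_lt] : 0 < x)
  linarith [h.log_eq]

lemma log_le_sqrt (h : Regime k x ℓ u a b) : ℓ ≤ 2 * √x := by
  have h0 : 0 < x := by linarith [h.one_lt]
  have h1 := Real.log_le_sub_one_of_pos (Real.sqrt_pos.2 h0)
  rw [Real.log_sqrt h0.le, h.log_eq] at h1
  linarith

lemma exp_u (h : Regime k x ℓ u a b) : Real.exp u = ℓ := by
  rw [← h.log_log_eq, Real.exp_log (by linarith [h.log_ge])]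

lemma rpow_eq (h : Regime k x ℓ u a b) (c : ℝ) : x ^ c = Real.exp (ℓ * c) := by
  rw [Real.rpow_def_of_pos (by linarith [h.one_lt]), h.log_eq]

lemma log_le_rpow (h : Regime k x ℓ u a b) : ℓ ≤ x ^ (1 / b) := by
  have hb : 0 < b := by linarith [h.le_b]
  rw [h.rpow_eq]
  nth_rw 1 [← h.exp_u]
  rw [Real.exp_le_exp, mul_one_div, le_div_iff₀ hb]
  have := h.u_mul_b_le
  have : 0 ≤ u * b := mul_nonneg (by linarith [h.u_ge]) hb.le
  linarith

lemma card_omegaSet_ge (h : Regime k x ℓ u a b) : x / 2 ≤ #(omegaSet x (x ^ (1 / b))) := by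
  have hℓ := h.log_ge
  have hb := h.le_b
  have hx0 : 0 < x := by linarith [h.one_lt]
  have hX := h.log_le_rpow
  have h1 := le_card_omegaSet h.one_lt (by linarith : 1 ≤ x ^ (1 / b))
  refine le_trans ?_ h1
  rw [Real.log_rpow hx0, h.log_eq]
  have e0 : (2 : ℝ) ≤ x * (2 / ℓ) := by
    rw [← mul_div_assoc, le_div_iff₀ (by linarith)]
    linarith [h.log_le_self]
  have e1 : √x ≤ x * (2 / ℓ) := by
    rw [← mul_div_assoc, le_div_iff₀ (by linarith)]
    nlinarith [Real.mul_self_sqrt hx0.le, Real.sqrt_nonneg x, h.log_le_sqrt]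
  have e2 : x * (2 / x ^ (1 / b)) ≤ x * (2 / ℓ) := by gcongr
  have e3 : Real.log 4 ≤ 2 := by
    rw [show (4 : ℝ) = 2 ^ 2 by norm_num, Real.log_pow]
    have := Real.log_two_lt_d9
    push_cast
    linarith
  have e4 : 4 * x * (1 / b * ℓ + Real.log 4) / ℓ ≤ x * (1 / 4) + x * (8 / ℓ) := by
    calc _ = x * (4 / b) + x * (4 * Real.log 4 / ℓ) := by field_simp
      _ ≤ x * (4 / 16) + x * (4 * 2 / ℓ) := by gcongr
      _ = _ := by norm_num
  have e5 : x * (19 / ℓ) ≤ x * (1 / 4) := by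
    refine mul_le_mul_of_nonneg_left ?_ hx0.le
    rw [div_le_div_iff₀ (by linarith) (by norm_num)]
    linarith
  have e6 : 5 * x / ℓ = x * (5 / ℓ) := by ring
  have e7 : x * (19 / ℓ) = 3 * (x * (2 / ℓ)) + x * (5 / ℓ) + x * (8 / ℓ) := by ring
  rw [e6]
  linarith

lemma pow_floor_ge (h : Regime k x ℓ u a b) (B : ℕ) : ℓ ^ B / 2 ≤ ⌊ℓ ^ B⌋₊ := by
  have hℓ := h.log_ge
  have h1 : 1 ≤ ℓ ^ B := one_le_pow₀ (by linarith)
  have h2 := Nat.sub_one_lt_floor (ℓ ^ B)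
  have h3 : (1 : ℝ) ≤ ⌊ℓ ^ B⌋₊ := by exact_mod_cast Nat.floor_pos.2 h1
  linarith

lemma sum_inv_primesLE_floor_pow_le (h : Regime k x ℓ u a b) {B : ℕ} (hB : 1 ≤ B) :
    Real.exp (2 * ∑ p ∈ Nat.primesLE ⌊ℓ ^ B⌋₊, 1 / (p : ℝ)) ≤ (B * u) ^ 22 := by
  have hu := h.u_ge
  have hB' : (1 : ℝ) ≤ B := by exact_mod_cast hB
  have hBu : 16 ≤ B * u := by nlinarith
  have e1 : Real.log (ℓ ^ B) = B * u := by rw [Real.log_pow, h.log_log_eq]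
  have e2 : 1 ≤ Real.log (B * u) := by
    rw [Real.le_log_iff_exp_le (by linarith)]
    linarith [Real.exp_one_lt_d9]
  have h1 := sum_inv_primesLE_le (x := ℓ ^ B) (by rwa [e1])
  rw [e1] at h1
  calc _ ≤ Real.exp (22 * Real.log (B * u)) := Real.exp_le_exp.2 (by linarith)
    _ = _ := by
      rw [show (22 : ℝ) * Real.log (B * u) = Real.log ((B * u) ^ 22) by
        rw [Real.log_pow]; norm_num, Real.exp_log (by positivity)]

lemma card_sdiff_boxSet_le' (h : Regime k x ℓ u a b) {B : ℕ} (hB : 2 ≤ B) :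
    (#(omegaSet x (x ^ (1 / b)) \ boxSet x (x ^ (1 / b)) ⌊ℓ ^ B⌋₊ (1 / ℓ ^ 2)) : ℝ) ≤
      x / ℓ * (21 * B ^ 22 * u ^ 23) := by
  have hℓ := h.log_ge
  have hu := h.u_ge
  have hb := h.le_b
  have hx0 : 0 < x := by linarith [h.one_lt]
  have hX := h.log_le_rpow
  have hB' : (1 : ℝ) ≤ B := by exact_mod_cast (by omega : 1 ≤ B)
  have hz : ℓ ≤ ⌊ℓ ^ B⌋₊ := by
    refine le_trans ?_ (h.pow_floor_ge B)
    have : ℓ ^ 2 ≤ ℓ ^ B := pow_le_pow_right₀ (by linarith) hB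
    nlinarith
  have hz0 : 0 < ⌊ℓ ^ B⌋₊ := by
    have : (0 : ℝ) < ⌊ℓ ^ B⌋₊ := by linarith
    exact_mod_cast this
  have h1 := card_sdiff_boxSet_le h.one_lt.le (by linarith : 1 < x ^ (1 / b))
    (δ := 1 / ℓ ^ 2) (by positivity) (by rw [div_le_one (by positivity)]; nlinarith) hz0
  refine h1.trans ?_
  rw [Real.log_rpow hx0, h.log_eq]
  have e0 : 5 * x / (1 / b * ℓ) *
      Real.exp (2 * ∑ p ∈ Nat.primesLE ⌊ℓ ^ B⌋₊, 1 / (p : ℝ)) ≤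
      x / ℓ * (5 * B ^ 22 * u ^ 23) := by
    have hs := h.sum_inv_primesLE_floor_pow_le (by omega : 1 ≤ B)
    calc _ ≤ 5 * x / (1 / b * ℓ) * (B * u) ^ 22 := by gcongr
      _ = x / ℓ * (5 * B ^ 22 * (b * u ^ 22)) := by field_simp
      _ ≤ x / ℓ * (5 * B ^ 22 * (u * u ^ 22)) := by
          have := h.b_le
          gcongr
      _ = _ := by ring
  have e1 : x * (2 / ⌊ℓ ^ B⌋₊) ≤ x / ℓ * 2 := by
    calc _ ≤ x * (2 / ℓ) := by gcongr
      _ = _ := by ring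
  have e2 : 1 / ℓ ^ 2 * x + 1 ≤ x / ℓ * 2 := by
    have h1 : 1 / ℓ ^ 2 * x ≤ x / ℓ := by
      rw [one_div_mul_eq_div]
      gcongr
      nlinarith
    have h2 : 1 ≤ x / ℓ := by
      rw [le_div_iff₀ (by linarith)]
      linarith [h.log_le_self]
    linarith
  have e3 : x * (3 * (1 / ℓ ^ 2 * (1 + ℓ) + 2 / x ^ (1 / b))) ≤ x / ℓ * 12 := by
    calc _ ≤ x * (3 * (1 / ℓ ^ 2 * (ℓ + ℓ) + 2 / ℓ)) := by
          gcongr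
          linarith
      _ = _ := by field_simp; norm_num
  have e4 : 1 ≤ (B : ℝ) ^ 22 * u ^ 23 :=
    one_le_mul_of_one_le_of_one_le (one_le_pow₀ hB') (one_le_pow₀ (by linarith))
  have e5 : 0 ≤ x / ℓ := by positivity
  nlinarith

lemma card_sharedSet_le (h : Regime k x ℓ u a b) (X₀ : ℝ) (z : ℕ) (δ : ℝ) :
    (#(sharedSet x X₀ z δ (ℓ ^ 2)) : ℝ) ≤ x / ℓ * 14 := by
  classical
  have hℓ := h.log_ge
  have hx0 : 0 < x := by linarith [h.one_lt]
  have h1 := card_dvd_sig_le (T := ℓ ^ 2) h.one_lt.le (by nlinarith)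
    ((filter_subset _ _).trans ((boxSet_subset x X₀ z δ).trans (omegaSet_subset _ _)))
    fun n hn => (mem_filter.1 hn).2
  refine (h1.trans_eq' ?_).trans ?_
  · rw [sharedSet]
  rw [h.log_eq]
  have e1 : ℓ / 2 ≤ √(ℓ ^ 2 / 2) := Real.le_sqrt_of_sq_le (by nlinarith)
  calc _ ≤ x * (4 * (ℓ + ℓ) / ℓ ^ 2) + x * (3 / (ℓ / 2)) := by
        gcongr
        linarith
    _ = _ := by field_simp; norm_num

lemma sum_card_dvd_sOf_le' (h : Regime k x ℓ u a b) {R S : Finset ℕ} (hR : ∀ p ∈ R, p.Prime)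
    (hS : S ⊆ omegaSet x (x ^ (1 / b))) (hL : ∑ p ∈ R, 1 / (p : ℝ) ≤ 11 * u) :
    ∑ s ∈ R.powerset with #s ≤ k, (#{n ∈ S | ∀ p ∈ s, p ∣ sOf n} : ℝ) ≤
      Real.exp 1 * (2 * k + 72) ^ k * u ^ (2 * k) * #S + Real.exp 1 * 5 ^ (k + 1) * (x / ℓ) := by
  have hℓ := h.log_ge
  have hu := h.u_ge
  have hb := h.le_b
  have hx0 : 0 < x := by linarith [h.one_lt]
  have hk : (0 : ℝ) ≤ k := Nat.cast_nonneg k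
  set r := ⌈(k + 33) * u⌉₊ with hr
  have hr1 : (k + 33) * u ≤ r := Nat.le_ceil _
  have hr2 : (r : ℝ) ≤ (k + 34) * u := by
    have := Nat.ceil_lt_add_one (by positivity : 0 ≤ (k + 33) * u)
    linarith
  have hy : x ^ (1 / u ^ 2) = Real.exp (ℓ / u ^ 2) := by rw [h.rpow_eq, mul_one_div]
  have h1 := sum_card_dvd_sOf_le k r (X₀ := x ^ (1 / b)) (y₀ := x ^ (1 / u ^ 2)) h.one_lt.le hR
    (hS.trans (omegaSet_subset _ _)) (fun n hn => exists_eq_mul_prime (hS hn)) hL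
    (by rw [hy]; exact Real.one_lt_exp_iff.2 (by positivity)) (by
      rw [hy, h.rpow_eq, ← Real.exp_nat_mul, Real.exp_le_exp]
      rw [show (r : ℝ) * (ℓ / u ^ 2) = ℓ * (r / u ^ 2) by ring]
      refine mul_le_mul_of_nonneg_left ?_ (by linarith)
      rw [div_le_div_iff₀ (by positivity) (by linarith)]
      calc r * b ≤ (k + 34) * u * b := by gcongr
        _ = (k + 34) * b * u := by ring
        _ ≤ u * u := by
          have := h.b_le_u
          gcongr
        _ = _ := by ring)
  refine h1.trans ?_
  rw [hy, Real.log_exp, h.log_eq]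
  have e1 : 1 + (2 * r + 2 * ℓ / (ℓ / u ^ 2)) ≤ (2 * k + 72) * u ^ 2 := by
    have : 2 * ℓ / (ℓ / u ^ 2) = 2 * u ^ 2 := by field_simp
    rw [this]
    have hu2 : u ≤ u ^ 2 := by nlinarith
    have : (k : ℝ) * u ≤ k * u ^ 2 := by gcongr
    nlinarith
  have e2 : Real.exp (Real.exp 1 * (11 * u) - r) ≤ 1 / (ℓ ^ (k + 2)) := by
    calc _ ≤ Real.exp (-((k + 2 : ℕ) * u)) := by
          rw [Real.exp_le_exp]
          push_cast
          nlinarith [Real.exp_one_lt_d9]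
      _ = _ := by rw [Real.exp_neg, Real.exp_nat_mul, h.exp_u, one_div]
  have e3 : 0 ≤ 1 + (2 * r + 2 * ℓ / (ℓ / u ^ 2)) := by positivity
  refine add_le_add ?_ ?_
  · calc _ ≤ Real.exp 1 * ((2 * k + 72) * u ^ 2) ^ k * #S := by gcongr
      _ = _ := by rw [mul_pow, ← pow_mul]; ring
  · calc _ ≤ Real.exp 1 * (5 * ℓ) ^ k * (x * (5 * ℓ) * (1 / (ℓ ^ (k + 2)))) := by
          gcongr <;> linarith
      _ = _ := by
          rw [mul_pow]
          field_simp
          ring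

end Regime

/-- The primes in `(ℓ², x^{1/a}]` not exceeding `x`. -/
noncomputable def primeRange (x ℓ a : ℝ) : Finset ℕ :=
  (Nat.primesLE ⌊x⌋₊).filter fun p : ℕ => ℓ ^ 2 < p ∧ (p : ℝ) ≤ x ^ (1 / a)

lemma mem_primeRange {x ℓ a : ℝ} {p : ℕ} : p ∈ primeRange x ℓ a ↔
    (p ≤ ⌊x⌋₊ ∧ p.Prime) ∧ ℓ ^ 2 < p ∧ (p : ℝ) ≤ x ^ (1 / a) := by
  rw [primeRange, mem_filter, Nat.mem_primesLE]

namespace Regime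
variable {k : ℕ} {x ℓ u a b : ℝ}

lemma prod_primeRange_le (h : Regime k x ℓ u a b) {e : Finset ℕ} (he : e ⊆ primeRange x ℓ a)
    (hk : #e ≤ k) : ∏ p ∈ e, p ≤ ⌊(x ^ (1 / a)) ^ k⌋₊ := by
  refine Nat.le_floor ?_
  push_cast
  calc ∏ p ∈ e, (p : ℝ) ≤ ∏ _p ∈ e, x ^ (1 / a) :=
        prod_le_prod (fun _ _ => Nat.cast_nonneg _) fun p hp => (mem_primeRange.1 (he hp)).2.2
    _ = (x ^ (1 / a)) ^ #e := prod_const _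
    _ ≤ _ := pow_le_pow_right₀ (Real.one_le_rpow h.one_lt.le (by have := h.a_pos; positivity)) hk

lemma pow_four_mul_le (h : Regime k x ℓ u a b) :
    (⌊(x ^ (1 / a)) ^ k⌋₊ : ℝ) ^ 4 * (ℓ ^ 2) ^ 2 ≤ x ^ (1 / b) := by
  have hℓ := h.log_ge
  have hb := h.le_b
  have ha := h.a_pos
  have hx0 : 0 < x := by linarith [h.one_lt]
  have hnn : 0 ≤ (x ^ (1 / a)) ^ k := by positivity
  calc (⌊(x ^ (1 / a)) ^ k⌋₊ : ℝ) ^ 4 * (ℓ ^ 2) ^ 2 ≤ ((x ^ (1 / a)) ^ k) ^ 4 * (ℓ ^ 2) ^ 2 := by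
        gcongr
        exact Nat.floor_le hnn
    _ = Real.exp ((4 * k : ℕ) * (ℓ * (1 / a)) + (4 : ℕ) * u) := by
        rw [Real.exp_add, Real.exp_nat_mul, Real.exp_nat_mul, h.exp_u, h.rpow_eq]
        ring
    _ ≤ x ^ (1 / b) := by
        rw [h.rpow_eq, Real.exp_le_exp]
        have e1 : 4 * k * (1 / a) ≤ 1 / (2 * b) := by
          rw [mul_one_div, div_le_div_iff₀ ha (by linarith)]
          linarith [h.b_le_a]
        have e2 : 4 * u ≤ ℓ * (1 / (2 * b)) := by
          rw [mul_one_div, le_div_iff₀ (by linarith)]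
          linarith [h.u_mul_b_le]
        have e3 : ℓ * (4 * k * (1 / a)) ≤ ℓ * (1 / (2 * b)) := by gcongr
        have e4 : ℓ * (1 / b) = ℓ * (1 / (2 * b)) + ℓ * (1 / (2 * b)) := by
          field_simp
          norm_num
        push_cast
        linarith

lemma floor_pow_ge (h : Regime k x ℓ u a b) :
    ℓ ^ (2 * k + 18) / 12 ≤ ⌊ℓ ^ (2 * k + 20)⌋₊ * (1 / ℓ ^ 2) / 6 := by
  have hℓ := h.log_ge
  have h1 := h.pow_floor_ge (2 * k + 20)
  calc ℓ ^ (2 * k + 18) / 12 = ℓ ^ (2 * k + 20) / 2 * (1 / ℓ ^ 2) / 6 := by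
        rw [show 2 * k + 20 = 2 * k + 18 + 2 by ring, pow_add]
        field_simp
        ring
    _ ≤ _ := by gcongr

lemma ceil_mul_le_sqrt (h : Regime k x ℓ u a b) :
    (⌈Real.exp 1 * (2 * ℓ + 2 * (11 * u)) ^ k * (ℓ ^ 2) ^ 2⌉₊ : ℝ) * (ℓ ^ 2) ^ 2 ≤
      √(⌊ℓ ^ (2 * k + 20)⌋₊ * (1 / ℓ ^ 2) / 6) := by
  have hℓ := h.log_ge
  have hu := h.u_ge
  refine Real.le_sqrt_of_sq_le (le_trans ?_ h.floor_pow_ge)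
  have h1 : (⌈Real.exp 1 * (2 * ℓ + 2 * (11 * u)) ^ k * (ℓ ^ 2) ^ 2⌉₊ : ℝ) ≤
      4 ^ (k + 1) * ℓ ^ (k + 4) := by
    have hc := Nat.ceil_lt_add_one
      (by positivity : 0 ≤ Real.exp 1 * (2 * ℓ + 2 * (11 * u)) ^ k * (ℓ ^ 2) ^ 2)
    have h2 : Real.exp 1 * (2 * ℓ + 2 * (11 * u)) ^ k * (ℓ ^ 2) ^ 2 ≤
        3 * (4 ^ k * ℓ ^ (k + 4)) := by
      calc _ ≤ 3 * (4 * ℓ) ^ k * (ℓ ^ 2) ^ 2 := by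
            gcongr
            · linarith [Real.exp_one_lt_d9]
            · linarith [h.log_log_le]
        _ = _ := by ring
    have h3 : (1 : ℝ) ≤ 4 ^ k * ℓ ^ (k + 4) :=
      one_le_mul_of_one_le_of_one_le (one_le_pow₀ (by norm_num)) (one_le_pow₀ (by linarith))
    linarith [show (4 : ℝ) ^ (k + 1) * ℓ ^ (k + 4) = 4 * (4 ^ k * ℓ ^ (k + 4)) by ring]
  calc _ ≤ (4 ^ (k + 1) * ℓ ^ (k + 4) * (ℓ ^ 2) ^ 2) ^ 2 := by gcongr
    _ = 12 * 16 ^ (k + 1) * ℓ ^ (2 * k + 16) / 12 := by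
        rw [show (16 : ℝ) ^ (k + 1) = (4 ^ (k + 1)) ^ 2 by
          rw [← pow_mul, mul_comm, pow_mul]
          norm_num]
        ring
    _ ≤ ℓ * ℓ ^ (2 * k + 16) / 12 := by
        have := h.le_log
        gcongr
    _ = ℓ ^ (2 * k + 17) / 12 := by ring
    _ ≤ _ := by
        have := pow_le_pow_right₀ (by linarith : 1 ≤ ℓ) (by omega : 2 * k + 17 ≤ 2 * k + 18)
        linarith

lemma exp_mul_pow_le (h : Regime k x ℓ u a b) :
    Real.exp 1 * (11 * u) ^ k * (ℓ ^ 2) ^ 2 ≤ ⌊ℓ ^ (2 * k + 20)⌋₊ * (1 / ℓ ^ 2) / 6 := by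
  have hℓ := h.log_ge
  have hu := h.u_ge
  refine le_trans ?_ h.floor_pow_ge
  calc _ ≤ 3 * ℓ ^ k * (ℓ ^ 2) ^ 2 := by
        gcongr
        · linarith [Real.exp_one_lt_d9]
        · exact h.log_log_le
    _ = 36 * ℓ ^ (k + 4) / 12 := by ring
    _ ≤ ℓ * ℓ ^ (k + 4) / 12 := by
        gcongr
        linarith
    _ = ℓ ^ (k + 5) / 12 := by ring
    _ ≤ _ := by
        have := pow_le_pow_right₀ (by linarith : 1 ≤ ℓ) (by omega : k + 5 ≤ 2 * k + 18)
        linarith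

end Regime

lemma exists_sum_abs_card_omegaSet_le (k : ℕ) : ∃ C : ℝ, 0 < C ∧ ∀ x ℓ u a b : ℝ,
    Regime k x ℓ u a b → ∑ s ∈ (primeRange x ℓ a).powerset with #s ≤ k,
      |(#{n ∈ omegaSet x (x ^ (1 / b)) | ∀ p ∈ s, p ∣ sOf n} : ℝ) -
        #(omegaSet x (x ^ (1 / b))) * ∏ p ∈ s, 1 / (p : ℝ)| ≤
      C * (x / ℓ * u ^ (2 * k + 23)) := by
  set B : ℕ := 2 * k + 20 with hB
  refine ⟨(2 ^ (k + 1) + 8) * Real.exp 1 * 11 ^ k + 12 * Real.exp 1 * 22 ^ k +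
    (Real.exp 1 * (2 * k + 72) ^ k * 14 + Real.exp 1 * 5 ^ (k + 1)) +
    6 * Real.exp 1 * 11 ^ k +
    (Real.exp 1 * (2 * k + 72) ^ k * (21 * B ^ 22) + Real.exp 1 * 5 ^ (k + 1)) +
    21 * B ^ 22 * Real.exp 1 * 11 ^ k, by positivity, fun x ℓ u a b h => ?_⟩
  have hℓ := h.log_ge
  have hu := h.u_ge
  have hx0 : 0 < x := by linarith [h.one_lt]
  have hR : ∀ p ∈ primeRange x ℓ a, p.Prime := fun p hp => (mem_primeRange.1 hp).1.2
  have hLsum : ∑ p ∈ primeRange x ℓ a, 1 / (p : ℝ) ≤ 11 * u := by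
    refine (sum_le_sum_of_subset_of_nonneg (filter_subset _ _) fun _ _ _ => by positivity).trans ?_
    have := sum_inv_primesLE_le (x := x) (by rw [h.log_eq, h.log_log_eq]; linarith)
    rwa [h.log_eq, h.log_log_eq] at this
  have hV : 1 ≤ ⌊ℓ ^ B⌋₊ * (1 / ℓ ^ 2) / 6 := by
    refine le_trans ?_ h.floor_pow_ge
    have : ℓ ≤ ℓ ^ (2 * k + 18) := le_self_pow₀ (by linarith) (by omega)
    linarith
  have hmain := sum_abs_card_boxSet_sub_le k (x := x) (X₀ := x ^ (1 / b)) (L := 11 * u)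
    (z := ⌊ℓ ^ B⌋₊) (R := primeRange x ℓ a) (D := ⌊(x ^ (1 / a)) ^ k⌋₊)
    (E₁ := ⌈Real.exp 1 * (2 * ℓ + 2 * (11 * u)) ^ k * (ℓ ^ 2) ^ 2⌉₊) h.one_lt.le
  rw [h.log_eq] at hmain
  have hbox := hmain (by linarith) hR (fun p hp => (mem_primeRange.1 hp).2.1) (by linarith) hLsum
    (fun e he hk => h.prod_primeRange_le he hk) hV h.ceil_mul_le_sqrt h.exp_mul_pow_le
    (Nat.le_ceil _) h.pow_four_mul_le
  have hsplit := sum_abs_card_omegaSet_sub_le k (x := x) (X₀ := x ^ (1 / b)) (z := ⌊ℓ ^ B⌋₊)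
    (δ := 1 / ℓ ^ 2) (by linarith : 1 ≤ 11 * u) hLsum
  have hshared := h.sum_card_dvd_sOf_le' (S := sharedSet x (x ^ (1 / b)) ⌊ℓ ^ B⌋₊ (1 / ℓ ^ 2)
    (ℓ ^ 2)) hR (by
      classical
      exact (filter_subset _ _).trans (boxSet_subset _ _ _ _)) hLsum
  have hrest := h.sum_card_dvd_sOf_le' (S := omegaSet x (x ^ (1 / b)) \
    boxSet x (x ^ (1 / b)) ⌊ℓ ^ B⌋₊ (1 / ℓ ^ 2)) hR sdiff_subset hLsum
  have hc1 := h.card_sdiff_boxSet_le' (by omega : 2 ≤ B)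
  have hc2 := h.card_sharedSet_le (x ^ (1 / b)) ⌊ℓ ^ B⌋₊ (1 / ℓ ^ 2)
  set y := x / ℓ with hy
  have hy0 : 0 < y := by positivity
  set v := y * u ^ (2 * k + 23) with hv
  have hpow : ∀ n ≤ 2 * k + 23, y * u ^ n ≤ v := fun n hn => by
    rw [hv]
    gcongr
    linarith
  have t1 : x * ((2 ^ (k + 1) + 8 * ℓ) / ℓ ^ 2 * (Real.exp 1 * (11 * u) ^ k)) ≤
      (2 ^ (k + 1) + 8) * Real.exp 1 * 11 ^ k * v := by
    calc _ ≤ x * ((2 ^ (k + 1) * ℓ + 8 * ℓ) / ℓ ^ 2 * (Real.exp 1 * (11 * u) ^ k)) := by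
          gcongr
          exact le_mul_of_one_le_right (by positivity) (by linarith)
      _ = (2 ^ (k + 1) + 8) * Real.exp 1 * 11 ^ k * (y * u ^ k) := by
          rw [hy, mul_pow]
          field_simp
      _ ≤ _ := by
          gcongr
          exact hpow k (by omega)
  have t2 : Real.exp 1 * (2 * (11 * u)) ^ k * (12 * x / ℓ) ≤ 12 * Real.exp 1 * 22 ^ k * v := by
    calc _ = 12 * Real.exp 1 * 22 ^ k * (y * u ^ k) := by
          rw [hy, ← mul_assoc, mul_pow]
          ring
      _ ≤ _ := by
          gcongr
          exact hpow k (by omega)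
  have hyv : y ≤ v := by simpa using hpow 0 (by omega)
  have t3 : Real.exp 1 * (2 * k + 72) ^ k * u ^ (2 * k) *
      #(sharedSet x (x ^ (1 / b)) ⌊ℓ ^ B⌋₊ (1 / ℓ ^ 2) (ℓ ^ 2)) +
      Real.exp 1 * 5 ^ (k + 1) * y ≤
      (Real.exp 1 * (2 * k + 72) ^ k * 14 + Real.exp 1 * 5 ^ (k + 1)) * v := by
    calc _ ≤ Real.exp 1 * (2 * k + 72) ^ k * u ^ (2 * k) * (y * 14) +
          Real.exp 1 * 5 ^ (k + 1) * y := by gcongr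
      _ = Real.exp 1 * (2 * k + 72) ^ k * 14 * (y * u ^ (2 * k)) +
          Real.exp 1 * 5 ^ (k + 1) * y := by ring
      _ ≤ Real.exp 1 * (2 * k + 72) ^ k * 14 * v + Real.exp 1 * 5 ^ (k + 1) * v := by
          gcongr
          exact hpow _ (by omega)
      _ = _ := by ring
  have t4 : x * (6 / ℓ * (Real.exp 1 * (11 * u) ^ k)) ≤ 6 * Real.exp 1 * 11 ^ k * v := by
    calc _ = 6 * Real.exp 1 * 11 ^ k * (y * u ^ k) := by
          rw [hy, mul_pow]
          ring
      _ ≤ _ := by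
          gcongr
          exact hpow k (by omega)
  have t5 : Real.exp 1 * (2 * k + 72) ^ k * u ^ (2 * k) *
      #(omegaSet x (x ^ (1 / b)) \ boxSet x (x ^ (1 / b)) ⌊ℓ ^ B⌋₊ (1 / ℓ ^ 2)) +
      Real.exp 1 * 5 ^ (k + 1) * y ≤
      (Real.exp 1 * (2 * k + 72) ^ k * (21 * B ^ 22) + Real.exp 1 * 5 ^ (k + 1)) * v := by
    calc _ ≤ Real.exp 1 * (2 * k + 72) ^ k * u ^ (2 * k) * (y * (21 * B ^ 22 * u ^ 23)) +
          Real.exp 1 * 5 ^ (k + 1) * v := by gcongr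
      _ = _ := by
          rw [hv, pow_add]
          ring
  have t6 : #(omegaSet x (x ^ (1 / b)) \ boxSet x (x ^ (1 / b)) ⌊ℓ ^ B⌋₊ (1 / ℓ ^ 2)) *
      (Real.exp 1 * (11 * u) ^ k) ≤ 21 * B ^ 22 * Real.exp 1 * 11 ^ k * v := by
    calc _ ≤ y * (21 * B ^ 22 * u ^ 23) * (Real.exp 1 * (11 * u) ^ k) := by gcongr
      _ = 21 * B ^ 22 * Real.exp 1 * 11 ^ k * (y * u ^ (k + 23)) := by
          rw [mul_pow, pow_add]
          ring
      _ ≤ _ := by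
          gcongr
          exact hpow _ (by omega)
  refine hsplit.trans ?_
  linarith

lemma eventually_regime (k : ℕ) : ∀ᶠ x : ℝ in atTop,
    Regime k x (Real.log x) (Real.log (Real.log x)) (Real.log (Real.log (Real.log x)))
      (Real.log (Real.log (Real.log (Real.log x)))) := by
  have hlin : ∀ c : ℝ, 0 < c → ∀ᶠ y : ℝ in atTop, c * Real.log y ≤ y := fun c hc => by
    filter_upwards [Real.isLittleO_log_id_atTop.bound (inv_pos.2 hc), eventually_ge_atTop 1]
      with y hy hy1
    rw [id_eq, Real.norm_of_nonneg (Real.log_nonneg hy1), Real.norm_of_nonneg (by linarith)] at hy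
    rw [← le_div_iff₀' hc]
    linarith [inv_mul_eq_div c y]
  have hsq : ∀ᶠ y : ℝ in atTop, 8 * Real.log y * Real.log y ≤ y := by
    filter_upwards [(Real.isLittleO_pow_log_id_atTop (n := 2)).bound (by norm_num : (0 : ℝ) < 1 / 8),
      eventually_ge_atTop 1] with y hy hy1
    rw [id_eq, Real.norm_of_nonneg (by positivity), Real.norm_of_nonneg (by linarith)] at hy
    linarith [sq (Real.log y)]
  have T1 := Real.tendsto_log_atTop
  have T2 := T1.comp T1
  have T3 := T1.comp T2
  have T4 := T1.comp T3
  filter_upwards [eventually_gt_atTop 1, T4.eventually_ge_atTop 16,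
    T1.eventually_ge_atTop (12 * 16 ^ (k + 1)), T1.eventually (hlin 11 (by norm_num)),
    T2.eventually (hlin (k + 34) (by positivity)), T3.eventually_gt_atTop 0,
    T3.eventually (hlin (8 * k + 1) (by positivity)), T1.eventually hsq,
    T2.eventually (hlin 1 one_pos), T3.eventually (hlin 1 one_pos), T2.eventually_ge_atTop 0]
    with x h1 h2 h3 h4 h5 h6 h7 h8 h9 h10 h11
  simp only [Function.comp] at *
  refine ⟨h1, rfl, rfl, h2, h3, h4, ?_, h6, by linarith, ?_⟩
  · refine le_trans ?_ h5
    exact mul_le_mul_of_nonneg_left (by linarith) (by positivity)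
  · refine le_trans ?_ h8
    exact mul_le_mul_of_nonneg_left (by linarith) (by linarith)

/-- The squarefree `d ≤ x` with at most `k` prime factors, all of them in `(ℓ², x^{1/a}]`. -/
noncomputable def moduli (k : ℕ) (x ℓ a : ℝ) : Finset ℕ :=
  (range (⌊x⌋₊ + 1)).filter fun d : ℕ => Squarefree d ∧ #d.primeFactors ≤ k ∧
    ∀ p ∈ d.primeFactors, ℓ ^ 2 < (p : ℝ) ∧ (p : ℝ) ≤ x ^ (1 / a)

lemma sum_moduli_le {k : ℕ} {x ℓ a : ℝ} (f : Finset ℕ → ℝ) (hf : ∀ s, 0 ≤ f s) :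
    ∑ d ∈ moduli k x ℓ a, f d.primeFactors ≤
      ∑ s ∈ (primeRange x ℓ a).powerset with #s ≤ k, f s := by
  have hinj : Set.InjOn Nat.primeFactors (moduli k x ℓ a : Set ℕ) := fun d hd e he hde => by
    rw [← Nat.prod_primeFactors_of_squarefree (mem_filter.1 hd).2.1, hde,
      Nat.prod_primeFactors_of_squarefree (mem_filter.1 he).2.1]
  rw [← sum_image (f := f) hinj]
  refine sum_le_sum_of_subset_of_nonneg (fun s hs => ?_) fun s _ _ => hf s
  obtain ⟨d, hd, rfl⟩ := mem_image.1 hs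
  obtain ⟨hdx, hsq, hk, hp⟩ := mem_filter.1 hd
  refine mem_filter.2 ⟨mem_powerset.2 fun p hpd => mem_primeRange.2 ⟨⟨?_, ?_⟩, hp p hpd⟩, hk⟩
  · exact (Nat.le_of_mem_primeFactors hpd).trans (Nat.lt_succ_iff.1 (mem_range.1 hdx))
  · exact Nat.prime_of_mem_primeFactors hpd

lemma abs_ratio_sub_eq {S : Finset ℕ} (hS : 0 < #S) {d : ℕ} (hd : Squarefree d) :
    |(#{n ∈ S | d ∣ sOf n} : ℝ) / #S - 1 / d| =
      |(#{n ∈ S | ∀ p ∈ d.primeFactors, p ∣ sOf n} : ℝ) -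
        #S * ∏ p ∈ d.primeFactors, 1 / (p : ℝ)| / #S := by
  have hS' : (0 : ℝ) < #S := Nat.cast_pos.2 hS
  have h1 : ∀ n, d ∣ n ↔ ∀ p ∈ d.primeFactors, p ∣ n := fun n => by
    rw [← prod_primes_dvd_iff fun p hp => Nat.prime_of_mem_primeFactors hp,
      Nat.prod_primeFactors_of_squarefree hd]
  have h2 : ∏ p ∈ d.primeFactors, 1 / (p : ℝ) = 1 / d := by
    rw [prod_div_distrib, prod_const_one, ← Nat.cast_prod, Nat.prod_primeFactors_of_squarefree hd]
  simp only [h1]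
  rw [h2, ← abs_of_pos hS', ← abs_div, abs_of_pos hS', sub_div, mul_div_cancel_left₀ _ hS'.ne']

lemma Regime.sum_moduli_abs_le {k : ℕ} {x ℓ u a b C : ℝ} (h : Regime k x ℓ u a b)
    (hC : ∑ s ∈ (primeRange x ℓ a).powerset with #s ≤ k,
      |(#{n ∈ omegaSet x (x ^ (1 / b)) | ∀ p ∈ s, p ∣ sOf n} : ℝ) -
        #(omegaSet x (x ^ (1 / b))) * ∏ p ∈ s, 1 / (p : ℝ)| ≤
      C * (x / ℓ * u ^ (2 * k + 23))) :
    ∑ d ∈ moduli k x ℓ a, |(#{n ∈ omegaSet x (x ^ (1 / b)) | d ∣ sOf n} : ℝ) /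
      #(omegaSet x (x ^ (1 / b))) - 1 / d| ≤ 2 * C * u ^ (2 * k + 23) / ℓ := by
  have hx0 : 0 < x := by linarith [h.one_lt]
  have hℓ := h.log_ge
  have hcard := h.card_omegaSet_ge
  set S := omegaSet x (x ^ (1 / b))
  have hS : (0 : ℝ) < #S := by linarith
  rw [sum_congr rfl fun d hd => abs_ratio_sub_eq (Nat.cast_pos.1 hS) (mem_filter.1 hd).2.1]
  refine (sum_moduli_le (fun s => |(#{n ∈ S | ∀ p ∈ s, p ∣ sOf n} : ℝ) -
    #S * ∏ p ∈ s, 1 / (p : ℝ)| / #S) fun s => by positivity).trans ?_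
  rw [← sum_div, div_le_iff₀ hS]
  have hC0 := (sum_nonneg fun s _ => abs_nonneg _).trans hC
  calc _ ≤ C * (x / ℓ * u ^ (2 * k + 23)) := hC
    _ = 2 * (C * (x / ℓ * u ^ (2 * k + 23))) / x * (x / 2) := by field_simp
    _ ≤ 2 * (C * (x / ℓ * u ^ (2 * k + 23))) / x * #S := by gcongr
    _ = _ := by field_simp

end LevelOfDistribution

/-- Fix a positive integer `k`. There is `C = C(k)` such that for all sufficiently
large `x`, `Σ_d |#{n ∈ Ω_x : d ∣ s(n)}/#Ω_x − 1/d| ≤ C (log log x)^C / log x`, the sum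
being over squarefree `d` with at most `k` prime factors, all of whose prime factors `p`
satisfy `(log x)² < p ≤ x^{1/log₃ x}`. -/
theorem level_of_distribution_s (k : ℕ) (hk : 0 < k) :
    ∃ C : ℝ, 0 < C ∧ ∀ᶠ x : ℝ in atTop,
      ∑ d ∈ (Finset.range (⌊x⌋₊ + 1)).filter (fun d : ℕ =>
          Squarefree d ∧ d.primeFactors.card ≤ k ∧
          ∀ p ∈ d.primeFactors, (Real.log x) ^ 2 < (p : ℝ) ∧
            (p : ℝ) ≤ x ^ (1 / Real.log (Real.log (Real.log x)))),
        |(((OmegaSet x).filter (fun n => d ∣ sOf n)).card : ℝ) / ((OmegaSet x).card : ℝ)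
          - 1 / d|
      ≤ C * (Real.log (Real.log x)) ^ C / Real.log x := by
  obtain ⟨C, hC, hmain⟩ := LevelOfDistribution.exists_sum_abs_card_omegaSet_le k
  refine ⟨2 * C + (2 * k + 23 : ℕ), by positivity, ?_⟩
  filter_upwards [LevelOfDistribution.eventually_regime k] with x h
  have hu := h.u_ge
  have hℓ := h.log_ge
  refine (h.sum_moduli_abs_le (hmain _ _ _ _ _ h)).trans ?_
  have hpow : Real.log (Real.log x) ^ (2 * k + 23) ≤
      Real.log (Real.log x) ^ (2 * C + (2 * k + 23 : ℕ)) := by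
    rw [← Real.rpow_natCast]
    exact Real.rpow_le_rpow_of_exponent_le (by linarith) (by linarith)
  have hc : 2 * C ≤ 2 * C + (2 * k + 23 : ℕ) := le_add_of_nonneg_right (Nat.cast_nonneg _)
  gcongr
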